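/- Let d be either d = pq for two primes p ≡ q ≡ 3 (mod 8), or d = p for a prime p ≡ 9 (mod 16) such that 2 is a fourth power residue modulo p. Then the order of the 2-Sylow subgroup of the ideal class group of L_{1,d} = ℚ(ζ₈, √d) equals h₂(-2d). -/

import Mathlib

open IntermediateField NumberField

/-- The quadratic field `ℚ(√m)` realized inside `ℂ` (for `m` of either sign). -/
noncomputable def quadField (m : ℤ) : IntermediateField ℚ ℂ :=
  IntermediateField.adjoin ℚ {z : ℂ | z ^ 2 = (m : ℂ)}

/-- The 2-class group of a number field `K ⊆ ℂ`: the 2-primary component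
(= 2-Sylow subgroup) of the ideal class group of its ring of integers. -/
noncomputable def twoClassGroup (K : IntermediateField ℚ ℂ) :
    Subgroup (ClassGroup (𝓞 K)) :=
  CommGroup.primaryComponent _ 2

/-- `h₂(m)`: the 2-class number of the quadratic field `ℚ(√m)`. -/
noncomputable def h2 (m : ℤ) : ℕ := Nat.card (twoClassGroup (quadField m))

/-- `L_{n,d} = ℚ(ζ_{2^{n+2}}, √d)`, the `n`-th layer of the cyclotomic
`ℤ₂`-extension of `ℚ(√d, √-1)`. -/
noncomputable def Lfield (n : ℕ) (d : ℤ) : IntermediateField ℚ ℂ :=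
  IntermediateField.adjoin ℚ
    ({z : ℂ | z ^ 2 ^ (n + 2) = 1} ∪ {z : ℂ | z ^ 2 = (d : ℂ)})

/-- `ℚ(ζ_{2^{n+2}} + ζ_{2^{n+2}}⁻¹, √d) = ℚ(2cos(2π/2^{n+2}), √d)`.
For `d > 0` this is the maximal real subfield `L_{n,d}⁺` of `L_{n,d}`;
for `d < 0` it is the `n`-th layer `K_{n,|d|}` of the cyclotomic
`ℤ₂`-extension of the imaginary quadratic field `ℚ(√d)`. -/
noncomputable def LplusField (n : ℕ) (d : ℤ) : IntermediateField ℚ ℂ :=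
  IntermediateField.adjoin ℚ
    ({((2 * Real.cos (2 * Real.pi / 2 ^ (n + 2)) : ℝ) : ℂ)} ∪ {z : ℂ | z ^ 2 = (d : ℂ)})

section EulerProduct
open UniqueFactorizationMonoid

variable {R : Type*} [CommRing R] [IsDedekindDomain R]

/-- nonzero ideals all of whose prime factors lie in `S` -/
def smoothIdeals (S : Set (Ideal R)) : Set (Ideal R) :=
  {I | I ≠ ⊥ ∧ ∀ P : Ideal R, P.IsPrime → P ∣ I → P ∈ S}

theorem hasSum_smoothIdeals (F : Ideal R →* ℝ) (S : Finset (Ideal R))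
    (hS : ∀ P ∈ S, P.IsPrime ∧ P ≠ ⊥ ∧ 0 ≤ F P ∧ F P < 1)  :
    HasSum (fun I : smoothIdeals (S : Set (Ideal R)) => F I) (∏ P ∈ S, (1 - F P)⁻¹) ∧
    ∀ I ∈ smoothIdeals (S : Set (Ideal R)), 0 ≤ F I := by
  classical
  induction S using Finset.induction_on with
  | empty =>
    have h1 : smoothIdeals ((∅ : Finset (Ideal R)) : Set (Ideal R)) = {⊤} := by
      ext I
      simp only [smoothIdeals, Finset.coe_empty, Set.mem_empty_iff_false, imp_false,
        Set.mem_ofPred_eq, Set.mem_singleton_iff]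
      constructor
      · rintro ⟨h0, h⟩
        by_contra hI
        obtain ⟨M, hM, hle⟩ := Ideal.exists_le_maximal I hI
        exact h M hM.isPrime (Ideal.dvd_iff_le.mpr hle)
      · rintro rfl
        refine ⟨top_ne_bot, fun P hP hd => hP.ne_top ?_⟩
        exact top_le_iff.mp (Ideal.dvd_iff_le.mp hd)
    rw [h1]
    have h2 : F ⊤ = 1 := by rw [← Ideal.one_eq_top, map_one]
    constructor
    · have := hasSum_unique (fun I : ({⊤} : Set (Ideal R)) => F I)
      simpa [h2] using this
    · rintro I rfl
      rw [h2]; norm_num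
  | insert P S hPS ih =>
    obtain ⟨ih1, ih2⟩ := ih (fun Q hQ => hS Q (Finset.mem_insert_of_mem hQ))
    obtain ⟨hP, hP0, hF0, hF1⟩ := hS P (Finset.mem_insert_self _ _)
    have hPp : Prime P := Ideal.prime_of_isPrime hP0 hP
    have hmem : ∀ x : ℕ × smoothIdeals (S : Set (Ideal R)),
        P ^ x.1 * (x.2 : Ideal R) ∈ smoothIdeals ((insert P S : Finset _) : Set (Ideal R)) := by
      rintro ⟨n, I, hI0, hI⟩
      refine ⟨mul_ne_zero (pow_ne_zero _ hP0) hI0, fun Q hQ hd => ?_⟩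
      have hQ0 : Q ≠ ⊥ := by
        rintro rfl
        have := zero_dvd_iff.mp hd
        exact mul_ne_zero (pow_ne_zero _ hP0) hI0 this
      have hQp : Prime Q := Ideal.prime_of_isPrime hQ0 hQ
      rcases hQp.dvd_or_dvd hd with h | h
      · have := hQp.dvd_of_dvd_pow h
        have : Q = P := by
          have := (hQp.associated_of_dvd hPp this)
          exact associated_iff_eq.mp this
        simp [this]
      · simp [hI Q hQ h]
    have hPn : ∀ I ∈ smoothIdeals (S : Set (Ideal R)), ¬ P ∣ I := fun I hI hd => hPS (by simpa using hI.2 P hP hd)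
    let e : ℕ × smoothIdeals (S : Set (Ideal R)) → smoothIdeals ((insert P S : Finset _) : Set (Ideal R)) :=
      fun x => ⟨_, hmem x⟩
    have he : Function.Bijective e := by
      constructor
      · rintro ⟨n, I, hI⟩ ⟨m, J, hJ⟩ h
        have h' : P ^ n * I = P ^ m * J := congrArg Subtype.val h
        have hnm : n = m := by
          have h1 : emultiplicity P (P ^ n * I) = n := by
            rw [emultiplicity_mul hPp, emultiplicity_pow_self hP0 hPp.not_isUnit,
              emultiplicity_eq_zero.mpr (hPn I hI), add_zero]
          have h2 : emultiplicity P (P ^ m * J) = m := by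
            rw [emultiplicity_mul hPp, emultiplicity_pow_self hP0 hPp.not_isUnit,
              emultiplicity_eq_zero.mpr (hPn J hJ), add_zero]
          rw [h', h2] at h1
          exact_mod_cast h1.symm
        subst hnm
        have := mul_left_cancel₀ (pow_ne_zero n hP0) h'
        simp [this]
      · rintro ⟨J, hJ0, hJ⟩
        obtain ⟨I, hE, hnd⟩ := FiniteMultiplicity.exists_eq_pow_mul_and_not_dvd
          (FiniteMultiplicity.of_prime_left hPp hJ0)
        refine ⟨⟨multiplicity P J, I, ?_, ?_⟩, ?_⟩
        · rintro rfl
          exact hnd (dvd_zero _)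
        · intro Q hQ hd
          have := hJ Q hQ (hE ▸ hd.mul_left _)
          simp only [Finset.coe_insert, Set.mem_insert_iff] at this
          rcases this with rfl | h
          · exact absurd hd hnd
          · exact h
        · exact Subtype.ext hE.symm
    have hg : HasSum (fun n : ℕ => F P ^ n) (1 - F P)⁻¹ := hasSum_geometric_of_lt_one hF0 hF1
    have hnn : ∀ I : smoothIdeals (S : Set (Ideal R)), 0 ≤ F I := fun I => ih2 I I.2
    have hs := Summable.mul_of_nonneg hg.summable ih1.summable (fun n => pow_nonneg hF0 n) hnn
    have hm := hg.mul ih1 hs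
    rw [Finset.prod_insert hPS]
    have hcomp : (fun x : ℕ × smoothIdeals (S : Set (Ideal R)) => F P ^ x.1 * F x.2)
        = (fun I : smoothIdeals ((insert P S : Finset _) : Set (Ideal R)) => F I) ∘ (Equiv.ofBijective e he) := by
      ext x
      simp [e]
    constructor
    · rw [← (Equiv.ofBijective e he).hasSum_iff, ← hcomp]
      exact hm
    · intro J hJ
      obtain ⟨x, hx⟩ := he.2 ⟨J, hJ⟩
      have : J = P ^ x.1 * (x.2 : Ideal R) := (congrArg Subtype.val hx).symm
      rw [this, map_mul, map_pow]
      exact mul_nonneg (pow_nonneg hF0 _) (hnn _)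

end EulerProduct

section Zeta
open Filter Topology Ideal

variable (K : Type*) [Field K] [NumberField K]

/-- `I ↦ N(I)^{-s}` -/
noncomputable def normPow (s : ℝ) : Ideal (𝓞 K) →* ℝ where
  toFun I := ((absNorm I : ℕ) : ℝ) ^ (-s)
  map_one' := by simp
  map_mul' I J := by
    rw [map_mul, Nat.cast_mul, Real.mul_rpow (by positivity) (by positivity)]

theorem sum_card_eq (n : ℕ) :
    (∑ k ∈ Finset.Icc 1 n, Nat.card {I : Ideal (𝓞 K) // absNorm I = k}) + 1 =
     Nat.card {I : Ideal (𝓞 K) // absNorm I ≤ n} := by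
  rw [show Finset.Icc 1 n = Finset.Ioc 0 n from Finset.Icc_succ_left_eq_Ioc _ _,
    show 1 = Nat.card {I : Ideal (𝓞 K) // absNorm I = 0} by simp [Ideal.absNorm_eq_zero_iff],
    Finset.sum_Ioc_add_eq_sum_Icc (n.zero_le),
    ← Finset.card_preimage_eq_sum_card_image_eq (fun k _ ↦ finite_setOfPred_absNorm_eq k)]
  simp [Set.coe_eq_subtype]

theorem zeta_summable {s : ℝ} (hs : 1 < s) :
    LSeriesSummable (fun n ↦ (Nat.card {I : Ideal (𝓞 K) // absNorm I = n} : ℂ)) (s : ℂ) := by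
  have := LSeriesSummable_of_sum_norm_bigO_and_nonneg (s := (s : ℂ)) (r := 1)
    (f := fun n ↦ (Nat.card {I : Ideal (𝓞 K) // absNorm I = n} : ℝ)) ?_ 
    (fun _ ↦ Nat.cast_nonneg _) zero_le_one (by simpa using hs)
  · simpa using this
  · have h := ((Ideal.tendsto_norm_le_div_atTop₀ K).comp tendsto_natCast_atTop_atTop)
    obtain ⟨l, h⟩ : ∃ l, Tendsto _ _ (𝓝 l) := ⟨_, h⟩
    have h2 : Tendsto (fun n : ℕ => (∑ k ∈ Finset.Icc 1 n, (Nat.card {I : Ideal (𝓞 K) // absNorm I = k} : ℝ)) / (n : ℝ)) atTop (𝓝 l) := by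
      refine h.congr fun n ↦ ?_
      simp only [Function.comp_apply, Nat.cast_le, ← Nat.cast_sum]
      congr
      rw [← add_left_inj 1, ← card_norm_le_eq_card_norm_le_add_one, sum_card_eq]
    have h3 := h2.isBigO_one ℝ
    have h4 := h3.mul (Asymptotics.isBigO_refl (fun n : ℕ => (n : ℝ)) atTop)
    simp only [one_mul] at h4
    simp only [Real.rpow_one]
    refine h4.congr' ?_ EventuallyEq.rfl
    filter_upwards [eventually_ne_atTop 0] with n hn
    field_simp

theorem zeta_hasSum {s : ℝ} (hs : 1 < s) :
    ∃ z : ℝ, dedekindZeta K s = z ∧ HasSum (normPow K s) z := by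
  set a : ℕ → ℝ := fun n => (Nat.card {I : Ideal (𝓞 K) // absNorm I = n} : ℝ) * (n : ℝ) ^ (-s) with ha
  have hterm : ∀ n, LSeries.term (fun n ↦ (Nat.card {I : Ideal (𝓞 K) // absNorm I = n} : ℂ)) (s : ℂ) n = (a n : ℂ) := by
    intro n
    rcases eq_or_ne n 0 with rfl | hn
    · simp [ha, Real.zero_rpow (by linarith : -s ≠ 0)]
    · rw [LSeries.term_of_ne_zero hn]
      simp only [ha]
      push_cast
      rw [Complex.ofReal_cpow (by positivity), div_eq_mul_inv, ← Complex.cpow_neg]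
      simp
  have hsum : Summable a := by
    have := zeta_summable K hs
    unfold LSeriesSummable at this
    rw [funext hterm] at this
    exact_mod_cast this
  refine ⟨∑' n, a n, ?_, ?_⟩
  · rw [dedekindZeta, LSeries, tsum_congr hterm, Complex.ofReal_tsum]
  · have hfib : ∀ n : ℕ, HasSum (fun I : {I : Ideal (𝓞 K) // absNorm I = n} => normPow K s I) (a n) := by
      intro n
      have : Finite {I : Ideal (𝓞 K) // absNorm I = n} := finite_setOfPred_absNorm_eq n
      have := Fintype.ofFinite {I : Ideal (𝓞 K) // absNorm I = n}
      have h := hasSum_fintype (fun I : {I : Ideal (𝓞 K) // absNorm I = n} => normPow K s I)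
      convert h using 1
      rw [Finset.sum_congr rfl (g := fun _ => (n:ℝ)^(-s))]
      · simp [ha]
      · rintro ⟨I, hI⟩ -
        simp [normPow, hI]
    have h0 : ∀ x, 0 ≤ normPow K s x := fun x => Real.rpow_nonneg (by positivity) _
    have hS : Summable (fun x : (n : ℕ) × {I : Ideal (𝓞 K) // absNorm I = n} => normPow K s x.2) := by
      rw [summable_sigma_of_nonneg (fun x => h0 _)]
      refine ⟨fun n => (hfib n).summable, ?_⟩
      exact hsum.congr (fun n => (hfib n).tsum_eq.symm)
    have h1 := hS.hasSum
    have h2 := h1.sigma hfib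
    rw [← h2.tsum_eq] at h1
    exact ((Equiv.sigmaFiberEquiv (fun I : Ideal (𝓞 K) => absNorm I)).hasSum_iff (f := normPow K s)).mp h1

end Zeta

section Zeta
open Filter Topology Ideal

variable (K : Type*) [Field K] [NumberField K]

/-- Euler factor at `p` -/
noncomputable def eulerFactor (s : ℝ) (p : ℕ) : ℝ :=
  ∏ P ∈ IsDedekindDomain.primesOverFinset (span {(p : ℤ)}) (𝓞 K), (1 - normPow K s P)⁻¹

theorem tendsto_eulerFactor {s : ℝ} (hs : 1 < s) {z : ℝ} (hz : HasSum (normPow K s) z) :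
    Tendsto (fun N : ℕ => ∏ p ∈ N.primesBelow, eulerFactor K s p) atTop (𝓝 z) := by
  classical
  have hpb : ∀ p : ℕ, p.Prime → (span {(p : ℤ)}) ≠ ⊥ := fun p hp => by
    simp [hp.ne_zero]
  have hpm : ∀ p : ℕ, p.Prime → (span {(p : ℤ)}).IsMaximal := fun p hp => by
    have := Fact.mk hp
    infer_instance
  set S : ℕ → Finset (Ideal (𝓞 K)) := fun N => N.primesBelow.biUnion
    (fun p => IsDedekindDomain.primesOverFinset (span {(p : ℤ)}) (𝓞 K)) with hSdef
  have hmemS : ∀ N P, P ∈ S N ↔ ∃ p, p < N ∧ p.Prime ∧ P.IsPrime ∧ P.LiesOver (span {(p : ℤ)}) := by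
    intro N P
    simp only [hSdef, Finset.mem_biUnion, Nat.mem_primesBelow, and_assoc]
    refine exists_congr fun p => and_congr_right fun _ => and_congr_right fun hp => ?_
    have := hpm p hp
    rw [IsDedekindDomain.mem_primesOverFinset_iff (hpb p hp)]
    rfl
  have hdisj : ∀ N : ℕ, ∏ p ∈ N.primesBelow, eulerFactor K s p = ∏ P ∈ S N, (1 - normPow K s P)⁻¹ := by
    intro N
    rw [hSdef, Finset.prod_biUnion]
    · rfl
    · intro p hp q hq hpq
      rw [Function.onFun, Finset.disjoint_left]
      intro P hP hQ
      simp only [Finset.mem_coe, Nat.mem_primesBelow] at hp hq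
      have := hpm p hp.2
      have := hpm q hq.2
      rw [IsDedekindDomain.mem_primesOverFinset_iff (hpb _ (by tauto))] at hP hQ
      have h1 := hP.2.over
      have h2 := hQ.2.over
      rw [← h2, span_singleton_eq_span_singleton, Int.associated_iff_natAbs] at h1
      exact hpq (by simpa using h1)
  have hne : ∀ N P, P ∈ S N → P ≠ ⊥ := by
    rintro N P hP rfl
    obtain ⟨p, _, hp, h1, h2⟩ := (hmemS _ _).mp hP
    have := h2.over
    rw [Ideal.under_bot] at this
    exact hpb p hp this
  have hprod : ∀ N, HasSum ((smoothIdeals (S N : Set (Ideal (𝓞 K)))).indicator (normPow K s)) (∏ P ∈ S N, (1 - normPow K s P)⁻¹) := by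
    intro N
    rw [← hasSum_subtype_iff_indicator]
    refine (hasSum_smoothIdeals (normPow K s) (S N) ?_).1
    intro P hP
    have hb := hne N P hP
    obtain ⟨p, _, hp, h1, h2⟩ := (hmemS _ _).mp hP
    refine ⟨h1, hb, Real.rpow_nonneg (by positivity) _, ?_⟩
    apply Real.rpow_lt_one_of_one_lt_of_neg _ (by linarith)
    have h3 : absNorm P ≠ 0 := by rwa [ne_eq, absNorm_eq_zero_iff]
    have h4 : absNorm P ≠ 1 := by
      rw [ne_eq, absNorm_eq_one_iff]; exact h1.ne_top
    exact_mod_cast (by omega : 1 < absNorm P)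
  have h0 : ∀ x, 0 ≤ normPow K s x := fun x => Real.rpow_nonneg (by positivity) _
  rw [funext hdisj, ← hz.tsum_eq, funext (fun N => (hprod N).tsum_eq.symm)]
  refine tendsto_tsum_of_dominated_convergence (bound := normPow K s) hz.summable ?_ ?_
  · intro I
    rcases eq_or_ne I ⊥ with rfl | hI
    · have : normPow K s ⊥ = 0 := by
        simp [normPow, Real.zero_rpow (by linarith : -s ≠ 0)]
      simp [Set.indicator_apply, this]
    · apply tendsto_const_nhds.congr'
      filter_upwards [eventually_gt_atTop (absNorm I)] with N hN
      rw [Set.indicator_of_mem]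
      refine ⟨hI, fun P hP hd => ?_⟩
      rw [Finset.mem_coe, hmemS]
      have hPb : P ≠ ⊥ := by
        rintro rfl
        exact hI (zero_dvd_iff.mp hd)
      have : NeZero P := ⟨hPb⟩
      refine ⟨absNorm (under ℤ P), ?_, Nat.absNorm_under_prime P, hP, ?_⟩
      · have h1 := Int.absNorm_under_dvd_absNorm P
        have h2 := map_dvd absNorm hd
        have h3 : absNorm I ≠ 0 := by rwa [ne_eq, absNorm_eq_zero_iff]
        exact (Nat.le_of_dvd (by omega) (h1.trans h2)).trans_lt hN
      · rw [Int.ideal_span_absNorm_eq_self]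
        exact ⟨rfl⟩
  · refine Eventually.of_forall fun N I => ?_
    rw [Set.indicator_apply]
    split_ifs
    · rw [Real.norm_of_nonneg (h0 I)]
    · simpa using h0 I

end Zeta

section Local
open Ideal
open scoped Pointwise

theorem perfect_residue (K : Type*) [Field K] [NumberField K] (P : Ideal (𝓞 K)) [hP : P.IsPrime] (h0 : P ≠ ⊥) :
    PerfectField P.ResidueField := by
  have hm : P.IsMaximal := hP.isMaximal h0
  have : Finite (𝓞 K ⧸ P) := Ideal.finiteQuotientOfFreeOfNeBot P h0
  have : Finite P.ResidueField := Finite.of_surjective _ (IsFractionRing.surjective_iff_isField (R := 𝓞 K ⧸ P) (K := P.ResidueField) |>.mpr ((Ideal.Quotient.maximal_ideal_iff_isField_quotient _).mp hm))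
  infer_instance

theorem perfect_residueZ (P : Ideal ℤ) [hP : P.IsPrime] (h0 : P ≠ ⊥) :
    PerfectField P.ResidueField := by
  have hm : P.IsMaximal := hP.isMaximal h0
  have : Finite (ℤ ⧸ P) := Ideal.finiteQuotientOfFreeOfNeBot P h0
  have : Finite P.ResidueField := Finite.of_surjective _ (IsFractionRing.surjective_iff_isField (R := ℤ ⧸ P) (K := P.ResidueField) |>.mpr ((Ideal.Quotient.maximal_ideal_iff_isField_quotient _).mp hm))
  infer_instance

theorem local_factor (K L : Type*) [Field K] [NumberField K] [Field L] [NumberField L] [Algebra K L]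
    [IsGalois ℚ K] [IsGalois ℚ L] (H : Subgroup Gal(L/ℚ)) [IsGaloisGroup H K L]
    (p : ℕ) (hp : p.Prime) (P : Ideal (𝓞 L)) [P.IsPrime] [P.LiesOver (span {(p : ℤ)})] (s : ℝ) :
    ∃ f g : ℕ, eulerFactor K s p = ((1 - ((p : ℝ) ^ (-s)) ^ f) ^ g)⁻¹ ∧
      g * Nat.card H * Nat.card (MulAction.stabilizer Gal(L/ℚ) P) =
        Nat.card Gal(L/ℚ) * Nat.card (MulAction.stabilizer Gal(L/ℚ) P ⊓ H : Subgroup Gal(L/ℚ)) ∧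
      f * g * Nat.card H * Nat.card (P.inertia Gal(L/ℚ)) =
        Nat.card Gal(L/ℚ) * Nat.card (P.inertia Gal(L/ℚ) ⊓ H : Subgroup Gal(L/ℚ)) ∧ 
      ∃ f', f * f' * Nat.card (P.inertia Gal(L/ℚ)) = Nat.card (MulAction.stabilizer Gal(L/ℚ) P) := by
  have := Fact.mk hp
  set pp : Ideal ℤ := span {(p : ℤ)} with hpp
  have hpb : pp ≠ ⊥ := by simp [hpp, hp.ne_zero]
  have hpm : pp.IsMaximal := by rw [hpp]; infer_instance
  set Q := P.under (𝓞 K) with hQ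
  have : Q.IsPrime := by rw [hQ]; infer_instance
  have : P.LiesOver Q := ⟨rfl⟩
  have : Q.LiesOver pp := ⟨by rw [hQ, under_under, P.over_def pp]⟩
  have hQ0 : Q ≠ ⊥ := by
    intro h
    have := Q.over_def pp
    rw [h, under_bot] at this
    exact hpb this
  have : IsGaloisGroup H (𝓞 K) (𝓞 L) := IsGaloisGroup.of_isFractionRing H (𝓞 K) (𝓞 L) K L
  have := perfect_residue K Q hQ0
  have := perfect_residueZ pp hpb
  have e1 := ramificationIdxIn_mul_ramificationIdxIn (p := pp) Q Gal(K/ℚ) (𝓞 L) Gal(L/ℚ) H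
  have f1 := inertiaDegIn_mul_inertiaDegIn (p := pp) Q Gal(K/ℚ) (𝓞 L) Gal(L/ℚ) H
  have I1 := card_inertia_eq_ramificationIdxIn (G := Gal(L/ℚ)) pp P
  have I2 := card_inertia_eq_ramificationIdxIn (G := H) Q P
  have D1 := card_stabilizer_eq (G := Gal(L/ℚ)) pp P
  have D2 := card_stabilizer_eq (G := H) Q P
  have hcard : ∀ A : Subgroup Gal(L/ℚ), Nat.card (A.subgroupOf H) = Nat.card (A ⊓ H : Subgroup Gal(L/ℚ)) := by
    intro A
    rw [← Subgroup.inf_subgroupOf_right]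
    exact Nat.card_congr (Subgroup.subgroupOfEquivOfLe inf_le_right).toEquiv
  have D3 : Nat.card ((MulAction.stabilizer Gal(L/ℚ) P).subgroupOf H) = Q.ramificationIdxIn (𝓞 L) * Q.inertiaDegIn (𝓞 L) := by
    rw [← D2]; rfl
  have I3 : Nat.card ((P.inertia Gal(L/ℚ)).subgroupOf H) = Q.ramificationIdxIn (𝓞 L) := by
    rw [← I2]; rfl
  rw [hcard] at D3 I3
  have N := ncard_primesOver_mul_ramificationIdxIn_mul_inertiaDegIn pp (𝓞 K) Gal(K/ℚ)
  have cK := IsGaloisGroup.card_eq_finrank Gal(K/ℚ) ℚ K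
  have cL := IsGaloisGroup.card_eq_finrank Gal(L/ℚ) ℚ L
  have cH := IsGaloisGroup.card_eq_finrank H K L
  have hm := Module.finrank_mul_finrank ℚ K L
  rw [← cK, ← cL, ← cH] at hm
  refine ⟨pp.inertiaDegIn (𝓞 K), (primesOver pp (𝓞 K)).ncard, ?_, ?_, ?_, ?_⟩
  · rw [eulerFactor, ← IsDedekindDomain.coe_primesOverFinset hpb, Set.ncard_coe_finset,
      ← inv_pow, ← Finset.prod_const]
    refine Finset.prod_congr rfl fun R hR => ?_
    rw [IsDedekindDomain.mem_primesOverFinset_iff hpb] at hR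
    obtain ⟨hR1, hR2⟩ := hR
    have h1 := absNorm_eq_pow_inertiaDeg (p := (p : ℤ)) R (Nat.prime_iff_prime_int.mp hp)
    have h2 : absNorm R = p ^ (pp.inertiaDegIn (𝓞 K)) := by
      rw [h1, inertiaDegIn_eq_inertiaDeg pp R Gal(K/ℚ)]
      have : R ≠ ⊥ := by
        rintro rfl
        have := (⊥ : Ideal (𝓞 K)).over_def pp
        rw [under_bot] at this
        exact hpb this
      have := hR1.isMaximal this
      rw [← inertiaDeg'_eq_inertiaDeg pp R, Int.natAbs_natCast]
    congr 2
    simp only [normPow, MonoidHom.coe_mk, OneHom.coe_mk, h2]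
    push_cast
    rw [← Real.rpow_natCast, ← Real.rpow_natCast, ← Real.rpow_mul (by positivity), ← Real.rpow_mul (by positivity), mul_comm]
  · rw [D1, D3, ← hm, ← N, ← e1, ← f1]; ring
  · rw [I1, I3, ← hm, ← N, ← e1]; ring
  · exact ⟨_, by rw [f1, I1, D1]; ring⟩

end Local

section Local
open Ideal Filter Topology
open scoped Pointwise

theorem card_decomp_of_exp_two (L : Type*) [Field L] [NumberField L] [IsGalois ℚ L]
    (hexp : ∀ g : Gal(L/ℚ), g * g = 1)
    (p : ℕ) (hp : p.Prime) (P : Ideal (𝓞 L)) [P.IsPrime] [P.LiesOver (span {(p : ℤ)})] :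
    ∃ f : ℕ, f ≤ 2 ∧ Nat.card (MulAction.stabilizer Gal(L/ℚ) P) = Nat.card (P.inertia Gal(L/ℚ)) * f := by
  have := Fact.mk hp
  set pp : Ideal ℤ := span {(p : ℤ)} with hpp
  have hpb : pp ≠ ⊥ := by simp [hpp, hp.ne_zero]
  have hpm : pp.IsMaximal := by rw [hpp]; infer_instance
  have hP0 : P ≠ ⊥ := by
    rintro rfl
    have := (⊥ : Ideal (𝓞 L)).over_def pp
    rw [under_bot] at this
    exact hpb this
  have hPm : P.IsMaximal := Ideal.IsPrime.isMaximal inferInstance hP0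
  have hfin : Finite (𝓞 L ⧸ P) := Ideal.finiteQuotientOfFreeOfNeBot P hP0
  have hfin : Finite (ℤ ⧸ pp) := Ideal.finiteQuotientOfFreeOfNeBot pp hpb
  let := Ideal.Quotient.field P
  let := Ideal.Quotient.field pp
  let φ := Ideal.Quotient.stabilizerQuotientInertiaEquiv Gal(L/ℚ) pp P
  refine ⟨Nat.card Gal((𝓞 L ⧸ P)/(ℤ ⧸ pp)), ?_, ?_⟩
  · have hc : IsCyclic Gal((𝓞 L ⧸ P)/(ℤ ⧸ pp)) := inferInstance
    rw [← IsCyclic.exponent_eq_card]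
    apply Nat.le_of_dvd (by norm_num)
    apply Monoid.exponent_dvd_of_forall_pow_eq_one
    intro g
    obtain ⟨x, rfl⟩ := φ.surjective g
    induction x using QuotientGroup.induction_on with
    | H x =>
      rw [← map_pow, ← QuotientGroup.mk_pow]
      have : x ^ 2 = 1 := by
        ext1
        simpa [pow_two] using hexp x
      rw [this]; simp
  · have : Subgroup.index _ = _ := Nat.card_congr φ.toEquiv
    rw [← this, ← ((inertia Gal(L/ℚ) P).subgroupOf (MulAction.stabilizer Gal(L/ℚ) P)).card_mul_index,
    Nat.card_congr (Subgroup.subgroupOfEquivOfLe (inertia_le_stabilizer (M := Gal(L/ℚ)) P)).toEquiv]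
    rfl

theorem card_inf_eq_sum {G : Type*} [Group G] [Fintype G] (A H : Subgroup G) [DecidablePred (· ∈ A)] [DecidablePred (· ∈ H)] :
    Nat.card (A ⊓ H : Subgroup G) = ∑ g : G, if g ∈ A then (if g ∈ H then 1 else 0) else 0 := by
  classical
  rw [Nat.card_eq_fintype_card, Fintype.card_subtype, Finset.card_filter]
  refine Finset.sum_congr rfl fun g _ => ?_
  simp only [Subgroup.mem_inf, ite_and]

theorem one_sub_pow_split (x : ℝ) (f g : ℕ) (h1 : f = 1 ∨ f = 2) :
    (1 - x ^ f) ^ g = (1 - x) ^ g * (1 + x) ^ (f * g - g) := by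
  rcases h1 with rfl | rfl
  · simp
  · rw [show 2 * g - g = g by omega, ← mul_pow]; ring

theorem local_factor' (K L : Type*) [Field K] [NumberField K] [Field L] [NumberField L] [Algebra K L]
    [IsGalois ℚ K] [IsGalois ℚ L] (H : Subgroup Gal(L/ℚ)) [IsGaloisGroup H K L]
    (hexp : ∀ g : Gal(L/ℚ), g * g = 1)
    (p : ℕ) (hp : p.Prime) (P : Ideal (𝓞 L)) [P.IsPrime] [P.LiesOver (span {(p : ℤ)})] (s : ℝ) :
    ∃ a b : ℕ, eulerFactor K s p = ((1 - ((p : ℝ) ^ (-s))) ^ a * (1 + ((p : ℝ) ^ (-s))) ^ b)⁻¹ ∧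
      a * Nat.card H * Nat.card (MulAction.stabilizer Gal(L/ℚ) P) =
        Nat.card Gal(L/ℚ) * Nat.card (MulAction.stabilizer Gal(L/ℚ) P ⊓ H : Subgroup Gal(L/ℚ)) ∧
      (a + b) * Nat.card H * Nat.card (P.inertia Gal(L/ℚ)) =
        Nat.card Gal(L/ℚ) * Nat.card (P.inertia Gal(L/ℚ) ⊓ H : Subgroup Gal(L/ℚ)) := by
  obtain ⟨f, g, h1, h2, h3, f', h4⟩ := local_factor K L H p hp P s
  obtain ⟨F, hF, h5⟩ := card_decomp_of_exp_two L hexp p hp P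
  have hI : 0 < Nat.card (P.inertia Gal(L/ℚ)) := Nat.card_pos
  have hD : 0 < Nat.card (MulAction.stabilizer Gal(L/ℚ) P) := Nat.card_pos
  have h6 : f * f' = F := by
    rw [h5, mul_comm] at h4
    exact Nat.eq_of_mul_eq_mul_left hI h4
  have hF0 : F ≠ 0 := by rintro rfl; omega
  have hf : f = 1 ∨ f = 2 := by
    have : f ≤ F := Nat.le_of_dvd (by omega) ⟨_, h6.symm⟩
    have : f ≠ 0 := by rintro rfl; omega
    omega
  refine ⟨g, f * g - g, ?_, h2, ?_⟩
  · rw [h1, one_sub_pow_split _ _ _ hf]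
  · rw [← h3]; congr 2; rcases hf with rfl | rfl <;> omega

variable (L : Type*) [Field L] [NumberField L] [IsGalois ℚ L]
  (K K₁ K₂ K₃ K₄ : Type*) [Field K] [NumberField K] [Algebra K L] [IsGalois ℚ K]
  [Field K₁] [NumberField K₁] [Algebra K₁ L] [IsGalois ℚ K₁]
  [Field K₂] [NumberField K₂] [Algebra K₂ L] [IsGalois ℚ K₂]
  [Field K₃] [NumberField K₃] [Algebra K₃ L] [IsGalois ℚ K₃]
  [Field K₄] [NumberField K₄] [Algebra K₄ L] [IsGalois ℚ K₄]
  (H H₁ H₂ H₃ H₄ : Subgroup Gal(L/ℚ)) [IsGaloisGroup H K L]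
  [IsGaloisGroup H₁ K₁ L] [IsGaloisGroup H₂ K₂ L] [IsGaloisGroup H₃ K₃ L] [IsGaloisGroup H₄ K₄ L]

include H H₁ H₂ H₃ H₄

open scoped Classical in
theorem eulerFactor_identity
    (hexp : ∀ g : Gal(L/ℚ), g * g = 1) (hcG : Nat.card Gal(L/ℚ) = 8)
    (hc : Nat.card H = 2) (hc₁ : Nat.card H₁ = 4) (hc₂ : Nat.card H₂ = 4)
    (hc₃ : Nat.card H₃ = 4) (hc₄ : Nat.card H₄ = 4)
    (key : ∀ g : Gal(L/ℚ), 8 * (if g = 1 then 1 else 0) + 4 = 4 * (if g ∈ H then 1 else 0)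
      + 2 * ((if g ∈ H₁ then 1 else 0) + (if g ∈ H₂ then 1 else 0)
      + (if g ∈ H₃ then 1 else 0) + (if g ∈ H₄ then 1 else 0))) (s : ℝ) (p : ℕ) (hp : p.Prime) :
    eulerFactor L s p * eulerFactor ℚ s p ^ 4 = eulerFactor K s p * eulerFactor K₁ s p *
      eulerFactor K₂ s p * eulerFactor K₃ s p * eulerFactor K₄ s p := by
  have key2 : ∀ A : Subgroup Gal(L/ℚ), 8 + 4 * Nat.card A =
    4 * Nat.card (A ⊓ H : Subgroup Gal(L/ℚ)) + 2 * (Nat.card (A ⊓ H₁ : Subgroup Gal(L/ℚ)) +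
      Nat.card (A ⊓ H₂ : Subgroup Gal(L/ℚ)) + Nat.card (A ⊓ H₃ : Subgroup Gal(L/ℚ)) +
      Nat.card (A ⊓ H₄ : Subgroup Gal(L/ℚ))) := by
    intro A
    have h1 : 1 = ∑ g : Gal(L/ℚ), if g ∈ A then (if g = 1 then 1 else 0) else 0 := by
      have := card_inf_eq_sum A ⊥
      simpa using this
    have h2 : Nat.card A = ∑ g : Gal(L/ℚ), if g ∈ A then 1 else 0 := by
      have := card_inf_eq_sum A ⊤
      simpa using this
    conv_lhs => rw [h2, show 8 = 8 * 1 by norm_num, h1]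
    simp only [card_inf_eq_sum, Finset.mul_sum, ← Finset.sum_add_distrib]
    refine Finset.sum_congr rfl fun g _ => ?_
    have hg := key g
    by_cases hA : g ∈ A
    · simp only [if_pos hA]; linarith
    · simp only [if_neg hA]; norm_num
  have := Fact.mk hp
  have hpm : (span {(p : ℤ)}).IsMaximal := by infer_instance
  obtain ⟨P, hP1, hP2⟩ := (inferInstance : Nonempty (primesOver (span {(p : ℤ)}) (𝓞 L)))
  have : IsGaloisGroup (⊥ : Subgroup Gal(L/ℚ)) L L := by
    have := IsGaloisGroup.intermediateField Gal(L/ℚ) ℚ L (⊤ : IntermediateField ℚ L)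
    exact { faithful := ⟨fun {a b} _ => Subsingleton.elim _ _⟩
            commutes := ⟨fun g x y => by obtain rfl := Subsingleton.elim g 1; simp⟩
            isInvariant := ⟨fun x _ => ⟨x, rfl⟩⟩ }
  have : IsGaloisGroup (⊤ : Subgroup Gal(L/ℚ)) ℚ L := inferInstance
  have : @IsGalois ℚ _ ℚ _ DivisionRing.toRatAlgebra := by
    have := IsGalois.self ℚ
    convert this using 1; exact Subsingleton.elim _ _
  obtain ⟨a, b, e1, e2, e3⟩ := local_factor' K L H hexp p hp P s
  obtain ⟨a1, b1, e11, e12, e13⟩ := local_factor' K₁ L H₁ hexp p hp P s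
  obtain ⟨a2, b2, e21, e22, e23⟩ := local_factor' K₂ L H₂ hexp p hp P s
  obtain ⟨a3, b3, e31, e32, e33⟩ := local_factor' K₃ L H₃ hexp p hp P s
  obtain ⟨a4, b4, e41, e42, e43⟩ := local_factor' K₄ L H₄ hexp p hp P s
  obtain ⟨a5, b5, e51, e52, e53⟩ := local_factor' ℚ L ⊤ hexp p hp P s
  obtain ⟨a6, b6, e61, e62, e63⟩ := local_factor' L L ⊥ hexp p hp P s
  have hI : 0 < Nat.card (P.inertia Gal(L/ℚ)) := Nat.card_pos
  have hD : 0 < Nat.card (MulAction.stabilizer Gal(L/ℚ) P) := Nat.card_pos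
  have kD := key2 (MulAction.stabilizer Gal(L/ℚ) P)
  have kI := key2 (P.inertia Gal(L/ℚ))
  rw [e1, e11, e21, e31, e41, e51, e61]
  rw [hcG, hc] at e2 e3
  rw [hcG, hc₁] at e12 e13
  rw [hcG, hc₂] at e22 e23
  rw [hcG, hc₃] at e32 e33
  rw [hcG, hc₄] at e42 e43
  rw [hcG] at e52 e53 e62 e63
  simp only [Subgroup.card_top, Subgroup.card_bot, inf_top_eq, inf_bot_eq, hcG] at e52 e53 e62 e63
  have ka : a6 + 4 * a5 = a + a1 + a2 + a3 + a4 := by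
    apply Nat.eq_of_mul_eq_mul_right hD
    ring_nf at *
    omega
  have kb : (a6 + b6) + 4 * (a5 + b5) = (a + b) + (a1 + b1) + (a2 + b2) + (a3 + b3) + (a4 + b4) := by
    apply Nat.eq_of_mul_eq_mul_right hI
    ring_nf at *
    omega
  have kb' : b6 + 4 * b5 = b + b1 + b2 + b3 + b4 := by omega
  generalize (p : ℝ) ^ (-s) = x
  simp only [← mul_inv, inv_pow]
  congr 1
  calc _ = (1 - x) ^ (a6 + 4 * a5) * (1 + x) ^ (b6 + 4 * b5) := by ring
    _ = (1 - x) ^ (a + a1 + a2 + a3 + a4) * (1 + x) ^ (b + b1 + b2 + b3 + b4) := by rw [ka, kb']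
    _ = _ := by ring

open scoped Classical in
theorem residue_identity
    (hexp : ∀ g : Gal(L/ℚ), g * g = 1) (hcG : Nat.card Gal(L/ℚ) = 8)
    (hc : Nat.card H = 2) (hc₁ : Nat.card H₁ = 4) (hc₂ : Nat.card H₂ = 4)
    (hc₃ : Nat.card H₃ = 4) (hc₄ : Nat.card H₄ = 4)
    (key : ∀ g : Gal(L/ℚ), 8 * (if g = 1 then 1 else 0) + 4 = 4 * (if g ∈ H then 1 else 0)
      + 2 * ((if g ∈ H₁ then 1 else 0) + (if g ∈ H₂ then 1 else 0)
      + (if g ∈ H₃ then 1 else 0) + (if g ∈ H₄ then 1 else 0))) :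
    dedekindZeta_residue L * dedekindZeta_residue ℚ ^ 4 =
      dedekindZeta_residue K * dedekindZeta_residue K₁ * dedekindZeta_residue K₂ *
      dedekindZeta_residue K₃ * dedekindZeta_residue K₄ := by
  have h := tendsto_sub_one_mul_dedekindZeta_nhdsGT K
  have h1 := tendsto_sub_one_mul_dedekindZeta_nhdsGT K₁
  have h2 := tendsto_sub_one_mul_dedekindZeta_nhdsGT K₂
  have h3 := tendsto_sub_one_mul_dedekindZeta_nhdsGT K₃
  have h4 := tendsto_sub_one_mul_dedekindZeta_nhdsGT K₄
  have h5 := tendsto_sub_one_mul_dedekindZeta_nhdsGT ℚ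
  have h6 := tendsto_sub_one_mul_dedekindZeta_nhdsGT L
  have hl := h6.mul (h5.pow 4)
  have hr := (((h.mul h1).mul h2).mul h3).mul h4
  have := tendsto_nhds_unique (hl.congr' ?_) hr
  · exact_mod_cast this
  · filter_upwards [self_mem_nhdsWithin] with s hs
    have hs : 1 < s := hs
    obtain ⟨z, e, k⟩ := zeta_hasSum K hs
    obtain ⟨z1, e1, k1⟩ := zeta_hasSum K₁ hs
    obtain ⟨z2, e2, k2⟩ := zeta_hasSum K₂ hs
    obtain ⟨z3, e3, k3⟩ := zeta_hasSum K₃ hs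
    obtain ⟨z4, e4, k4⟩ := zeta_hasSum K₄ hs
    obtain ⟨z5, e5, k5⟩ := zeta_hasSum ℚ hs
    obtain ⟨z6, e6, k6⟩ := zeta_hasSum L hs
    have m := tendsto_eulerFactor K hs k
    have m1 := tendsto_eulerFactor K₁ hs k1
    have m2 := tendsto_eulerFactor K₂ hs k2
    have m3 := tendsto_eulerFactor K₃ hs k3
    have m4 := tendsto_eulerFactor K₄ hs k4
    have m5 := tendsto_eulerFactor ℚ hs k5
    have m6 := tendsto_eulerFactor L hs k6
    have hml := m6.mul (m5.pow 4)
    have hmr := (((m.mul m1).mul m2).mul m3).mul m4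
    have heq : z6 * z5 ^ 4 = z * z1 * z2 * z3 * z4 := by
      refine tendsto_nhds_unique (hml.congr fun N => ?_) hmr
      rw [← Finset.prod_pow, ← Finset.prod_mul_distrib, ← Finset.prod_mul_distrib,
        ← Finset.prod_mul_distrib, ← Finset.prod_mul_distrib, ← Finset.prod_mul_distrib]
      refine Finset.prod_congr rfl fun p hp => ?_
      exact eulerFactor_identity L K K₁ K₂ K₃ K₄ H H₁ H₂ H₃ H₄ hexp hcG hc hc₁ hc₂ hc₃ hc₄ key s p
        (Nat.prime_of_mem_primesBelow hp)
    have heq' : (z6 : ℂ) * (z5 : ℂ) ^ 4 = z * z1 * z2 * z3 * z4 := by exact_mod_cast heq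
    rw [e, e1, e2, e3, e4, e5, e6]
    linear_combination ((s : ℂ) - 1) ^ 5 * heq'

end Local

section Quad

/-- `K = F(r)` with `r ^ 2 = m`, `m` not a square in `F`. -/
structure IsQuad (F K : Type*) [Field F] [Field K] [Algebra F K] (m : F) (r : K) : Prop where
  sq : r ^ 2 = algebraMap F K m
  nsq : ∀ q : F, q ^ 2 ≠ m
  span : ∀ x : K, ∃ a b : F, x = algebraMap F K a + algebraMap F K b * r

namespace IsQuad

variable {F K : Type*} [Field F] [Field K] [Algebra F K] {m : F} {r : K} (h : IsQuad F K m r)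
include h

theorem not_mem (a : F) : r ≠ algebraMap F K a := by
  rintro rfl
  have := h.sq
  rw [← map_pow] at this
  exact h.nsq a ((algebraMap F K).injective this)

theorem eq_zero {a b : F} (e : algebraMap F K a + algebraMap F K b * r = 0) : a = 0 ∧ b = 0 := by
  have hb : b = 0 := by
    by_contra hb
    apply h.not_mem (-a / b)
    have : algebraMap F K b ≠ 0 := by simpa using hb
    rw [map_div₀, map_neg]
    field_simp
    linear_combination e
  subst hb
  simpa using e

theorem ext {a b a' b' : F} (e : algebraMap F K a + algebraMap F K b * r =
    algebraMap F K a' + algebraMap F K b' * r) : a = a' ∧ b = b' := by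
  have := h.eq_zero (a := a - a') (b := b - b') (by simp only [map_sub]; linear_combination e)
  exact ⟨sub_eq_zero.mp this.1, sub_eq_zero.mp this.2⟩

/-- basis `1, r` -/
noncomputable def basis : Module.Basis (Fin 2) F K :=
  Module.Basis.mk (v := ![1, r])
    (LinearIndependent.pair_iff.mpr fun s t e => by
      simp only [Algebra.smul_def, mul_one] at e
      exact h.eq_zero e)
    (by
      rintro x -
      obtain ⟨a, b, rfl⟩ := h.span x
      rw [Matrix.range_cons, Matrix.range_cons, Matrix.range_empty, Set.union_empty]
      rw [Set.singleton_union, Submodule.mem_span_pair]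
      exact ⟨a, b, by simp [Algebra.smul_def]⟩)

theorem finiteDimensional : FiniteDimensional F K := Module.Finite.of_basis h.basis

theorem finrank_eq : Module.finrank F K = 2 := by
  rw [Module.finrank_eq_card_basis h.basis]; simp

theorem exists_conj [CharZero F] : ∃ σ : K ≃ₐ[F] K, ∀ a b : F, σ (algebraMap F K a + algebraMap F K b * r) =
    algebraMap F K a - algebraMap F K b * r := by
  choose A B hAB using h.span
  have key : ∀ a b : F, A (algebraMap F K a + algebraMap F K b * r) = a ∧ B (algebraMap F K a + algebraMap F K b * r) = b := by
    intro a b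
    have := h.ext (hAB (algebraMap F K a + algebraMap F K b * r))
    exact ⟨this.1.symm, this.2.symm⟩
  let f : K → K := fun x => algebraMap F K (A x) - algebraMap F K (B x) * r
  have hf : ∀ a b : F, f (algebraMap F K a + algebraMap F K b * r) =
    algebraMap F K a - algebraMap F K b * r := by
    intro a b
    simp only [f, key]
  have hff : ∀ x, f (f x) = x := by
    intro x
    obtain ⟨a, b, rfl⟩ := h.span x
    rw [hf]
    have := hf a (-b)
    simp only [map_neg, neg_mul, sub_neg_eq_add, ← sub_eq_add_neg] at this
    exact this
  have hc : ∀ a : F, f (algebraMap F K a) = algebraMap F K a := by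
    intro a
    have := hf a 0
    simpa using this
  have hsq := h.sq
  refine ⟨{ toFun := f, invFun := f, left_inv := hff, right_inv := hff, map_mul' := ?_, map_add' := ?_, commutes' := hc }, hf⟩
  · intro x y
    obtain ⟨a, b, rfl⟩ := h.span x
    obtain ⟨a', b', rfl⟩ := h.span y
    have e : (algebraMap F K a + algebraMap F K b * r) * (algebraMap F K a' + algebraMap F K b' * r) =
      algebraMap F K (a * a' + b * b' * m) + algebraMap F K (a * b' + b * a') * r := by
      simp only [map_add, map_mul]; linear_combination (algebraMap F K b) * (algebraMap F K b') * hsq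
    rw [e, hf, hf, hf]
    simp only [map_add, map_mul]; linear_combination (-(algebraMap F K b) * (algebraMap F K b')) * hsq
  · intro x y
    obtain ⟨a, b, rfl⟩ := h.span x
    obtain ⟨a', b', rfl⟩ := h.span y
    have e : (algebraMap F K a + algebraMap F K b * r) + (algebraMap F K a' + algebraMap F K b' * r) =
      algebraMap F K (a + a') + algebraMap F K (b + b') * r := by
      simp only [map_add]; ring
    rw [e, hf, hf, hf]
    simp only [map_add]; ring

theorem isGalois [CharZero F] : IsGalois F K := by
  have := h.finiteDimensional
  have : Algebra.IsQuadraticExtension F K := ⟨h.finrank_eq⟩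
  infer_instance

end IsQuad

theorem rat_int_of_isIntegral {K : Type*} [Field K] [CharZero K] {q : ℚ} (h : IsIntegral ℤ ((q : ℚ) : K)) :
    ∃ n : ℤ, q = n := by
  have h1 : IsIntegral ℤ q := by
    rw [← isIntegral_algebraMap_iff (algebraMap ℚ K).injective]
    simpa using h
  obtain ⟨n, hn⟩ := IsIntegrallyClosed.isIntegral_iff.mp h1
  exact ⟨n, by simpa using hn.symm⟩

theorem rat_int_of_mul_sq {m : ℤ} (hm : Squarefree m) {q : ℚ} {N : ℤ} (h : m * q ^ 2 = N) :
    ∃ n : ℤ, q = n := by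
  have hm0 : (m : ℚ) ≠ 0 := by exact_mod_cast hm.ne_zero
  have h1 : IsIntegral ℤ ((m : ℚ) * q) := by
    apply IsIntegral.of_pow (n := 2) (by norm_num)
    have : ((m : ℚ) * q) ^ 2 = ((m * N : ℤ) : ℚ) := by push_cast; rw [← h]; ring
    rw [this]
    exact isIntegral_algebraMap (R := ℤ) (x := m * N)
  obtain ⟨c, hc⟩ := rat_int_of_isIntegral (K := ℚ) (q := m * q) (by simpa using h1)
  have h2 : c ^ 2 = m * N := by
    have : ((c ^ 2 : ℤ) : ℚ) = ((m * N : ℤ) : ℚ) := by push_cast; rw [← h, ← hc]; ring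
    exact_mod_cast this
  have h3 : m ∣ c := (hm.dvd_pow_iff_dvd two_ne_zero).mp ⟨N, h2⟩
  obtain ⟨k, rfl⟩ := h3
  refine ⟨k, ?_⟩
  push_cast at hc
  exact mul_left_cancel₀ hm0 hc

variable {K : Type*} [Field K] [CharZero K] 

theorem IsQuad.int_repr {m : ℤ} {r : K} (h : IsQuad ℚ K m r) (hm : Squarefree m) {x : K} (hx : IsIntegral ℤ x) :
    ∃ A B : ℤ, 2 * x = A + B * r ∧ 4 ∣ A ^ 2 - m * B ^ 2 := by
  obtain ⟨σ, hσ⟩ := h.exists_conj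
  obtain ⟨a, b, rfl⟩ := h.span x
  have hx' : IsIntegral ℤ (σ (algebraMap ℚ K a + algebraMap ℚ K b * r)) := hx.map σ
  rw [hσ] at hx'
  have hsq := h.sq
  have h1 := hx.add hx'
  have h2 := hx.mul hx'
  obtain ⟨A, hA⟩ := rat_int_of_isIntegral (K := K) (q := 2 * a) (by
    have e : ((2 * a : ℚ) : K) = algebraMap ℚ K a + algebraMap ℚ K b * r + (algebraMap ℚ K a - algebraMap ℚ K b * r) := by
      simp only [eq_ratCast]; push_cast; ring
    rw [e]; exact h1)
  obtain ⟨N, hN⟩ := rat_int_of_isIntegral (K := K) (q := a ^ 2 - m * b ^ 2) (by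
    have e : ((a ^ 2 - m * b ^ 2 : ℚ) : K) = (algebraMap ℚ K a + algebraMap ℚ K b * r) * (algebraMap ℚ K a - algebraMap ℚ K b * r) := by
      simp only [eq_ratCast, Rat.cast_intCast] at hsq ⊢; push_cast; linear_combination ((b : ℚ) : K) ^ 2 * hsq
    rw [e]; exact h2)
  obtain ⟨B, hB⟩ := rat_int_of_mul_sq hm (q := 2 * b) (N := A ^ 2 - 4 * N) (by
    push_cast; rw [← hA, ← hN]; ring)
  refine ⟨A, B, ?_, N, ?_⟩
  · have hA' : (2 * a : K) = A := by exact_mod_cast congrArg (Rat.cast (K := K)) hA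
    have hB' : (2 * b : K) = B := by exact_mod_cast congrArg (Rat.cast (K := K)) hB
    rw [← hA', ← hB']; simp; ring
  · have : ((A ^ 2 - m * B ^ 2 : ℤ) : ℚ) = ((4 * N : ℤ) : ℚ) := by
      push_cast; rw [← hA, ← hB, ← hN]; ring
    exact_mod_cast this

theorem IsQuad.int_repr_23 {m : ℤ} {r : K} (h : IsQuad ℚ K m r) (hm : Squarefree m) (hm4 : m % 4 = 2 ∨ m % 4 = 3)
    {x : K} (hx : IsIntegral ℤ x) : ∃ A B : ℤ, x = A + B * r := by
  obtain ⟨A, B, h1, h2⟩ := h.int_repr hm hx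
  have h3 : 2 ∣ A ∧ 2 ∣ B := by
    have e : (A ^ 2 - m * B ^ 2) % 4 = 0 := Int.emod_eq_zero_of_dvd h2
    have hA : A % 4 = 0 ∨ A % 4 = 1 ∨ A % 4 = 2 ∨ A % 4 = 3 := by omega
    have hB : B % 4 = 0 ∨ B % 4 = 1 ∨ B % 4 = 2 ∨ B % 4 = 3 := by omega
    rcases hA with hA | hA | hA | hA <;> rcases hB with hB | hB | hB | hB <;> rcases hm4 with hm4 | hm4 <;>
      simp [Int.sub_emod, Int.mul_emod, pow_two, hA, hB, hm4] at e <;> omega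
  obtain ⟨⟨a, rfl⟩, ⟨b, rfl⟩⟩ := h3
  refine ⟨a, b, ?_⟩
  push_cast at h1
  have : (2 : K) ≠ 0 := two_ne_zero
  apply mul_left_cancel₀ this
  linear_combination h1

theorem IsQuad.int_repr_1 {m : ℤ} {r : K} (h : IsQuad ℚ K m r) (hm : Squarefree m) (hm4 : m % 4 = 1)
    {x : K} (hx : IsIntegral ℤ x) : ∃ A B : ℤ, x = A + B * ((1 + r) / 2) := by
  obtain ⟨A, B, h1, h2⟩ := h.int_repr hm hx
  have h3 : 2 ∣ A - B := by
    have e : (A ^ 2 - m * B ^ 2) % 4 = 0 := Int.emod_eq_zero_of_dvd h2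
    have hA : A % 4 = 0 ∨ A % 4 = 1 ∨ A % 4 = 2 ∨ A % 4 = 3 := by omega
    have hB : B % 4 = 0 ∨ B % 4 = 1 ∨ B % 4 = 2 ∨ B % 4 = 3 := by omega
    rcases hA with hA | hA | hA | hA <;> rcases hB with hB | hB | hB | hB <;>
      simp [Int.sub_emod, Int.mul_emod, pow_two, hA, hB, hm4] at e <;> omega
  obtain ⟨a, ha⟩ := h3
  obtain rfl : A = 2 * a + B := by omega
  refine ⟨a, B, ?_⟩
  push_cast at h1
  have : (2 : K) ≠ 0 := two_ne_zero
  apply mul_left_cancel₀ this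
  linear_combination h1

theorem discr_of_gen [NumberField K] (θ : 𝓞 K) (u v : ℤ) (hθ : θ ^ 2 = u * θ + v)
    (hirr : ∀ q : ℚ, algebraMap (𝓞 K) K θ ≠ q) (hspan : ∀ x : 𝓞 K, ∃ a b : ℤ, x = a + b * θ) :
    discr K = u ^ 2 + 4 * v := by
  let b : Module.Basis (Fin 2) ℤ (𝓞 K) := Module.Basis.mk (v := ![1, θ])
    (LinearIndependent.pair_iff.mpr fun s t e => by
      have ht : t = 0 := by
        by_contra ht
        apply hirr (- s / t)
        have := congrArg (algebraMap (𝓞 K) K) e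
        simp at this
        have ht' : (t : K) ≠ 0 := by exact_mod_cast ht
        push_cast
        field_simp
        linear_combination this
      subst ht
      simpa using e)
    (by
      rintro x -
      obtain ⟨a, b, rfl⟩ := hspan x
      rw [Matrix.range_cons, Matrix.range_cons, Matrix.range_empty, Set.union_empty]
      rw [Set.singleton_union, Submodule.mem_span_pair]
      exact ⟨a, b, by simp⟩)
  have hb0 : b 0 = 1 := by simp [b]
  have hb1 : b 1 = θ := by simp [b]
  rw [← NumberField.discr_eq_discr K b, Algebra.discr_def, Matrix.det_fin_two]
  simp only [Algebra.traceMatrix_apply, Algebra.traceForm_apply, hb0, hb1, one_mul, mul_one]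
  have hfr : Module.finrank ℤ (𝓞 K) = 2 := by rw [Module.finrank_eq_card_basis b]; simp
  have htc : ∀ n : ℤ, Algebra.trace ℤ (𝓞 K) (n : 𝓞 K) = 2 * n := by
    intro n
    have := Algebra.trace_algebraMap (R := ℤ) (S := 𝓞 K) n
    rw [hfr] at this
    simpa using this
  have ht1 : Algebra.trace ℤ (𝓞 K) 1 = 2 := by simpa using htc 1
  have htθ : Algebra.trace ℤ (𝓞 K) θ = u := by
    rw [Algebra.trace_eq_matrix_trace b, Matrix.trace_fin_two, Algebra.leftMulMatrix_eq_repr_mul,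
      Algebra.leftMulMatrix_eq_repr_mul, hb0, hb1, mul_one]
    have e2 : θ * θ = v • b 0 + u • b 1 := by
      rw [hb0, hb1]; simp; linear_combination hθ
    have e3 : b.repr θ = Finsupp.single 1 1 := by rw [← hb1, b.repr_self]
    rw [e2, e3, map_add, map_smul, map_smul, b.repr_self, b.repr_self]
    simp [Finsupp.single_apply]
  have ht2 : Algebra.trace ℤ (𝓞 K) (θ * θ) = u * u + 2 * v := by
    have e2 : θ * θ = u • θ + (v : 𝓞 K) := by simp; linear_combination hθ
    rw [e2, map_add, map_smul, htc, htθ]; simp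
  rw [ht1, htθ, ht2]; ring

theorem exists_ringOfIntegers {x : K} (hx : IsIntegral ℤ x) : ∃ θ : 𝓞 K, algebraMap (𝓞 K) K θ = x :=
  ⟨⟨x, hx⟩, rfl⟩

theorem isIntegral_of_sq_int {r : K} {m : ℤ} (hsq : r ^ 2 = (m : K)) : IsIntegral ℤ r := by
  apply IsIntegral.of_pow (n := 2) (by norm_num)
  rw [hsq]
  exact isIntegral_algebraMap (R := ℤ) (x := m)

theorem IsQuad.discr_23 [NumberField K] {m : ℤ} {r : K} (h : IsQuad ℚ K m r) (hm : Squarefree m) (hm4 : m % 4 = 2 ∨ m % 4 = 3) :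
    discr K = 4 * m := by
  have hsq : r ^ 2 = (m : K) := by simpa using h.sq
  obtain ⟨θ, hθ⟩ := exists_ringOfIntegers (isIntegral_of_sq_int hsq)
  have := discr_of_gen (K := K) θ 0 m
    (by apply RingOfIntegers.ext; simp only [map_pow, map_add, map_mul, map_intCast, hθ]; simpa using hsq)
    (fun q => by rw [hθ]; simpa using h.not_mem q)
    (fun x => by
      obtain ⟨a, b, e⟩ := h.int_repr_23 hm hm4 x.isIntegral_coe
      exact ⟨a, b, by apply RingOfIntegers.ext; simp only [map_add, map_mul, map_intCast, hθ]; exact e⟩)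
  simpa using this

theorem isIntegral_half {r : K} {k : ℤ} (e : ((1 + r) / 2) ^ 2 = ((1 + r) / 2) + (k : K)) :
    IsIntegral ℤ ((1 + r) / 2) := by
  refine ⟨Polynomial.X ^ 2 - (Polynomial.X + Polynomial.C k), ?_, ?_⟩
  · apply Polynomial.monic_X_pow_sub
    rw [Polynomial.degree_X_add_C k]; norm_num
  · simp only [Polynomial.eval₂_sub, Polynomial.eval₂_add, Polynomial.eval₂_pow, Polynomial.eval₂_X, Polynomial.eval₂_C, e]
    simp

theorem IsQuad.discr_1 [NumberField K] {m : ℤ} {r : K} (h : IsQuad ℚ K m r) (hm : Squarefree m) (hm4 : m % 4 = 1) :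
    discr K = m := by
  have hsq : r ^ 2 = (m : K) := by simpa using h.sq
  obtain ⟨k, hk⟩ : ∃ k, m = 1 + 4 * k := ⟨m / 4, by omega⟩
  have e : ((1 + r) / 2) ^ 2 = ((1 + r) / 2) + (k : K) := by
    have : (m : K) = 1 + 4 * k := by exact_mod_cast congrArg (Int.cast (R := K)) hk
    rw [this] at hsq
    field_simp; linear_combination hsq
  obtain ⟨θ, hθ⟩ := exists_ringOfIntegers (isIntegral_half e)
  have := discr_of_gen (K := K) θ 1 k
    (by apply RingOfIntegers.ext; simp only [map_pow, map_add, map_mul, map_intCast, hθ]; simpa using e)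
    (fun q hq => h.not_mem (2 * q - 1) (by
        rw [hθ] at hq
        simp; linear_combination 2 * hq))
    (fun x => by
      obtain ⟨a, b, e⟩ := h.int_repr_1 hm hm4 x.isIntegral_coe
      exact ⟨a, b, by apply RingOfIntegers.ext; simp only [map_add, map_mul, map_intCast, hθ]; exact e⟩)
  rw [this, hk]; ring

end Quad

section Setup

theorem IsQuad.of_adjoin {F K : Type*} [Field F] [Field K] [Algebra F K] {m : F} {r : K}
    (hsq : r ^ 2 = algebraMap F K m) (hn : ∀ q : F, q ^ 2 ≠ m) :
    IsQuad F F⟮r⟯ m (AdjoinSimple.gen F r) where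
  sq := by
    apply Subtype.ext
    simpa using hsq
  nsq := hn
  span := by
    have hintegral : IsIntegral F r := by
      apply IsIntegral.of_pow (n := 2) (by norm_num)
      rw [hsq]
      exact isIntegral_algebraMap
    rintro ⟨x, hx⟩
    have hx' : x ∈ Algebra.adjoin F {r} := by
      rw [← IntermediateField.adjoin_simple_toSubalgebra_of_isAlgebraic hintegral.isAlgebraic]
      exact hx
    have key : ∀ y ∈ Algebra.adjoin F {r}, ∃ a b : F, y = algebraMap F K a + algebraMap F K b * r := by
      intro y hy
      induction hy using Algebra.adjoin_induction with
      | mem z hz =>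
        rw [Set.mem_singleton_iff] at hz
        exact ⟨0, 1, by simp [hz]⟩
      | algebraMap z => exact ⟨z, 0, by simp⟩
      | add y z _ _ hy hz =>
        obtain ⟨a, b, rfl⟩ := hy
        obtain ⟨a', b', rfl⟩ := hz
        exact ⟨a + a', b + b', by simp only [map_add]; ring⟩
      | mul y z _ _ hy hz =>
        obtain ⟨a, b, rfl⟩ := hy
        obtain ⟨a', b', rfl⟩ := hz
        exact ⟨a * a' + b * b' * m, a * b' + b * a', by
          simp only [map_add, map_mul]; linear_combination algebraMap F K b * algebraMap F K b' * hsq⟩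
    obtain ⟨a, b, e⟩ := key x hx'
    exact ⟨a, b, Subtype.ext (by simpa using e)⟩

/-- square roots in a quadratic extension of elements of the base -/
theorem IsQuad.sq_eq {F K : Type*} [Field F] [Field K] [CharZero F] [Algebra F K] {m : F} {r : K} (h : IsQuad F K m r)
    {x : K} {n : F} (hx : x ^ 2 = algebraMap F K n) : ∃ y : F, y ^ 2 = n ∨ m * y ^ 2 = n := by
  obtain ⟨a, b, rfl⟩ := h.span x
  have hsq := h.sq
  have := h.ext (a := a ^ 2 + m * b ^ 2) (b := 2 * a * b) (a' := n) (b' := 0) (by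
    simp only [map_add, map_mul, map_pow, map_zero, map_ofNat]
    linear_combination hx - (algebraMap F K b) ^ 2 * hsq)
  obtain ⟨h1, h2⟩ := this
  rcases mul_eq_zero.mp h2 with h3 | h3
  · have : a = 0 := by simpa using h3
    exact ⟨b, Or.inr (by rw [← h1, this]; ring)⟩
  · exact ⟨a, Or.inl (by rw [← h1, h3]; ring)⟩

theorem rat_sq_ne_int {n : ℤ} (hn : Squarefree n) (h1 : n ≠ 1) (q : ℚ) : q ^ 2 ≠ n := by
  intro h
  have : IsIntegral ℤ q := by
    apply IsIntegral.of_pow (n := 2) (by norm_num)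
    rw [h]; exact isIntegral_algebraMap (R := ℤ) (x := n)
  obtain ⟨k, rfl⟩ := rat_int_of_isIntegral (K := ℚ) (q := q) (by simpa using this)
  have h2 : k ^ 2 = n := by exact_mod_cast h
  have := hn k ⟨1, by rw [← h2]; ring⟩
  rcases Int.isUnit_iff.mp this with rfl | rfl
  · apply h1; rw [← h2]; norm_num
  · apply h1; rw [← h2]; norm_num

/-- the data `L = ℚ(i, √2, √d)` -/
structure Setup (L : Type*) [Field L] [NumberField L] (d : ℤ) (i w t : L) : Prop where
  hi : i ^ 2 = -1
  hw : w ^ 2 = 2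
  ht : t ^ 2 = d
  gen : IntermediateField.adjoin ℚ {i, w, t} = ⊤
  hd1 : 1 < d
  hd8 : d % 8 = 1
  hd : Squarefree d

theorem sqf_two_mul {d : ℤ} (hd : Squarefree d) (hd8 : d % 8 = 1) : Squarefree (2 * d) := by
  have h2 : IsRelPrime (2 : ℤ) d := by
    exact IsCoprime.isRelPrime ⟨-(d / 2), 1, by omega⟩
  exact (squarefree_mul_iff).mpr ⟨h2, Int.prime_two.squarefree, hd⟩

theorem rat_sq_ne_of_neg {n : ℚ} (hn : n < 0) (q : ℚ) : q ^ 2 ≠ n := by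
  intro h; nlinarith [sq_nonneg q]

theorem rat_not_sq_d {d : ℤ} (hd : Squarefree d) (hd1 : 1 < d) (q : ℚ) : q ^ 2 ≠ d :=
  rat_sq_ne_int hd (by omega) q

theorem rat_not_sq_two_d {d : ℤ} (hd : Squarefree d) (hd8 : d % 8 = 1) (q : ℚ) : 2 * q ^ 2 ≠ d := by
  intro h
  apply rat_sq_ne_int (sqf_two_mul hd hd8) (by omega) (2 * q)
  push_cast; linear_combination 2 * h

theorem rat_not_sq_two (q : ℚ) : q ^ 2 ≠ 2 := by
  have := rat_sq_ne_int Int.prime_two.squarefree (by norm_num) q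
  exact_mod_cast this

section Biq

variable {M : Type*} [Field M] [NumberField M] {d : ℤ} {w t : M}

theorem isQuad_w (hw : w ^ 2 = 2) : IsQuad ℚ ℚ⟮w⟯ 2 (AdjoinSimple.gen ℚ w) :=
  IsQuad.of_adjoin (by simpa using hw) rat_not_sq_two

theorem not_sq_d_in_k (hw : w ^ 2 = 2) (hd1 : 1 < d) (hd8 : d % 8 = 1) (hd : Squarefree d) (q : ℚ⟮w⟯) :
    q ^ 2 ≠ (d : ℚ⟮w⟯) := by
  intro h
  obtain ⟨y, hy | hy⟩ := (isQuad_w hw).sq_eq (n := (d : ℚ)) (x := q) (by simpa using h)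
  · exact rat_not_sq_d hd hd1 y hy
  · exact rat_not_sq_two_d hd hd8 y hy

theorem not_sq_neg_in_k (hw : w ^ 2 = 2) {n : ℚ} (hn : n < 0) (q : ℚ⟮w⟯) :
    q ^ 2 ≠ algebraMap ℚ ℚ⟮w⟯ n := by
  intro h
  obtain ⟨y, hy | hy⟩ := (isQuad_w hw).sq_eq (n := n) (x := q) h
  · exact rat_sq_ne_of_neg hn y hy
  · nlinarith [sq_nonneg y]

/-- the data `M = ℚ(√2, √d)` -/
structure IsBiq (M : Type*) [Field M] [NumberField M] (d : ℤ) (w t : M) : Prop where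
  hw : w ^ 2 = 2
  ht : t ^ 2 = d
  span : ∀ x : M, ∃ a b : ℚ⟮w⟯, x = algebraMap ℚ⟮w⟯ M a + algebraMap ℚ⟮w⟯ M b * t
  hd1 : 1 < d
  hd8 : d % 8 = 1
  hd : Squarefree d

theorem IsBiq.isQuad (h : IsBiq M d w t) : IsQuad ℚ⟮w⟯ M (d : ℚ⟮w⟯) t where
  sq := by simpa using h.ht
  nsq := not_sq_d_in_k h.hw h.hd1 h.hd8 h.hd
  span := h.span

end Biq

namespace Setup

variable {L : Type*} [Field L] [NumberField L] {d : ℤ} {i w t : L} (S : Setup L d i w t)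
include S

theorem quad2 : IsQuad ℚ⟮w⟯ (ℚ⟮w⟯⟮t⟯) (d : ℚ⟮w⟯) (AdjoinSimple.gen ℚ⟮w⟯ t) :=
  IsQuad.of_adjoin (by simpa using S.ht) (not_sq_d_in_k S.hw S.hd1 S.hd8 S.hd)

theorem not_sq_neg_one (q : ℚ⟮w⟯⟮t⟯) : q ^ 2 ≠ -1 := by
  intro h
  obtain ⟨y, hy | hy⟩ := S.quad2.sq_eq (n := (-1 : ℚ⟮w⟯)) (x := q) (by simpa using h)
  · exact not_sq_neg_in_k S.hw (n := -1) (by norm_num) y (by simpa using hy)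
  · have hd0 : (d : ℚ) ≠ 0 := by have := S.hd1; exact_mod_cast (by omega : d ≠ 0)
    have hd1 : (1 : ℚ) < d := by exact_mod_cast S.hd1
    apply not_sq_neg_in_k S.hw (n := - d) (by linarith) (d * y)
    simp only [map_neg, map_intCast]
    linear_combination (d : ℚ⟮w⟯) * hy

theorem adj_i_eq_top : (ℚ⟮w⟯⟮t⟯)⟮i⟯ = ⊤ := by
  have hw : w ∈ (ℚ⟮w⟯⟮t⟯)⟮i⟯ :=
    IntermediateField.algebraMap_mem _ (algebraMap ℚ⟮w⟯ (ℚ⟮w⟯⟮t⟯) (AdjoinSimple.gen ℚ w))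
  have ht : t ∈ (ℚ⟮w⟯⟮t⟯)⟮i⟯ :=
    IntermediateField.algebraMap_mem _ (AdjoinSimple.gen ℚ⟮w⟯ t)
  have hi : i ∈ (ℚ⟮w⟯⟮t⟯)⟮i⟯ := mem_adjoin_simple_self _ _
  generalize (ℚ⟮w⟯⟮t⟯)⟮i⟯ = E at *
  have h1 : IntermediateField.adjoin ℚ {i, w, t} ≤ E.restrictScalars ℚ := by
    rw [IntermediateField.adjoin_le_iff]
    intro x hx
    rcases hx with hx | hx | hx
    · rw [hx]; exact hi
    · rw [hx]; exact hw
    · rw [hx]; exact ht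
  rw [S.gen] at h1
  rw [eq_top_iff]
  intro x _
  exact h1 (IntermediateField.mem_top (x := x))

theorem quad3 : IsQuad (ℚ⟮w⟯⟮t⟯) L (-1) i where
  sq := by simpa using S.hi
  nsq := S.not_sq_neg_one
  span := by
    intro x
    have hx : x ∈ (ℚ⟮w⟯⟮t⟯)⟮i⟯ := by rw [S.adj_i_eq_top]; exact IntermediateField.mem_top
    obtain ⟨a, b, e⟩ := (IsQuad.of_adjoin (F := ℚ⟮w⟯⟮t⟯) (m := -1) (r := i) (by simpa using S.hi) S.not_sq_neg_one).span ⟨x, hx⟩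
    exact ⟨a, b, by simpa using congrArg Subtype.val e⟩

theorem finrank_eq : Module.finrank ℚ L = 8 := by
  rw [← Module.finrank_mul_finrank ℚ ℚ⟮w⟯ L, ← Module.finrank_mul_finrank ℚ⟮w⟯ (ℚ⟮w⟯⟮t⟯) L, S.quad3.finrank_eq,
    S.quad2.finrank_eq, (isQuad_w S.hw).finrank_eq]

theorem isGalois : IsGalois ℚ L := by
  rw [← isGalois_iff_isGalois_top, ← S.gen]
  have h1 : @IsGalois ℚ _ ℚ⟮i⟯ _ (IntermediateField.algebra' _) := (IsQuad.of_adjoin (m := (-1 : ℚ)) (r := i) (by simpa using S.hi)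
    (rat_sq_ne_of_neg (by norm_num))).isGalois
  have h2 : @IsGalois ℚ _ ℚ⟮w⟯ _ (IntermediateField.algebra' _) := (isQuad_w S.hw).isGalois
  have h3 : @IsGalois ℚ _ ℚ⟮t⟯ _ (IntermediateField.algebra' _) := (IsQuad.of_adjoin (m := (d : ℚ)) (r := t) (by simpa using S.ht)
    (rat_not_sq_d S.hd S.hd1)).isGalois
  have e : IntermediateField.adjoin ℚ {i, w, t} = ℚ⟮i⟯ ⊔ (ℚ⟮w⟯ ⊔ ℚ⟮t⟯) := by
    rw [← IntermediateField.adjoin_union, ← IntermediateField.adjoin_union]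
    rfl
  rw [e]
  have := normal_sup ℚ L ℚ⟮w⟯ ℚ⟮t⟯
  have := normal_sup ℚ L ℚ⟮i⟯ (ℚ⟮w⟯ ⊔ ℚ⟮t⟯)
  exact { }

theorem ext_aut {g g' : Gal(L/ℚ)} (h1 : g i = g' i) (h2 : g w = g' w) (h3 : g t = g' t) : g = g' := by
  have : (⊤ : IntermediateField ℚ L) ≤ IntermediateField.fixedField (Subgroup.zpowers (g'⁻¹ * g)) := by
    rw [← S.gen, IntermediateField.adjoin_le_iff]
    rintro x hx ⟨k, hk⟩
    have h0 : (g'⁻¹ * g) x = x := by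
      have h6 : g x = g' x := by
        rcases hx with hx | hx | hx
        · rw [hx, h1]
        · rw [hx, h2]
        · rw [hx, h3]
      rw [AlgEquiv.mul_apply, h6, ← AlgEquiv.mul_apply, inv_mul_cancel, AlgEquiv.one_apply]
    have hmem : k ∈ MulAction.stabilizer Gal(L/ℚ) x := by
      have : Subgroup.zpowers (g'⁻¹ * g) ≤ MulAction.stabilizer Gal(L/ℚ) x := by
        rw [Subgroup.zpowers_le]; exact h0
      exact this hk
    exact hmem
  apply AlgEquiv.ext
  intro x
  have h4 := this (IntermediateField.mem_top (x := x)) ⟨_, Subgroup.mem_zpowers _⟩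
  have h5 : g' ((g'⁻¹ * g) x) = g' x := congrArg g' h4
  simpa [AlgEquiv.mul_apply] using h5

theorem sgn_i (g : Gal(L/ℚ)) : g i = i ∨ g i = -i := by
  rw [← sq_eq_sq_iff_eq_or_eq_neg, ← map_pow, S.hi]; simp

theorem sgn_w (g : Gal(L/ℚ)) : g w = w ∨ g w = -w := by
  rw [← sq_eq_sq_iff_eq_or_eq_neg, ← map_pow, S.hw]
  exact map_ofNat g 2

theorem sgn_t (g : Gal(L/ℚ)) : g t = t ∨ g t = -t := by
  rw [← sq_eq_sq_iff_eq_or_eq_neg, ← map_pow, S.ht]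
  exact map_intCast g d

theorem exp_two (g : Gal(L/ℚ)) : g * g = 1 := by
  apply S.ext_aut
  · rcases S.sgn_i g with h | h <;> simp [AlgEquiv.mul_apply, h]
  · rcases S.sgn_w g with h | h <;> simp [AlgEquiv.mul_apply, h]
  · rcases S.sgn_t g with h | h <;> simp [AlgEquiv.mul_apply, h]

theorem isAbelianGalois : IsAbelianGalois ℚ L := by
  have := S.isGalois
  have : IsMulCommutative Gal(L/ℚ) := ⟨⟨fun a b => by
    have h1 := S.exp_two a
    have h2 := S.exp_two b
    have h3 := S.exp_two (a * b)
    have e1 : a⁻¹ = a := inv_eq_of_mul_eq_one_left h1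
    have e2 : b⁻¹ = b := inv_eq_of_mul_eq_one_left h2
    have e3 : (a * b)⁻¹ = a * b := inv_eq_of_mul_eq_one_left h3
    show a * b = b * a
    rw [← e3, mul_inv_rev, e1, e2]⟩⟩
  exact { }

theorem isTotallyComplex : IsTotallyComplex L where
  isComplex v := by
    rw [← InfinitePlace.not_isReal_iff_isComplex]
    intro hv
    have h1 := congrArg v.embedding S.hi
    rw [map_pow, map_neg, map_one] at h1
    have h2 := InfinitePlace.isReal_iff.mp hv
    have h3 : star (v.embedding i) = v.embedding i := RingHom.congr_fun h2 i
    obtain ⟨x, hx⟩ := Complex.conj_eq_iff_real.mp h3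
    rw [hx] at h1
    have h4 : x ^ 2 = -1 := by exact_mod_cast h1
    nlinarith [sq_nonneg x]

theorem isCMField : IsCMField L := by
  have := S.isAbelianGalois
  have := S.isTotallyComplex
  infer_instance

end Setup
end Setup

section SetupF

namespace Setup

variable {L : Type*} [Field L] [NumberField L] {d : ℤ} {i w t : L} (S : Setup L d i w t)
include S

theorem span8 (x : L) : ∃ a b c e a' b' c' e' : ℚ, x = ((a : L) + b * w + (c + e * w) * t) +
    (a' + b' * w + (c' + e' * w) * t) * i := by
  obtain ⟨u, v, rfl⟩ := S.quad3.span x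
  obtain ⟨u1, u2, rfl⟩ := S.quad2.span u
  obtain ⟨v1, v2, rfl⟩ := S.quad2.span v
  obtain ⟨a, b, rfl⟩ := (isQuad_w S.hw).span u1
  obtain ⟨c, e, rfl⟩ := (isQuad_w S.hw).span u2
  obtain ⟨a', b', rfl⟩ := (isQuad_w S.hw).span v1
  obtain ⟨c', e', rfl⟩ := (isQuad_w S.hw).span v2
  refine ⟨a, b, c, e, a', b', c', e', ?_⟩
  have hw : algebraMap (ℚ⟮w⟯⟮t⟯) L (algebraMap ℚ⟮w⟯ (ℚ⟮w⟯⟮t⟯) (AdjoinSimple.gen ℚ w)) = w := rfl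
  have ht : algebraMap (ℚ⟮w⟯⟮t⟯) L (AdjoinSimple.gen ℚ⟮w⟯ t) = t := rfl
  simp only [map_add, map_mul, hw, ht, eq_ratCast, map_ratCast]

theorem real_of_sq {z : L} {n : ℤ} (hn : 0 ≤ n) (hz : z ^ 2 = n) : z ∈ maximalRealSubfield L := by
  rw [mem_maximalRealSubfield_iff]
  intro φ
  have h1 := congrArg φ hz
  rw [map_pow, map_intCast] at h1
  have h2 : ((Real.sqrt n : ℝ) : ℂ) ^ 2 = n := by
    rw [← Complex.ofReal_pow, Real.sq_sqrt (by exact_mod_cast hn)]; simp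
  rw [← h2, sq_eq_sq_iff_eq_or_eq_neg] at h1
  rcases h1 with h1 | h1 <;> rw [h1] <;> simp

theorem w_mem : w ∈ maximalRealSubfield L := S.real_of_sq (n := 2) (by norm_num) (by simpa using S.hw)

theorem t_mem : t ∈ maximalRealSubfield L := S.real_of_sq (n := d) (by have := S.hd1; omega) S.ht

theorem i_not_mem : i ∉ maximalRealSubfield L := by
  rw [mem_maximalRealSubfield_iff]
  intro h
  obtain ⟨φ⟩ : Nonempty (L →+* ℂ) := inferInstance
  obtain ⟨x, hx⟩ := Complex.conj_eq_iff_real.mp (h φ)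
  have h1 := congrArg φ S.hi
  rw [map_pow, map_neg, map_one, hx] at h1
  have h4 : x ^ 2 = -1 := by exact_mod_cast h1
  nlinarith [sq_nonneg x]

theorem conj_i [IsCMField L] : IsCMField.complexConj L i = -i := by
  have h : (IsCMField.complexConj L i) ^ 2 = i ^ 2 := by
    rw [← map_pow, S.hi]; simp
  rcases sq_eq_sq_iff_eq_or_eq_neg.mp h with h | h
  · exact absurd ((IsCMField.complexConj_eq_self_iff L i).mp h) S.i_not_mem
  · exact h

theorem mem_real_iff [IsCMField L] (x : L) : x ∈ maximalRealSubfield L ↔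
    ∃ a b c e : ℚ, x = (a : L) + b * w + (c + e * w) * t := by
  constructor
  · intro hx
    have h1 := (IsCMField.complexConj_eq_self_iff L x).mpr hx
    obtain ⟨a, b, c, e, a', b', c', e', rfl⟩ := S.span8 x
    have hw := (IsCMField.complexConj_eq_self_iff L w).mpr S.w_mem
    have ht := (IsCMField.complexConj_eq_self_iff L t).mpr S.t_mem
    refine ⟨a, b, c, e, ?_⟩
    simp only [map_add, map_mul, hw, ht, S.conj_i, map_ratCast] at h1
    have h2 : (2 : L) ≠ 0 := two_ne_zero
    have h3 : 2 * ((a' + b' * w + (c' + e' * w) * t) * i) = 0 := by linear_combination -h1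
    rcases mul_eq_zero.mp h3 with h4 | h4
    · exact absurd h4 h2
    · rw [h4, add_zero]
  · rintro ⟨a, b, c, e, rfl⟩
    have hr : ∀ q : ℚ, (q : L) ∈ maximalRealSubfield L := fun q => SubfieldClass.ratCast_mem _ q
    exact add_mem (add_mem (hr a) (mul_mem (hr b) S.w_mem))
      (mul_mem (add_mem (hr c) (mul_mem (hr e) S.w_mem)) S.t_mem)

theorem isBiq [IsCMField L] : IsBiq (maximalRealSubfield L) d ⟨w, S.w_mem⟩ ⟨t, S.t_mem⟩ where
  hw := Subtype.ext S.hw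
  ht := Subtype.ext (by simpa using S.ht)
  hd1 := S.hd1
  hd8 := S.hd8
  hd := S.hd
  span := by
    rintro ⟨x, hx⟩
    obtain ⟨a, b, c, e, rfl⟩ := (S.mem_real_iff x).mp hx
    refine ⟨(a : ℚ⟮(⟨w, S.w_mem⟩ : maximalRealSubfield L)⟯) + b * AdjoinSimple.gen ℚ (⟨w, S.w_mem⟩ : maximalRealSubfield L),
      (c : ℚ⟮(⟨w, S.w_mem⟩ : maximalRealSubfield L)⟯) + e * AdjoinSimple.gen ℚ (⟨w, S.w_mem⟩ : maximalRealSubfield L), ?_⟩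
    apply Subtype.ext
    simp

theorem isGalois_real [IsCMField L] : IsGalois ℚ (maximalRealSubfield L) := by
  have := S.isAbelianGalois
  exact (IsAbelianGalois.tower_bot ℚ (maximalRealSubfield L) L).toIsGalois

/-- the Galois group of `L / K⁺` inside the one of `L / ℚ` -/
def HR (L : Type*) [Field L] [NumberField L] (w t : L) : Subgroup Gal(L/ℚ) :=
  MulAction.stabilizer Gal(L/ℚ) w ⊓ MulAction.stabilizer Gal(L/ℚ) t

omit S in
theorem mem_HR {g : Gal(L/ℚ)} : g ∈ HR L w t ↔ g w = w ∧ g t = t := Iff.rfl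

theorem isGaloisGroup_HR [IsCMField L] : IsGaloisGroup (HR L w t) (maximalRealSubfield L) L where
  faithful := inferInstance
  commutes := ⟨by
    rintro ⟨g, hg⟩ ⟨x, hx⟩ y
    obtain ⟨hg1, hg2⟩ := mem_HR.mp hg
    show g (x * y) = x * g y
    rw [map_mul]
    congr 1
    obtain ⟨a, b, c, e, rfl⟩ := (S.mem_real_iff x).mp hx
    simp [hg1, hg2]⟩
  isInvariant := ⟨by
    intro x hx
    have hw := (IsCMField.complexConj_eq_self_iff L w).mpr S.w_mem
    have ht := (IsCMField.complexConj_eq_self_iff L t).mpr S.t_mem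
    have h1 := hx ⟨(IsCMField.complexConj L).restrictScalars ℚ, mem_HR.mpr ⟨hw, ht⟩⟩
    exact ⟨⟨x, (IsCMField.complexConj_eq_self_iff L x).mp h1⟩, rfl⟩⟩

theorem card_HR [IsCMField L] : Nat.card (HR L w t) = 2 := by
  have := S.isGaloisGroup_HR
  rw [IsGaloisGroup.card_eq_finrank (HR L w t) (maximalRealSubfield L) L]
  exact Algebra.IsQuadraticExtension.finrank_eq_two _ _

omit S in
theorem mem_fixing {r : L} {g : Gal(L/ℚ)} : g ∈ _root_.fixingSubgroup Gal(L/ℚ) (ℚ⟮r⟯ : Set L) ↔ g r = r := by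
  constructor
  · intro h
    exact h ⟨r, mem_adjoin_simple_self ℚ r⟩
  · rintro h ⟨x, hx⟩
    have : ℚ⟮r⟯ ≤ IntermediateField.fixedField (Subgroup.zpowers g) := by
      rw [IntermediateField.adjoin_simple_le_iff]
      rintro ⟨k, hk⟩
      have : Subgroup.zpowers g ≤ MulAction.stabilizer Gal(L/ℚ) r := by
        rw [Subgroup.zpowers_le]; exact h
      exact this hk
    exact this hx ⟨g, Subgroup.mem_zpowers g⟩

theorem card_fixing {r : L} {m : ℚ} (h : IsQuad ℚ ℚ⟮r⟯ m (AdjoinSimple.gen ℚ r)) :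
    Nat.card (_root_.fixingSubgroup Gal(L/ℚ) (ℚ⟮r⟯ : Set L)) = 4 := by
  have := S.isGalois
  rw [IsGaloisGroup.card_eq_finrank _ ℚ⟮r⟯ L]
  have h1 := Module.finrank_mul_finrank ℚ ℚ⟮r⟯ L
  rw [h.finrank_eq, S.finrank_eq] at h1
  omega

theorem q1 : IsQuad ℚ ℚ⟮i⟯ ((-1 : ℤ) : ℚ) (AdjoinSimple.gen ℚ i) :=
  IsQuad.of_adjoin (by simpa using S.hi) (rat_sq_ne_of_neg (by norm_num))

theorem q2 : IsQuad ℚ ℚ⟮i * w⟯ ((-2 : ℤ) : ℚ) (AdjoinSimple.gen ℚ (i * w)) :=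
  IsQuad.of_adjoin (by rw [mul_pow, S.hi, S.hw]; simp) (rat_sq_ne_of_neg (by norm_num))

theorem q3 : IsQuad ℚ ℚ⟮i * t⟯ ((-d : ℤ) : ℚ) (AdjoinSimple.gen ℚ (i * t)) :=
  IsQuad.of_adjoin (by rw [mul_pow, S.hi, S.ht]; simp) (rat_sq_ne_of_neg (by
    have := S.hd1; exact_mod_cast (by omega : -d < 0)))

theorem q4 : IsQuad ℚ ℚ⟮i * w * t⟯ ((-2 * d : ℤ) : ℚ) (AdjoinSimple.gen ℚ (i * w * t)) :=
  IsQuad.of_adjoin (by rw [mul_pow, mul_pow, S.hi, S.ht, S.hw]; simp) (rat_sq_ne_of_neg (by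
    have := S.hd1; exact_mod_cast (by omega : -2 * d < 0)))

theorem ne_zero : i ≠ 0 ∧ w ≠ 0 ∧ t ≠ 0 := by
  have hd0 : (d : L) ≠ 0 := by have := S.hd1; exact_mod_cast (by omega : d ≠ 0)
  refine ⟨?_, ?_, ?_⟩ <;> rintro rfl
  · have := S.hi; simp at this
  · have := S.hw; simp at this
  · have := S.ht; simp at this; exact hd0 this.symm

theorem residue [IsCMField L] : dedekindZeta_residue L * dedekindZeta_residue ℚ ^ 4 =
    dedekindZeta_residue (maximalRealSubfield L) * dedekindZeta_residue ℚ⟮i⟯ * dedekindZeta_residue ℚ⟮i * w⟯ *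
      dedekindZeta_residue ℚ⟮i * t⟯ * dedekindZeta_residue ℚ⟮i * w * t⟯ := by
  have := S.isGalois
  have := S.isGalois_real
  have := S.isGaloisGroup_HR
  have := S.q1.isGalois
  have := S.q2.isGalois
  have := S.q3.isGalois
  have := S.q4.isGalois
  obtain ⟨hi0, hw0, ht0⟩ := S.ne_zero
  refine residue_identity L (maximalRealSubfield L) ℚ⟮i⟯ ℚ⟮i * w⟯ ℚ⟮i * t⟯ ℚ⟮i * w * t⟯ (HR L w t)
    (_root_.fixingSubgroup Gal(L/ℚ) (ℚ⟮i⟯ : Set L)) (_root_.fixingSubgroup Gal(L/ℚ) (ℚ⟮i * w⟯ : Set L))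
    (_root_.fixingSubgroup Gal(L/ℚ) (ℚ⟮i * t⟯ : Set L)) (_root_.fixingSubgroup Gal(L/ℚ) (ℚ⟮i * w * t⟯ : Set L))
    S.exp_two ?_ S.card_HR (S.card_fixing S.q1) (S.card_fixing S.q2) (S.card_fixing S.q3) (S.card_fixing S.q4) ?_
  · rw [IsGalois.card_aut_eq_finrank, S.finrank_eq]
  · intro g
    have h1 : g = 1 ↔ g i = i ∧ g w = w ∧ g t = t :=
      ⟨by rintro rfl; simp, fun h => S.ext_aut (by simpa using h.1) (by simpa using h.2.1) (by simpa using h.2.2)⟩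
    have hn : ∀ x : L, x ≠ 0 → ¬ (-x = x) := fun x hx h => hx (neg_eq_self.mp h)
    have a1 := hn i hi0
    have a2 := hn w hw0
    have a3 := hn t ht0
    have a4 := hn (i * w) (mul_ne_zero hi0 hw0)
    have a5 := hn (i * t) (mul_ne_zero hi0 ht0)
    have a6 := hn (i * w * t) (mul_ne_zero (mul_ne_zero hi0 hw0) ht0)
    classical
    rw [if_congr h1 rfl rfl, if_congr (mem_HR (w := w) (t := t)) rfl rfl, if_congr (mem_fixing (r := i)) rfl rfl,
      if_congr (mem_fixing (r := i * w)) rfl rfl, if_congr (mem_fixing (r := i * t)) rfl rfl,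
      if_congr (mem_fixing (r := i * w * t)) rfl rfl]
    simp only [map_mul]
    rcases S.sgn_i g with h | h <;> rcases S.sgn_w g with h' | h' <;> rcases S.sgn_t g with h'' | h'' <;>
      simp only [h, h', h'', a1, a2, a3, a4, a5, a6, neg_mul, mul_neg, neg_neg, if_true, if_false, and_true, and_false,
        and_self, true_and, false_and]

end Setup
end SetupF

section SetupG

theorem exists_primitive_of_dvd (K : Type*) [Field K] [NumberField K] {n : ℕ} (hn : n ∣ Units.torsionOrder K) :
    ∃ ζ : K, IsPrimitiveRoot ζ n := by
  obtain ⟨μ, hμ⟩ : ∃ μ : Units.torsion K, orderOf μ = Units.torsionOrder K := by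
    rw [← IsCyclic.exponent_eq_card.trans (Units.torsionOrder.eq_1 K).symm]
    exact Monoid.exists_orderOf_eq_exponent (Monoid.ExponentExists.of_finite)
  rw [← Subgroup.orderOf_coe, ← orderOf_units] at hμ
  have h1 : IsPrimitiveRoot (((μ : (𝓞 K)ˣ) : 𝓞 K)) (Units.torsionOrder K) := by
    rw [← hμ]; exact IsPrimitiveRoot.orderOf _
  have h2 := h1.map_of_injective (f := algebraMap (𝓞 K) K) RingOfIntegers.coe_injective
  obtain ⟨k, hk⟩ := hn
  exact ⟨_, h2.pow (Units.torsionOrder_pos K) (by rw [hk, mul_comm])⟩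

theorem torsionOrder_of_real (K : Type*) [Field K] [NumberField K] (φ : K →+* ℝ) : Units.torsionOrder K = 2 := by
  obtain ⟨ζ, hζ⟩ := exists_primitive_of_dvd K (dvd_refl _)
  have h1 := hζ.map_of_injective (f := φ) φ.injective
  have h2 : φ ζ = 1 ∨ φ ζ = -1 := by
    have := h1.pow_eq_one
    rcases eq_or_ne (φ ζ) 0 with h | h
    · rw [h, zero_pow (Units.torsionOrder_ne_zero K)] at this; norm_num at this
    · have h3 : |φ ζ| ^ Units.torsionOrder K = 1 := by rw [← abs_pow, this, abs_one]
      have h4 := (pow_eq_one_iff_of_nonneg (abs_nonneg _) (Units.torsionOrder_ne_zero K)).mp h3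
      rcases abs_eq (zero_le_one) |>.mp h4 with h | h
      · exact Or.inl h
      · exact Or.inr h
  have h5 : (φ ζ) ^ 2 = 1 := by rcases h2 with h | h <;> rw [h] <;> norm_num
  have h6 := h1.dvd_of_pow_eq_one _ h5
  have h7 := Units.even_torsionOrder K
  exact Nat.dvd_antisymm h6 h7.two_dvd

theorem regulator_rank_zero (K : Type*) [Field K] [NumberField K] (h : Units.rank K = 0) : Units.regulator K = 1 := by
  rw [Units.regulator_eq_regOfFamily_fundSystem]
  have : IsEmpty (Fin (Units.rank K)) := by rw [h]; infer_instance
  obtain ⟨w'⟩ : Nonempty (InfinitePlace K) := inferInstance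
  classical
  have hc : Fintype.card (InfinitePlace K) ≤ 1 := by
    have := h
    rw [Units.rank] at this
    omega
  have := Fintype.card_le_one_iff_subsingleton.mp hc
  have : IsEmpty {w // w ≠ w'} := ⟨fun x => x.2 (Subsingleton.elim _ _)⟩
  rw [Units.regOfFamily_eq_det _ w' (Equiv.equivOfIsEmpty _ _)]
  simp

theorem residue_rat : dedekindZeta_residue ℚ = 1 := by
  rw [dedekindZeta_residue_def]
  have h1 := InfinitePlace.nrComplexPlaces_eq_zero_of_finrank_eq_one (K := ℚ) (by simp)
  have h2 := InfinitePlace.nrRealPlaces_eq_one_of_finrank_eq_one (K := ℚ) (by simp)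
  rw [regulator_rank_zero, h1, h2, torsionOrder_of_real ℚ (algebraMap ℚ ℝ), Rat.classNumber_eq, Rat.numberField_discr]
  · norm_num
  · rw [Units.rank, InfinitePlace.card_eq_nrRealPlaces_add_nrComplexPlaces, h1, h2]

theorem residue_imag (K : Type*) [Field K] [NumberField K] [IsTotallyComplex K] (h : Module.finrank ℚ K = 2) :
    dedekindZeta_residue K = 2 * Real.pi * classNumber K / (Units.torsionOrder K * Real.sqrt |discr K|) := by
  have h0 := InfinitePlace.card_add_two_mul_card_eq_rank K
  have h1 := IsTotallyComplex.nrRealPlaces_eq_zero K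
  have h2 : InfinitePlace.nrComplexPlaces K = 1 := by omega
  rw [dedekindZeta_residue_def, regulator_rank_zero, h1, h2]
  · simp
  · rw [Units.rank, InfinitePlace.card_eq_nrRealPlaces_add_nrComplexPlaces, h1, h2]

theorem totallyComplex_of_sq_neg {K : Type*} [Field K] [NumberField K] {x : K} {n : ℤ} (hn : n < 0) (hx : x ^ 2 = n) :
    IsTotallyComplex K where
  isComplex v := by
    rw [← InfinitePlace.not_isReal_iff_isComplex]
    intro hv
    have h1 := congrArg v.embedding hx
    rw [map_pow, map_intCast] at h1
    have h2 := InfinitePlace.isReal_iff.mp hv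
    have h3 : star (v.embedding x) = v.embedding x := RingHom.congr_fun h2 x
    obtain ⟨y, hy⟩ := Complex.conj_eq_iff_real.mp h3
    rw [hy] at h1
    have h4 : y ^ 2 = (n : ℝ) := by exact_mod_cast h1
    have h5 : (n : ℝ) < 0 := by exact_mod_cast hn
    nlinarith [sq_nonneg y]

theorem IsQuad.residue_eq {K : Type*} [Field K] [NumberField K] {m : ℤ} {r : K} (h : IsQuad ℚ K m r) (hm : m < 0) :
    dedekindZeta_residue K = 2 * Real.pi * classNumber K / (Units.torsionOrder K * Real.sqrt |discr K|) := by
  have := totallyComplex_of_sq_neg (K := K) hm (by simpa using h.sq)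
  exact residue_imag K h.finrank_eq

end SetupG

section SetupG2

theorem cf_aux {π RL Rp Q hL hp a b c e wL wa wb wc we sL sp sa sb sc se : ℝ} (hπ : 0 < π) (hRp : 0 < Rp) (hQ : 0 < Q)
    (hwL : 0 < wL) (hwa : 0 < wa) (hwb : 0 < wb) (hwc : 0 < wc) (hwe : 0 < we)
    (hsL : 0 < sL) (hsp : 0 < sp) (hsa : 0 < sa) (hsb : 0 < sb) (hsc : 0 < sc) (hse : 0 < se)
    (hR : RL / Rp = 2 ^ 3 * Q⁻¹)
    (h : 2 ^ 0 * (2 * π) ^ 4 * RL * hL / (wL * sL) = 2 ^ 4 * (2 * π) ^ 0 * Rp * hp / ((2 : ℕ) * sp) *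
      (2 * π * a / (wa * sa)) * (2 * π * b / (wb * sb)) * (2 * π * c / (wc * sc)) * (2 * π * e / (we * se))) :
    hL * sp * (wa * wb * wc * we) * (sa * sb * sc * se) = Q * hp * (a * b * c * e) * wL * sL := by
  have hRL : RL = 8 * Rp / Q := by
    field_simp at hR ⊢; linarith
  subst hRL
  field_simp at h
  norm_num at h
  linear_combination h / 16

theorem cf_aux2 {hL Q hp a b c e wL wa wb wc we DL Dp Da Db Dc De : ℕ} 
    (h : (hL : ℝ) * √Dp * (wa * wb * wc * we) * (√Da * √Db * √Dc * √De) = Q * hp * (a * b * c * e) * wL * √DL) :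
    hL ^ 2 * Dp * (wa * wb * wc * we) ^ 2 * (Da * Db * Dc * De) = Q ^ 2 * hp ^ 2 * (a * b * c * e) ^ 2 * wL ^ 2 * DL := by
  have hs : ∀ D : ℕ, (√(D : ℝ)) ^ 2 = D := fun D => Real.sq_sqrt (Nat.cast_nonneg D)
  have h2 := congrArg (· ^ 2) h
  simp only [mul_pow, hs] at h2
  have h3 : (hL : ℝ) ^ 2 * Dp * (wa * wb * wc * we) ^ 2 * (Da * Db * Dc * De) = Q ^ 2 * hp ^ 2 * (a * b * c * e) ^ 2 * wL ^ 2 * DL := by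
    linear_combination h2
  exact_mod_cast h3

variable {L : Type*} [Field L] [NumberField L] {d : ℤ} {i w t : L} 

theorem Setup.class_formula (S : Setup L d i w t) [IsCMField L] :
    classNumber L ^ 2 * (discr (maximalRealSubfield L)).natAbs *
      (Units.torsionOrder ℚ⟮i⟯ * Units.torsionOrder ℚ⟮i * w⟯ * Units.torsionOrder ℚ⟮i * t⟯ * Units.torsionOrder ℚ⟮i * w * t⟯) ^ 2 *
      ((discr ℚ⟮i⟯).natAbs * (discr ℚ⟮i * w⟯).natAbs * (discr ℚ⟮i * t⟯).natAbs * (discr ℚ⟮i * w * t⟯).natAbs) =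
    IsCMField.indexRealUnits L ^ 2 * classNumber (maximalRealSubfield L) ^ 2 *
      (classNumber ℚ⟮i⟯ * classNumber ℚ⟮i * w⟯ * classNumber ℚ⟮i * t⟯ * classNumber ℚ⟮i * w * t⟯) ^ 2 *
      Units.torsionOrder L ^ 2 * (discr L).natAbs := by
  have h := S.residue
  have hd := S.hd1
  rw [residue_rat, one_pow, mul_one, S.q1.residue_eq (by norm_num), S.q2.residue_eq (by norm_num),
    S.q3.residue_eq (by omega), S.q4.residue_eq (by omega), dedekindZeta_residue_def, dedekindZeta_residue_def] at h
  have hR := IsCMField.regulator_div_regulator_eq_two_pow_mul_indexRealUnits_inv L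
  have hrL : InfinitePlace.nrRealPlaces L = 0 := IsTotallyComplex.nrRealPlaces_eq_zero L
  have hcL : InfinitePlace.nrComplexPlaces L = 4 := by
    have := InfinitePlace.card_add_two_mul_card_eq_rank L
    rw [S.finrank_eq] at this; omega
  have hrp : InfinitePlace.nrComplexPlaces (maximalRealSubfield L) = 0 := IsTotallyReal.nrComplexPlaces_eq_zero _
  have hfp : Module.finrank ℚ (maximalRealSubfield L) = 4 := by
    have := Module.finrank_mul_finrank ℚ (maximalRealSubfield L) L
    rw [S.finrank_eq, Algebra.IsQuadraticExtension.finrank_eq_two (maximalRealSubfield L) L] at this; omega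
  have hcp : InfinitePlace.nrRealPlaces (maximalRealSubfield L) = 4 := by
    have := InfinitePlace.card_add_two_mul_card_eq_rank (maximalRealSubfield L)
    rw [hfp] at this; omega
  have hrank : Units.rank L = 3 := by
    rw [Units.rank, InfinitePlace.card_eq_nrRealPlaces_add_nrComplexPlaces, hrL, hcL]
  have htp : Units.torsionOrder (maximalRealSubfield L) = 2 := by
    obtain ⟨v⟩ : Nonempty (InfinitePlace (maximalRealSubfield L)) := inferInstance
    exact torsionOrder_of_real _ (InfinitePlace.embedding_of_isReal (IsTotallyReal.isReal v))
  rw [hrL, hcL, hrp, hcp, htp] at h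
  rw [hrank] at hR
  have hD : ∀ (K : Type _) [Field K] [NumberField K], 0 < √(((discr K).natAbs : ℕ) : ℝ) := fun K _ _ => by
    apply Real.sqrt_pos_of_pos
    exact_mod_cast Int.natAbs_pos.mpr (discr_ne_zero K)
  have hD' : ∀ n : ℤ, |(n : ℝ)| = ((n.natAbs : ℕ) : ℝ) := fun n => by
    rw [Nat.cast_natAbs]; simp
  have ht : ∀ (K : Type _) [Field K] [NumberField K], (0 : ℝ) < Units.torsionOrder K := fun K _ _ => by
    exact_mod_cast Units.torsionOrder_pos K
  have hQ : (0 : ℝ) < IsCMField.indexRealUnits L := by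
    rcases IsCMField.indexRealUnits_eq_one_or_two L with h | h <;> rw [h] <;> norm_num
  simp only [hD'] at h
  apply cf_aux2
  exact cf_aux Real.pi_pos (Units.regulator_pos (maximalRealSubfield L)) hQ (ht L) (ht _) (ht _) (ht _) (ht _) (hD L) (hD _) (hD _) (hD _)
    (hD _) (hD _) hR h

end SetupG2

section SetupG3

variable {M : Type*} [Field M] [NumberField M] {d : ℤ} {w t : M}

theorem isQuad_t (ht : t ^ 2 = d) (hd1 : 1 < d) (hd : Squarefree d) : IsQuad ℚ ℚ⟮t⟯ ((d : ℤ) : ℚ) (AdjoinSimple.gen ℚ t) :=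
  IsQuad.of_adjoin (by simpa using ht) (fun q => rat_not_sq_d hd hd1 q)

theorem isQuad_w' (hw : w ^ 2 = 2) : IsQuad ℚ ℚ⟮w⟯ ((2 : ℤ) : ℚ) (AdjoinSimple.gen ℚ w) := by
  simpa using isQuad_w hw

theorem discr_t (ht : t ^ 2 = d) (hd1 : 1 < d) (hd8 : d % 8 = 1) (hd : Squarefree d) : discr ℚ⟮t⟯ = d :=
  (isQuad_t ht hd1 hd).discr_1 hd (by omega)

theorem discr_w (hw : w ^ 2 = 2) : discr ℚ⟮w⟯ = 8 := by
  rw [(isQuad_w' hw).discr_23 (Int.prime_two.squarefree) (by norm_num)]; norm_num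

theorem coprime_two_pow_d (hd8 : d % 8 = 1) (n : ℕ) : IsCoprime ((2 : ℤ) ^ n) d :=
  IsCoprime.pow_left ⟨-(d / 2), 1, by omega⟩

theorem discr_comp (K₁ : IntermediateField ℚ M) (ht : t ^ 2 = d) (hd1 : 1 < d) (hd8 : d % 8 = 1) (hd : Squarefree d)
    (n : ℕ) (h1 : (discr K₁).natAbs = 2 ^ n) (htop : K₁ ⊔ ℚ⟮t⟯ = ⊤) :
    (discr M).natAbs = (2 ^ n) ^ 2 * d.natAbs ^ (Module.finrank ℚ K₁) := by
  have hc : IsCoprime (discr K₁) (discr ℚ⟮t⟯) := by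
    rw [discr_t ht hd1 hd8 hd]
    have h := coprime_two_pow_d hd8 n
    rw [Int.isCoprime_iff_gcd_eq_one, Int.gcd, h1] 
    rw [Int.isCoprime_iff_gcd_eq_one, Int.gcd] at h
    simpa using h
  have hg : IsGalois ℚ ℚ⟮t⟯ := (isQuad_t ht hd1 hd).isGalois
  have hl : K₁.LinearDisjoint ℚ⟮t⟯ := (linearDisjoint_of_isGalois_isCoprime_discr M ℚ⟮t⟯ K₁ hc.symm).symm
  rw [natAbs_discr_eq_natAbs_discr_pow_mul_natAbs_discr_pow M K₁ ℚ⟮t⟯ hl htop (isCoprime_differentIdeal_of_isCoprime_discr M hc),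
    h1, discr_t ht hd1 hd8 hd, (isQuad_t ht hd1 hd).finrank_eq]

theorem IsBiq.discr_eq (h : IsBiq M d w t) : (discr M).natAbs = 64 * d.natAbs ^ 2 := by
  rw [discr_comp ℚ⟮w⟯ h.ht h.hd1 h.hd8 h.hd 3 (by rw [discr_w h.hw]; rfl), (isQuad_w' h.hw).finrank_eq]
  · norm_num
  rw [eq_top_iff]
  intro x _
  obtain ⟨a, b, rfl⟩ := h.span x
  refine add_mem ?_ (mul_mem ?_ ?_)
  · exact (le_sup_left : ℚ⟮w⟯ ≤ ℚ⟮w⟯ ⊔ ℚ⟮t⟯) a.2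
  · exact (le_sup_left : ℚ⟮w⟯ ≤ ℚ⟮w⟯ ⊔ ℚ⟮t⟯) b.2
  · exact (le_sup_right : ℚ⟮t⟯ ≤ ℚ⟮w⟯ ⊔ ℚ⟮t⟯) (mem_adjoin_simple_self ℚ t)

variable {L : Type*} [Field L] [NumberField L] {i w t : L} 

namespace Setup
variable (S : Setup L d i w t)
include S

theorem prim8 : IsPrimitiveRoot (w * (1 + i) / 2) (2 ^ 3) := by
  have h4 : (w * (1 + i) / 2) ^ 4 = -1 := by
    have : (w * (1 + i) / 2) ^ 2 = i := by
      field_simp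
      rw [S.hw]; linear_combination 2 * S.hi
    rw [show (w * (1 + i) / 2) ^ 4 = ((w * (1 + i) / 2) ^ 2) ^ 2 by ring, this, S.hi]
  rw [IsPrimitiveRoot.iff_orderOf]
  apply orderOf_eq_prime_pow
  · rw [show 2 ^ 2 = 4 by rfl, h4]; norm_num
  · rw [show 2 ^ (2 + 1) = 4 * 2 by rfl, pow_mul, h4]; norm_num

theorem discr_L : (discr L).natAbs = 2 ^ 16 * d.natAbs ^ 4 := by
  have hc := S.prim8.intermediateField_adjoin_isCyclotomicExtension ℚ
  set ζ := w * (1 + i) / 2 with hζ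
  have hc' : @IsCyclotomicExtension {2 ^ 3} ℚ ℚ⟮ζ⟯ _ _ DivisionRing.toRatAlgebra := by
    convert hc
    · rfl
    · exact Subsingleton.elim (α := Algebra ℚ ℚ⟮ζ⟯) _ _
  have hp : Fact (Nat.Prime 2) := ⟨Nat.prime_two⟩
  have hd' : (discr ℚ⟮ζ⟯).natAbs = 2 ^ 8 := by
    have := IsCyclotomicExtension.Rat.discr_prime_pow 2 3 ℚ⟮ζ⟯
    rw [this]; rw [Int.natAbs_mul]; simp [Int.natAbs_pow]
  have hf : Module.finrank ℚ ℚ⟮ζ⟯ = 4 := by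
    rw [IsCyclotomicExtension.Rat.finrank (2 ^ 3) ℚ⟮ζ⟯]
    decide
  rw [discr_comp ℚ⟮ζ⟯ S.ht S.hd1 S.hd8 S.hd 8 hd', hf]
  · norm_num
  rw [eq_top_iff, ← S.gen, adjoin_le_iff]
  have hz : ζ ∈ ℚ⟮ζ⟯ ⊔ ℚ⟮t⟯ := (le_sup_left : ℚ⟮ζ⟯ ≤ ℚ⟮ζ⟯ ⊔ ℚ⟮t⟯) (mem_adjoin_simple_self ℚ ζ)
  have hi' : i = ζ ^ 2 := by
    rw [hζ]; field_simp
    rw [S.hw]; linear_combination - 2 * S.hi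
  have hw' : w = ζ * (1 - i) := by
    rw [hζ]; field_simp
    linear_combination w * S.hi
  have hi2 : i ∈ ℚ⟮ζ⟯ ⊔ ℚ⟮t⟯ := by rw [hi']; exact pow_mem hz 2
  rintro x (rfl | rfl | rfl)
  · exact hi2
  · rw [hw']; exact mul_mem hz (sub_mem (one_mem _) hi2)
  · exact (le_sup_right : ℚ⟮x⟯ ≤ ℚ⟮ζ⟯ ⊔ ℚ⟮x⟯) (mem_adjoin_simple_self ℚ x)

theorem discr_real [IsCMField L] : (discr (maximalRealSubfield L)).natAbs = 64 * d.natAbs ^ 2 := S.isBiq.discr_eq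

end Setup
end SetupG3

section SetupG4

theorem IsQuad.not_four_dvd {K : Type*} [Field K] [NumberField K] {m : ℚ} {r : K} (h : IsQuad ℚ K m r)
    (hm : ∀ y : ℚ, m * y ^ 2 ≠ -1) : ¬ 4 ∣ Units.torsionOrder K := by
  intro h4
  obtain ⟨ζ, hζ⟩ := exists_primitive_of_dvd K h4
  have h2 : ζ ^ 2 = -1 := (hζ.pow (by norm_num) (show 4 = 2 * 2 by rfl)).eq_neg_one_of_two_right
  obtain ⟨y, hy | hy⟩ := h.sq_eq (n := -1) (x := ζ) (by simpa using h2)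
  · nlinarith
  · exact hm y hy

theorem IsQuad.torsion_two {K : Type*} [Field K] [NumberField K] {m : ℚ} {r : K} (h : IsQuad ℚ K m r)
    (hm : ∀ y : ℚ, y ^ 2 ≠ -m) : ∃ a, Odd a ∧ Units.torsionOrder K = 2 * a := by
  obtain ⟨a, ha⟩ := Units.even_torsionOrder K
  refine ⟨a, ?_, by omega⟩
  rw [← Nat.not_even_iff_odd]
  rintro ⟨b, hb⟩
  refine h.not_four_dvd (fun y hy => hm (m * y) ?_) ⟨b, by omega⟩
  linear_combination m * hy

theorem IsQuad.torsion_four {K : Type*} [Field K] [NumberField K] {r : K} (h : IsQuad ℚ K ((-1 : ℤ) : ℚ) r) :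
     ∃ a, Odd a ∧ Units.torsionOrder K = 4 * a := by
  have hr : r ^ 2 = -1 := by simpa using h.sq
  have h4 : IsPrimitiveRoot r (2 ^ 2) := by
    rw [IsPrimitiveRoot.iff_orderOf]
    apply orderOf_eq_prime_pow
    · rw [show 2 ^ 1 = 2 by rfl, hr]; norm_num
    · rw [show 2 ^ (1 + 1) = 2 * 2 by rfl, pow_mul, hr]; norm_num
  obtain ⟨a, ha⟩ := Units.dvd_torsionOrder_of_isPrimitiveRoot h4
  refine ⟨a, ?_, ha⟩
  rw [← Nat.not_even_iff_odd]
  rintro ⟨b, hb⟩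
  obtain ⟨ζ, hζ⟩ := exists_primitive_of_dvd K (n := 8) ⟨b, by omega⟩
  have h2 : ζ ^ 4 = -1 := (hζ.pow (by norm_num) (show 8 = 4 * 2 by rfl)).eq_neg_one_of_two_right
  have h0 : ζ ≠ 0 := hζ.ne_zero (by norm_num)
  obtain ⟨y, hy | hy⟩ := h.sq_eq (n := 2) (x := ζ + ζ⁻¹) (by
    rw [map_ofNat]
    field_simp
    linear_combination h2)
  · exact rat_not_sq_two y hy
  · push_cast at hy; nlinarith

theorem classNumber_one_of_imag {K : Type*} [Field K] [NumberField K] {m : ℤ} {r : K} (h : IsQuad ℚ K m r)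
    (hm : m < 0) (hD : |discr K| ≤ 8) : classNumber K = 1 := by
  rw [classNumber_eq_one_iff]
  apply RingOfIntegers.isPrincipalIdealRing_of_abs_discr_lt
  have htc : IsTotallyComplex K := totallyComplex_of_sq_neg (x := r) (n := m) hm (by simpa using h.sq)
  have hc : InfinitePlace.nrComplexPlaces K = 1 := by
    have := IsTotallyComplex.finrank K
    rw [h.finrank_eq] at this
    omega
  rw [hc, h.finrank_eq]
  have h1 : ((|discr K| : ℤ) : ℝ) ≤ 8 := by exact_mod_cast hD
  have h3 := Real.pi_gt_three
  norm_num [Nat.factorial]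
  norm_num at h1
  nlinarith

variable {L : Type*} [Field L] [NumberField L] {d : ℤ} {i w t : L} 

namespace Setup
variable (S : Setup L d i w t)
include S

theorem exists_neg_w : ∃ g : Gal(L/ℚ), g w = -w := by
  by_contra! hc
  have hG := S.isGalois
  have h1 : w ∈ (⊥ : IntermediateField ℚ L) := by
    rw [IsGalois.mem_bot_iff_fixed]
    intro g
    exact (S.sgn_w g).resolve_right (hc g)
  obtain ⟨q, hq⟩ := mem_bot.mp h1
  refine rat_not_sq_two q ((algebraMap ℚ L).injective ?_)
  rw [map_pow, hq, S.hw, map_ofNat]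

theorem torsion_L : ∃ a, Odd a ∧ Units.torsionOrder L = 8 * a := by
  obtain ⟨a, ha⟩ := Units.dvd_torsionOrder_of_isPrimitiveRoot S.prim8
  refine ⟨a, ?_, ha⟩
  rw [← Nat.not_even_iff_odd]
  rintro ⟨b, hb⟩
  obtain ⟨ζ, hζ⟩ := exists_primitive_of_dvd L (n := 16) ⟨b, by omega⟩
  have h2 : ζ ^ 8 = -1 := (hζ.pow (by norm_num) (show 16 = 8 * 2 by rfl)).eq_neg_one_of_two_right
  have h0 : ζ ≠ 0 := hζ.ne_zero (by norm_num)
  obtain ⟨g, hg⟩ := S.exists_neg_w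
  set s := ζ + ζ⁻¹ with hs
  have hs1 : (s ^ 2 - 2 - w) * (s ^ 2 - 2 + w) = 0 := by
    have : (s ^ 2 - 2) ^ 2 = 2 := by
      rw [hs]; field_simp; linear_combination h2
    linear_combination this - S.hw
  have hw0 : w ≠ 0 := by rintro rfl; simpa using S.hw
  have hgg : g (g s) = s := by
    have := S.exp_two g
    exact congrArg (fun f : Gal(L/ℚ) => f s) this
  have hk : ∃ e : L, s ^ 2 = 2 + e ∧ g e = -e ∧ e ^ 2 = 2 := by
    rcases mul_eq_zero.mp hs1 with h | h
    · exact ⟨w, by linear_combination h, hg, S.hw⟩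
    · exact ⟨-w, by linear_combination h, by rw [map_neg, hg], by rw [neg_sq, S.hw]⟩
  obtain ⟨e, he, hge, he2⟩ := hk
  have hgs : (g s) ^ 2 = 2 - e := by
    rw [← map_pow, he, map_add, hge, map_ofNat]; ring
  have hp : (s * g s - w) * (s * g s + w) = 0 := by
    linear_combination (g s) ^ 2 * he + (2 + e) * hgs - he2 - S.hw
  have hfix : g (s * g s) = s * g s := by rw [map_mul, hgg]; ring
  rcases mul_eq_zero.mp hp with h | h
  · rw [show s * g s = w by linear_combination h, hg] at hfix
    exact hw0 (by linear_combination (-1/2) * hfix)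
  · rw [show s * g s = -w by linear_combination h, map_neg, hg] at hfix
    exact hw0 (by linear_combination (1/2) * hfix)

theorem sqf_neg2d : Squarefree (-2 * d) := by
  have := sqf_two_mul S.hd S.hd8
  rwa [show -2 * d = -(2 * d) by ring, ← Int.squarefree_natAbs, Int.natAbs_neg, Int.squarefree_natAbs]

theorem sqf_negd : Squarefree (-d) := by
  rw [← Int.squarefree_natAbs, Int.natAbs_neg, Int.squarefree_natAbs]; exact S.hd

theorem class_formula2 [IsCMField L] : ∃ x y : ℕ, Odd x ∧ Odd y ∧ 
    4 * classNumber L * x = IsCMField.indexRealUnits L * classNumber (maximalRealSubfield L) * classNumber ℚ⟮i * t⟯ * 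
      classNumber ℚ⟮i * w * t⟯ * y := by
  have h := S.class_formula
  have d1 : discr ℚ⟮i⟯ = -4 := by
    rw [S.q1.discr_23 (by rw [← Int.squarefree_natAbs]; simp) (by norm_num)]; norm_num
  have d2 : discr ℚ⟮i * w⟯ = -8 := by
    rw [S.q2.discr_23 (by rw [← Int.squarefree_natAbs]; exact Nat.prime_two.squarefree) (by norm_num)]; norm_num
  have d3 : discr ℚ⟮i * t⟯ = 4 * -d := S.q3.discr_23 S.sqf_negd (by have := S.hd8; omega)
  have d4 : discr ℚ⟮i * w * t⟯ = 4 * (-2 * d) := S.q4.discr_23 S.sqf_neg2d (by have := S.hd8; omega)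
  have hd1 := S.hd1
  have c1 : classNumber ℚ⟮i⟯ = 1 := classNumber_one_of_imag S.q1 (by norm_num) (by rw [d1]; norm_num)
  have c2 : classNumber ℚ⟮i * w⟯ = 1 := classNumber_one_of_imag S.q2 (by norm_num) (by rw [d2]; norm_num)
  obtain ⟨a, ha, wL⟩ := S.torsion_L
  obtain ⟨b, hb, w1⟩ := S.q1.torsion_four
  obtain ⟨c, hc, w2⟩ := S.q2.torsion_two (fun y => by push_cast; rw [neg_neg]; exact rat_not_sq_two y)
  obtain ⟨e, he, w3⟩ := S.q3.torsion_two (fun y => by push_cast; rw [neg_neg]; exact rat_not_sq_d S.hd S.hd1 y)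
  obtain ⟨f, hf, w4⟩ := S.q4.torsion_two (fun y => by
    have := rat_not_sq_d (sqf_two_mul S.hd S.hd8) (by linarith) y
    push_cast at this ⊢
    rwa [neg_mul, neg_neg])
  rw [c1, c2, wL, w1, w2, w3, w4, d1, d2, d3, d4, S.discr_L, S.discr_real] at h
  refine ⟨b * c * e * f, a, by simp [Nat.odd_mul, *], ha, ?_⟩
  obtain ⟨n, hn⟩ : ∃ n : ℕ, d = n := ⟨d.toNat, by omega⟩
  have e3 : (4 * -d).natAbs = 4 * n := by omega
  have e4 : (4 * (-2 * d)).natAbs = 8 * n := by omega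
  have e5 : d.natAbs = n := by omega
  have hn0 : 0 < n := by omega
  rw [e3, e4, e5] at h
  apply Nat.pow_left_injective (n := 2) (by norm_num)
  have hz : (0 : ℕ) < 2 ^ 22 * n ^ 4 := by positivity
  apply Nat.eq_of_mul_eq_mul_left hz
  simp only [Int.reduceNegSucc, Int.natAbs_neg, Int.reduceNeg] at h
  norm_num at h
  dsimp only
  linear_combination h

end Setup
end SetupG4

section SetupH

variable {M : Type*} [Field M] [NumberField M] {d : ℤ} {w t : M}

theorem IsBiq.exists_sigma (h : IsBiq M d w t) : ∃ σ : M ≃+* M, (∀ a : ℚ⟮w⟯, σ (algebraMap ℚ⟮w⟯ M a) = algebraMap ℚ⟮w⟯ M a) ∧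
    σ t = -t ∧ ∀ x, σ (σ x) = x := by
  obtain ⟨σ, hσ⟩ := h.isQuad.exists_conj
  refine ⟨σ.toRingEquiv, fun a => σ.commutes a, ?_, ?_⟩
  · have := hσ 0 1
    simpa using this
  · intro x
    obtain ⟨a, b, rfl⟩ := h.span x
    change σ (σ _) = _
    have := hσ a (-b)
    rw [hσ, sub_eq_add_neg, ← neg_mul, ← map_neg, this, map_neg, neg_mul, sub_neg_eq_add]

theorem IsBiq.no_sqrt (h : IsBiq M d w t) {W s : 𝓞 M} (hW : algebraMap (𝓞 M) M W = w) (ε : (𝓞 M)ˣ)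
    (hs : s ^ 2 = W * ε) : False := by
  obtain ⟨σ, hσ, hσt, -⟩ := h.exists_sigma
  set τ := RingOfIntegers.mapRingEquiv σ with hτ
  have hτa : ∀ x, algebraMap (𝓞 M) M (τ x) = σ (algebraMap (𝓞 M) M x) := fun x => rfl
  have hW2 : W ^ 2 = 2 := by
    apply RingOfIntegers.ext
    change algebraMap (𝓞 M) M _ = algebraMap (𝓞 M) M _
    rw [map_pow, hW, h.hw, map_ofNat]
  have hτW : τ W = W := by
    apply RingOfIntegers.ext
    change algebraMap (𝓞 M) M _ = algebraMap (𝓞 M) M _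
    rw [hτa, hW]; exact hσ (AdjoinSimple.gen ℚ w)
  have hnorm : Ideal.absNorm (Ideal.span {s}) = 2 := by
    have hf : Module.finrank ℚ M = 4 := by
      have h1 := Module.finrank_mul_finrank ℚ ℚ⟮w⟯ M
      rw [(isQuad_w' h.hw).finrank_eq, h.isQuad.finrank_eq] at h1
      exact h1.symm
    have h4 : Ideal.absNorm (Ideal.span {s}) ^ 4 = 2 ^ 4 := by
      have e1 : s ^ 4 = 2 * ((ε ^ 2 : (𝓞 M)ˣ) : 𝓞 M) := by
        rw [show s ^ 4 = (s ^ 2) ^ 2 by ring, hs, mul_pow, hW2]; simp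
      rw [← map_pow, Ideal.span_singleton_pow, e1, Ideal.span_singleton_mul_right_unit (Units.isUnit _),
        Ideal.absNorm_span_singleton]
      have : (2 : 𝓞 M) = algebraMap ℤ (𝓞 M) 2 := by simp
      rw [this, Algebra.norm_algebraMap, RingOfIntegers.rank, hf]; rfl
    exact Nat.pow_left_injective (n := 4) (by norm_num) h4
  have hP : (Ideal.span {s}).IsPrime := Ideal.isPrime_of_irreducible_absNorm (by rw [hnorm]; exact Nat.prime_two)
  have hτs : τ s ∈ Ideal.span {s} := by
    apply hP.mem_of_pow_mem 2
    rw [← map_pow, hs, map_mul, hτW, Ideal.mem_span_singleton]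
    refine ⟨s * (ε⁻¹ : (𝓞 M)ˣ) * τ ε, ?_⟩
    have : (ε : 𝓞 M) * (ε⁻¹ : (𝓞 M)ˣ) = 1 := by simp
    linear_combination (-(ε⁻¹ : (𝓞 M)ˣ) * τ ε) * hs - W * τ ε * this
  have hτP : ∀ x ∈ Ideal.span {s}, τ x ∈ Ideal.span {s} := by
    intro x hx
    obtain ⟨c, rfl⟩ := Ideal.mem_span_singleton.mp hx
    rw [map_mul]; exact Ideal.mul_mem_right _ _ hτs
  obtain ⟨k, hk⟩ : ∃ k : ℤ, d = 1 + 8 * k := ⟨d / 8, by have := h.hd8; omega⟩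
  have ht := h.ht
  rw [hk] at ht
  push_cast at ht
  obtain ⟨θ, hθ⟩ := exists_ringOfIntegers (isIntegral_half (r := t) (k := 2 * k) (by
    field_simp; push_cast; linear_combination ht))
  have e1 : θ * (1 - θ) = 2 * (-(k : 𝓞 M)) := by
    apply RingOfIntegers.ext
    change algebraMap (𝓞 M) M _ = algebraMap (𝓞 M) M _
    simp only [map_mul, map_sub, map_one, map_neg, map_ofNat, map_intCast, hθ]
    field_simp; linear_combination - ht
  have e2 : τ θ = 1 - θ := by
    apply RingOfIntegers.ext
    change algebraMap (𝓞 M) M _ = algebraMap (𝓞 M) M _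
    rw [hτa]
    simp only [map_sub, map_one, hθ, map_div₀, map_add, map_ofNat, hσt]
    field_simp; ring
  have h2 : (2 : 𝓞 M) ∈ Ideal.span {s} := by
    rw [Ideal.mem_span_singleton]
    have : (ε : 𝓞 M) * (ε⁻¹ : (𝓞 M)ˣ) = 1 := by simp
    exact ⟨s ^ 3 * ((ε⁻¹ : (𝓞 M)ˣ) : 𝓞 M) ^ 2, by
      rw [show s * (s ^ 3 * ((ε⁻¹ : (𝓞 M)ˣ) : 𝓞 M) ^ 2) = (s ^ 2) ^ 2 * ((ε⁻¹ : (𝓞 M)ˣ) : 𝓞 M) ^ 2 by ring, hs, 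
        mul_pow, mul_assoc, ← mul_pow, this, hW2]; simp⟩
  have hm : θ * (1 - θ) ∈ Ideal.span {s} := by rw [e1]; exact Ideal.mul_mem_right _ _ h2
  have h1 : (1 : 𝓞 M) ∈ Ideal.span {s} := by
    rcases hP.mem_or_mem hm with hh | hh
    · have := hτP _ hh
      rw [e2] at this
      have := add_mem hh this
      simpa using this
    · have := hτP _ hh
      rw [map_sub, map_one, e2] at this
      have := add_mem hh this
      simpa using this
  exact hP.ne_top ((Ideal.eq_top_iff_one _).mpr h1)

theorem unit_of_inv {K : Type*} [Field K] [CharZero K] {x : K} (h0 : x ≠ 0) (hx : IsIntegral ℤ x) (hx' : IsIntegral ℤ x⁻¹) :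
    ∃ ε : (𝓞 K)ˣ, algebraMap (𝓞 K) K ε = x := by
  obtain ⟨a, ha⟩ := exists_ringOfIntegers hx
  obtain ⟨b, hb⟩ := exists_ringOfIntegers hx'
  have hab : a * b = 1 := by
    apply RingOfIntegers.ext
    change algebraMap (𝓞 K) K _ = algebraMap (𝓞 K) K _
    rw [map_mul, ha, hb, map_one, mul_inv_cancel₀ h0]
  exact ⟨⟨a, b, hab, by rw [mul_comm, hab]⟩, ha⟩

variable {L : Type*} [Field L] [NumberField L] {i w t : L} 

theorem Setup.indexRealUnits_eq_one (S : Setup L d i w t) [IsCMField L] : IsCMField.indexRealUnits L = 1 := by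
  refine (IsCMField.indexRealUnits_eq_one_or_two L).resolve_right fun h2 => ?_
  rw [IsCMField.indexRealUnits_eq_two_iff] at h2
  obtain ⟨u, hu⟩ := h2
  obtain ⟨a, ha, hw⟩ := S.torsion_L
  have ho : orderOf (IsCMField.unitsMulComplexConjInv L u) = 8 * a := by
    rw [← Nat.card_zpowers, hu, ← hw]; simp [Units.torsionOrder]
  rw [← Subgroup.orderOf_coe, IsCMField.unitsMulComplexConjInv_apply] at ho
  set c := IsCMField.complexConj L
  let φ : (𝓞 L)ˣ →* L := (algebraMap (𝓞 L) L : 𝓞 L →* L).comp (Units.coeHom _)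
  have hφ : Function.Injective φ := fun x y hxy => Units.ext (RingOfIntegers.ext hxy)
  have hφc : ∀ x, φ (IsCMField.unitsComplexConj L x) = c (φ x) := fun x => rfl
  rw [← orderOf_injective φ hφ] at ho
  have hinv : ∀ x : (𝓞 L)ˣ, φ x⁻¹ = (φ x)⁻¹ := by
    intro x
    apply eq_inv_of_mul_eq_one_left
    rw [← map_mul]; simp
  have h0 : ∀ x : (𝓞 L)ˣ, φ x ≠ 0 := by
    intro x hx
    have : φ (x * x⁻¹) = 0 := by rw [map_mul, hx, zero_mul]
    rw [mul_inv_cancel, map_one] at this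
    exact one_ne_zero this
  have hintegral : ∀ x : (𝓞 L)ˣ, IsIntegral ℤ (φ x) := fun x => RingOfIntegers.isIntegral_coe _
  rw [map_mul, hinv, hφc] at ho
  set v := φ (u ^ a) with hv
  have hv0 : v ≠ 0 := h0 _
  have hcv0 : c v ≠ 0 := by simpa using hv0
  have hvint : IsIntegral ℤ v := hintegral _
  have hvi : IsIntegral ℤ v⁻¹ := by rw [hv, ← hinv]; exact hintegral _
  have hv' : v = φ u ^ a := by rw [hv, map_pow]
  clear_value v
  set ζ := v * (c v)⁻¹ with hζ
  have hord : orderOf ζ = 8 := by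
    have : ζ = (φ u * (c (φ u))⁻¹) ^ a := by
      rw [hζ, hv', mul_pow, map_pow, inv_pow]
    rw [this, orderOf_pow_of_dvd ha.pos.ne' (by rw [ho]; exact ⟨8, by ring⟩), ho, Nat.mul_div_cancel _ ha.pos]
  have hζ4 : ζ ^ 4 = -1 := by
    have hp : IsPrimitiveRoot ζ 8 := by rw [← hord]; exact IsPrimitiveRoot.orderOf ζ
    exact (hp.pow (by norm_num) (show 8 = 4 * 2 by rfl)).eq_neg_one_of_two_right
  have hζ0 : ζ ≠ 0 := by intro h; rw [h] at hζ4; norm_num at hζ4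
  have hcc : ∀ x, c (c x) = x := fun x => IsCMField.complexConj_apply_apply L x
  have hcζ : c ζ = ζ⁻¹ := by rw [hζ, map_mul, map_inv₀, hcc, mul_inv, inv_inv, mul_comm]
  have hcv : c v = v * ζ⁻¹ := by rw [hζ]; field_simp
  set e := ζ + ζ⁻¹ with he
  have he2 : (e - w) * (e + w) = 0 := by
    have : e ^ 2 = 2 := by rw [he]; field_simp; linear_combination hζ4
    linear_combination this - S.hw
  set s := (1 + ζ) * v⁻¹ with hs
  have hζint : IsIntegral ℤ ζ := IsIntegral.of_pow (n := 4) (by norm_num) (by rw [hζ4]; exact isIntegral_one.neg)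
  have hsint : IsIntegral ℤ s := (isIntegral_one.add hζint).mul hvi
  have hsr : s ∈ maximalRealSubfield L := by
    rw [← IsCMField.complexConj_eq_self_iff]
    change c s = s
    rw [hs, map_mul, map_add, map_inv₀, map_one, hcζ, hcv]
    field_simp; ring
  set N := v * c v with hN
  have hNr : N ∈ maximalRealSubfield L := by
    rw [← IsCMField.complexConj_eq_self_iff]
    change c N = N
    rw [hN, map_mul, hcc, mul_comm]
  have hNi : IsIntegral ℤ N⁻¹ := by
    rw [hN, mul_inv, ← map_inv₀ c]
    exact hvi.mul (hvi.map c)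
  have hNi' : IsIntegral ℤ N := hvint.mul (hvint.map c)
  have hN0 : N ≠ 0 := mul_ne_zero hv0 hcv0
  have hs2 : s ^ 2 = e * (1 + e) * N⁻¹ := by
    rw [hs, hN, hcv, he]; clear_value ζ; field_simp; linear_combination -hζ4
  -- sign
  obtain ⟨f, hf, hef⟩ : ∃ f : L, (f = 1 ∨ f = -1) ∧ e = w * f := by
    rcases mul_eq_zero.mp he2 with h | h
    · exact ⟨1, Or.inl rfl, by linear_combination h⟩
    · exact ⟨-1, Or.inr rfl, by linear_combination h⟩
  have hf2 : f ^ 2 = 1 := by rcases hf with rfl | rfl <;> ring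
  have hfr : f ∈ maximalRealSubfield L := by rcases hf with rfl | rfl <;> simp
  have hfi : IsIntegral ℤ f := IsIntegral.of_pow (n := 2) (by norm_num) (by rw [hf2]; exact isIntegral_one)
  have hwi : IsIntegral ℤ w := isIntegral_of_sq_int (m := 2) (by simpa using S.hw)
  set E := f * (1 + w * f) * N⁻¹ with hE
  have hEr : E ∈ maximalRealSubfield L := 
    mul_mem (mul_mem hfr (add_mem (one_mem _) (mul_mem S.w_mem hfr))) (inv_mem hNr)
  have hE1 : E * (f * (w * f - 1) * N) = 1 := by
    rw [hE]; field_simp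
    linear_combination (f ^ 2 * w ^ 2 + w^2 -1) * hf2 + S.hw
  have hE0 : E ≠ 0 := left_ne_zero_of_mul_eq_one hE1
  have hEinv : E⁻¹ = f * (w * f - 1) * N := inv_eq_of_mul_eq_one_right hE1
  have hs3 : s ^ 2 = w * E := by rw [hs2, hef, hE]; ring
  -- transfer to K+
  have hintegral' : ∀ x : maximalRealSubfield L, IsIntegral ℤ (x : L) → IsIntegral ℤ x := by
    intro x hx
    exact (isIntegral_algebraMap_iff (algebraMap (maximalRealSubfield L) L).injective).mp hx
  obtain ⟨W, hW⟩ := exists_ringOfIntegers (hintegral' ⟨w, S.w_mem⟩ hwi)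
  obtain ⟨s', hs'⟩ := exists_ringOfIntegers (hintegral' ⟨s, hsr⟩ hsint)
  obtain ⟨ε, hε⟩ := unit_of_inv (x := (⟨E, hEr⟩ : maximalRealSubfield L)) (by
      intro h; exact hE0 (congrArg Subtype.val h))
    (hintegral' _ ((hfi.mul (isIntegral_one.add (hwi.mul hfi))).mul hNi))
    (hintegral' _ (by
      rw [show (((⟨E, hEr⟩ : maximalRealSubfield L)⁻¹ : maximalRealSubfield L) : L) = E⁻¹ from rfl, hEinv]
      exact (hfi.mul ((hwi.mul hfi).sub isIntegral_one)).mul hNi'))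
  refine S.isBiq.no_sqrt hW ε (s := s') ?_
  apply RingOfIntegers.ext
  change algebraMap (𝓞 _) _ _ = algebraMap (𝓞 _) _ _
  rw [map_pow, map_mul, hW, hs', hε]
  exact Subtype.ext hs3

end SetupH

section GenusI

structure InvSetup (A B : Type*) [CommRing A] [CommRing B] [Algebra A B] (τ : B ≃+* B) (θ : B) : Prop where
  inv : ∀ x, τ (τ x) = x
  com : ∀ a : A, τ (algebraMap A B a) = algebraMap A B a
  inj : Function.Injective (algebraMap A B)
  gen : ∀ x : B, ∃ a b : A, x = algebraMap A B a + algebraMap A B b * θ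
  ne : τ θ ≠ θ

theorem dvd_of_quad {B : Type*} [CommRing B] [IsDomain B] [IsIntegrallyClosed B] {n z T s : B} (hn : n ≠ 0)
    (h : z ^ 2 - n * T * z + n ^ 2 * s = 0) : n ∣ z := by
  let K := FractionRing B
  have hn' : algebraMap B K n ≠ 0 := by simpa using hn
  have hintegral : IsIntegral B (algebraMap B K z / algebraMap B K n) := by
    refine ⟨Polynomial.X ^ 2 - (Polynomial.C T * Polynomial.X + Polynomial.C (-s)), ?_, ?_⟩
    · apply Polynomial.monic_X_pow_sub
      exact lt_of_le_of_lt Polynomial.degree_linear_le (by norm_num)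
    · simp only [Polynomial.eval₂_sub, Polynomial.eval₂_add, Polynomial.eval₂_pow, Polynomial.eval₂_X, Polynomial.eval₂_C,
        Polynomial.eval₂_mul, Polynomial.eval₂_neg, map_neg]
      have h2 := congrArg (algebraMap B K) h
      simp only [map_add, map_sub, map_mul, map_pow, map_zero] at h2
      rw [div_pow, sub_eq_zero, div_eq_iff (pow_ne_zero 2 hn'), add_mul, mul_assoc, pow_two (algebraMap B K n), ← mul_assoc (_ / _), div_mul_cancel₀ _ hn']
      linear_combination h2
  obtain ⟨y, hy⟩ := IsIntegrallyClosed.isIntegral_iff.mp hintegral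
  refine ⟨y, IsFractionRing.injective B K ?_⟩
  rw [map_mul, hy, mul_div_cancel₀ _ hn']

variable {A B : Type*} [CommRing A] [IsDomain A] [IsPrincipalIdealRing A] [CommRing B] [IsDedekindDomain B]
  [Algebra A B] {τ : B ≃+* B} {θ : B}

namespace InvSetup

variable (S : InvSetup A B τ θ)
include S

omit [IsDomain A] [IsPrincipalIdealRing A] in
theorem fix {x : B} (hx : τ x = x) : ∃ a : A, algebraMap A B a = x := by
  obtain ⟨a, b, rfl⟩ := S.gen x
  rw [map_add, map_mul, S.com, S.com] at hx
  have : algebraMap A B b * (τ θ - θ) = 0 := by linear_combination hx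
  rcases mul_eq_zero.mp this with h | h
  · exact ⟨a, by rw [h]; ring⟩
  · exact absurd (sub_eq_zero.mp h) S.ne

omit [IsDomain A] [IsPrincipalIdealRing A] [IsDedekindDomain B] in
theorem mem_map {I : Ideal B} {x : B} : x ∈ I.map τ ↔ τ x ∈ I := by
  rw [Ideal.mem_map_of_equiv]
  constructor
  · rintro ⟨y, hy, rfl⟩; rwa [S.inv]
  · intro h; exact ⟨_, h, S.inv x⟩

omit [IsDomain A] [IsPrincipalIdealRing A] [IsDedekindDomain B] in
theorem map_map (I : Ideal B) : (I.map τ).map τ = I := by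
  ext x
  rw [S.mem_map, S.mem_map, S.inv]

omit [IsDomain A] [IsPrincipalIdealRing A] [IsDedekindDomain B] in
theorem map_span (x : B) : (Ideal.span {x}).map τ = Ideal.span {τ x} := by
  rw [Ideal.map_span]; simp

omit [IsDomain A] [IsPrincipalIdealRing A] [IsDedekindDomain B] in
theorem map_ne_bot {I : Ideal B} (h : I ≠ ⊥) : I.map τ ≠ ⊥ := by
  intro h2
  apply h
  rw [← S.map_map I, h2, Ideal.map_bot]

/-- the relative norm of an ideal -/
theorem norm_ideal (I : Ideal B) : ∃ n : A, I * I.map τ = Ideal.span {algebraMap A B n} := by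
  by_cases hI : I = ⊥
  · exact ⟨0, by rw [hI]; simp⟩
  have hN : ∀ x : B, ∃ a : A, algebraMap A B a = x * τ x := fun x => S.fix (by rw [map_mul, S.inv, mul_comm])
  choose N hN using hN
  obtain ⟨n, hn⟩ := (inferInstance : (Ideal.span (N '' (I : Set B))).IsPrincipal)
  have hmem : ∀ x ∈ I, n ∣ N x := by
    intro x hx
    have : N x ∈ Ideal.span (N '' (I : Set B)) := Ideal.subset_span ⟨x, hx, rfl⟩
    rw [hn] at this
    exact Ideal.mem_span_singleton.mp this
  have hn0 : n ≠ 0 := by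
    rintro rfl
    apply hI
    rw [eq_bot_iff]
    intro x hx
    have h0 : N x = 0 := zero_dvd_iff.mp (hmem x hx)
    have := hN x
    rw [h0, map_zero] at this
    rcases mul_eq_zero.mp this.symm with h | h
    · exact h
    · simpa using h
  have hn0' : algebraMap A B n ≠ 0 := by
    intro h; exact hn0 (S.inj (by rw [h, map_zero]))
  refine ⟨n, le_antisymm ?_ ?_⟩
  · rw [Ideal.mul_le]
    intro a ha b' hb'
    rw [S.mem_map] at hb'
    set b := τ b' with hb
    have hb2 : b' = τ b := by rw [hb, S.inv]
    rw [hb2, Ideal.mem_span_singleton]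
    obtain ⟨x, hx⟩ := hmem a ha
    obtain ⟨y, hy⟩ := hmem b hb'
    obtain ⟨z, hz⟩ := hmem (a + b) (add_mem ha hb')
    have h1 := hN a
    have h2 := hN b
    have h3 := hN (a + b)
    rw [hx, map_mul] at h1
    rw [hy, map_mul] at h2
    rw [hz, map_mul, map_add] at h3
    refine dvd_of_quad hn0' (T := algebraMap A B (z - x - y)) (s := algebraMap A B (x * y)) ?_
    simp only [map_sub, map_mul]
    linear_combination (a * τ b) * (h1 + h2 - h3) + (b * τ b) * h1 + algebraMap A B n * algebraMap A B x * h2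
  · rw [Ideal.span_singleton_le_iff_mem]
    have h1 : n ∈ Ideal.span (N '' (I : Set B)) := by rw [hn]; exact Ideal.mem_span_singleton_self n
    have h2 := Ideal.mem_map_of_mem (algebraMap A B) h1
    rw [Ideal.map_span] at h2
    refine (Ideal.span_le.mpr ?_) h2
    rintro _ ⟨_, ⟨x, hx, rfl⟩, rfl⟩
    rw [hN]
    exact Ideal.mul_mem_mul hx (Ideal.mem_map_of_mem τ hx)

/-- Hilbert 90 step -/
theorem hilbert (δ : B) (hδ : τ δ = -δ) (hδ0 : δ ≠ 0) {I : Ideal B} {γ : B} {n : A} (hn : n ≠ 0) (h1 : I * I = Ideal.span {γ})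
    (h2 : I * I.map τ = Ideal.span {algebraMap A B n}) (h3 : γ * τ γ = algebraMap A B n ^ 2) :
    ∃ β : B, β ≠ 0 ∧ (I * Ideal.span {β}).map τ = I * Ideal.span {β} := by
  set N := algebraMap A B n with hN
  have hn0 : N ≠ 0 := by
    intro h; exact hn (S.inj (by rw [← hN, h, map_zero]))
  have h4 : Ideal.span {γ} * I.map τ = Ideal.span {N} * I := by
    rw [← h1, mul_assoc, h2, mul_comm]
  obtain ⟨β, hβ0, hβ⟩ : ∃ β : B, β ≠ 0 ∧ γ * τ β = N * β := by
    by_cases hc : N + γ = 0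
    · refine ⟨δ, hδ0, ?_⟩
      rw [hδ]; linear_combination (-δ) * hc
    · refine ⟨N + γ, hc, ?_⟩
      rw [map_add, S.com]; linear_combination h3
  refine ⟨τ β, by simpa using hβ0, ?_⟩
  rw [Ideal.map_mul, S.map_span, S.inv]
  have hne : Ideal.span {N} ≠ ⊥ := by simpa using hn0
  apply mul_left_cancel₀ hne
  rw [mul_comm (I.map τ), ← mul_assoc, Ideal.span_singleton_mul_span_singleton, ← hβ, ← Ideal.span_singleton_mul_span_singleton,
    mul_comm _ (I.map τ), ← mul_assoc, mul_comm (I.map τ), h4, mul_assoc]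

theorem prime_dichotomy {P : Ideal B} (hP : P.IsPrime) (hτ : P.map τ = P) (hδ : θ - τ θ ∉ P) :
    ∃ p : A, P = Ideal.span {algebraMap A B p} := by
  obtain ⟨p, hp⟩ := (inferInstance : (P.comap (algebraMap A B)).IsPrincipal)
  refine ⟨p, le_antisymm ?_ ?_⟩
  · intro x hx
    have hx' : τ x ∈ P := by
      rw [← S.mem_map, hτ]; exact hx
    obtain ⟨a, b, rfl⟩ := S.gen x
    have h1 : algebraMap A B b * (θ - τ θ) ∈ P := by
      have := sub_mem hx hx'
      rw [map_add, map_mul, S.com, S.com] at this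
      convert this using 1; ring
    have hb := (hP.mem_or_mem h1).resolve_right hδ
    have ha : algebraMap A B a ∈ P := by
      have := sub_mem hx (Ideal.mul_mem_right θ _ hb)
      simpa using this
    have key : ∀ y : A, algebraMap A B y ∈ P → algebraMap A B y ∈ Ideal.span {algebraMap A B p} := by
      intro y hy
      have : y ∈ P.comap (algebraMap A B) := hy
      rw [hp] at this
      obtain ⟨z, rfl⟩ := Ideal.mem_span_singleton.mp this
      rw [map_mul]; exact Ideal.mul_mem_right _ _ (Ideal.mem_span_singleton_self _)
    exact add_mem (key _ ha) (Ideal.mul_mem_right _ _ (key _ hb))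
  · rw [Ideal.span_singleton_le_iff_mem]
    have : p ∈ P.comap (algebraMap A B) := by rw [hp]; exact Ideal.mem_span_singleton_self p
    exact this

/-- structure of the invariant ideals -/
theorem invariant (J : Ideal B) (hJ : J ≠ ⊥) (hτ : J.map τ = J) : ∃ a : A, ∃ s : Multiset (Ideal B),
    a ≠ 0 ∧ (∀ P ∈ s, P.IsPrime ∧ P ≠ ⊥ ∧ θ - τ θ ∈ P) ∧ J = Ideal.span {algebraMap A B a} * s.prod := by
  induction J using (wellFounded_gt (α := Ideal B)).induction with
  | _ J ih =>
  by_cases hJ1 : J = ⊤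
  · exact ⟨1, 0, one_ne_zero, by simp, by simp [hJ1]⟩
  obtain ⟨P, hPm, hJP⟩ := Ideal.exists_le_maximal J hJ1
  have hP := hPm.isPrime
  have hP0 : P ≠ ⊥ := by rintro rfl; exact hJ (le_bot_iff.mp hJP)
  have step : ∀ Q J' : Ideal B, Q ≠ ⊤ → Q.map τ = Q → J = Q * J' → J' ≠ ⊥ ∧ J < J' ∧ J'.map τ = J' := by
    intro Q J' hQ1 hQ h
    have hQ0 : Q ≠ ⊥ := by rintro rfl; apply hJ; simp [h]
    have hJ0 : J' ≠ ⊥ := by rintro rfl; apply hJ; simp [h]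
    refine ⟨hJ0, lt_of_le_of_ne (by rw [h]; exact (Ideal.mul_le_right : Q * J' ≤ J')) ?_, ?_⟩
    · intro he
      apply hQ1
      rw [he] at h
      have : (1 : Ideal B) * J' = Q * J' := by rw [one_mul]; exact h
      have := mul_right_cancel₀ hJ0 this
      rw [← this, Ideal.one_eq_top]
    · apply mul_left_cancel₀ hQ0
      rw [← h]
      conv_lhs => rw [← hQ]
      rw [← Ideal.map_mul, ← h, hτ]
  by_cases hPτ : P.map τ = P
  · obtain ⟨J', hJ'⟩ := Ideal.dvd_iff_le.mpr hJP
    obtain ⟨h0, hlt, hi⟩ := step P J' hP.ne_top hPτ hJ'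
    obtain ⟨a, s, ha, hs, h⟩ := ih J' hlt h0 hi
    by_cases hδ : θ - τ θ ∈ P
    · refine ⟨a, P ::ₘ s, ha, ?_, ?_⟩
      · intro Q hQ
        rcases Multiset.mem_cons.mp hQ with rfl | hQ
        · exact ⟨hP, hP0, hδ⟩
        · exact hs Q hQ
      · rw [Multiset.prod_cons, hJ', h]; ring
    · obtain ⟨p, hp⟩ := S.prime_dichotomy hP hPτ hδ
      refine ⟨p * a, s, mul_ne_zero ?_ ha, hs, ?_⟩
      · rintro rfl; apply hP0; rw [hp]; simp
      · rw [hJ', h, map_mul, ← Ideal.span_singleton_mul_span_singleton, ← hp]; ring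
  · have hP' : (P.map τ).IsMaximal := by
      have := Ideal.map_isPrime_of_equiv τ (I := P)
      exact this.isMaximal (S.map_ne_bot hP0)
    have hJP' : J ≤ P.map τ := by rw [← hτ]; exact Ideal.map_mono hJP
    have hcop : IsCoprime P (P.map τ) := by
      rw [Ideal.isCoprime_iff_sup_eq]
      exact hPm.coprime_of_ne hP' (Ne.symm hPτ)
    obtain ⟨J', hJ'⟩ := hcop.mul_dvd (Ideal.dvd_iff_le.mpr hJP) (Ideal.dvd_iff_le.mpr hJP')
    obtain ⟨n, hn⟩ := S.norm_ideal P
    have hQ1 : P * P.map τ ≠ ⊤ := by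
      intro h
      exact hP.ne_top (top_le_iff.mp (h ▸ (Ideal.mul_le_left : P * P.map τ ≤ P)))
    obtain ⟨h0, hlt, hi⟩ := step _ J' hQ1 (by rw [Ideal.map_mul, S.map_map, mul_comm]) hJ'
    obtain ⟨a, s, ha, hs, h⟩ := ih J' hlt h0 hi
    refine ⟨n * a, s, mul_ne_zero ?_ ha, hs, ?_⟩
    · rintro rfl; apply hJ; rw [hJ', hn]; simp
    · rw [hJ', h, map_mul, ← Ideal.span_singleton_mul_span_singleton, ← hn]; ring

end InvSetup
end GenusI

section ArithJ

theorem nat_sq_of {a b c : ℕ} (h : Nat.Coprime a b) (h2 : a * b = c ^ 2) : ∃ d, a = d ^ 2 :=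
  exists_eq_pow_of_mul_eq_pow (Nat.isUnit_iff.mpr h) h2

theorem pell_par : ∀ n x y : Fin 8, (n.1 % 4 = 1 ∨ n.1 % 4 = 2) → x.1 ^ 2 % 8 = (n.1 * (y.1 ^ 2 % 8) % 8 + 1) % 8 →
    x.1 % 2 = 1 ∧ y.1 % 2 = 0 := by decide

theorem pell_split (N : ℕ) (hN : ¬ IsSquare N) (h4 : N % 4 = 1 ∨ N % 4 = 2) :
    ∃ a b x y : ℕ, a * b = N ∧ b * y ^ 2 = a * x ^ 2 + 1 ∧ b ≠ 1 := by
  have hN0 : 0 < N := by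
    rcases Nat.eq_zero_or_pos N with rfl | h
    · simp at hN
    · exact h
  have hex : ∃ Y : ℕ, 0 < Y ∧ ∃ X : ℕ, X ^ 2 = N * Y ^ 2 + 1 := by
    have hN' : ¬ IsSquare (N : ℤ) := by
      rwa [Int.isSquare_natCast_iff]
    obtain ⟨X, Y, h, hY⟩ := Pell.exists_of_not_isSquare (by exact_mod_cast hN0) hN'
    refine ⟨Y.natAbs, Int.natAbs_pos.mpr hY, X.natAbs, ?_⟩
    zify
    rw [sq_abs, sq_abs]; linarith
  classical
  obtain ⟨hY, X, hX⟩ := Nat.find_spec hex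
  have hmin := fun m => Nat.find_min hex (m := m)
  set Y := Nat.find hex
  have hpar : X % 2 = 1 ∧ Y % 2 = 0 := by
    have hX2 : (X % 8) ^ 2 % 8 = ((N % 8) * ((Y % 8) ^ 2 % 8) % 8 + 1) % 8 := by
      rw [← Nat.pow_mod, hX, ← Nat.pow_mod, ← Nat.mul_mod, Nat.mod_add_mod]
    have := pell_par ⟨N % 8, Nat.mod_lt _ (by norm_num)⟩ ⟨X % 8, Nat.mod_lt _ (by norm_num)⟩ ⟨Y % 8, Nat.mod_lt _ (by norm_num)⟩
      (by dsimp only; omega) hX2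
    dsimp only at this
    omega
  obtain ⟨m, hm⟩ : ∃ m, X = 2 * m + 1 := ⟨X / 2, by omega⟩
  obtain ⟨Z, hZ⟩ : ∃ Z, Y = 2 * Z := ⟨Y / 2, by omega⟩
  have hmn : m * (m + 1) = N * Z ^ 2 := by
    rw [hm, hZ] at hX; nlinarith
  have hcop : Nat.Coprime m (m + 1) := by simp
  have hZ0 : 0 < Z := by omega
  have hm0 : 0 < m := by
    rcases Nat.eq_zero_or_pos m with rfl | h
    · have : 0 < N * Z ^ 2 := by positivity
      omega
    · exact h
  have hab : Nat.gcd N m * Nat.gcd N (m + 1) = N := by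
    rw [← hcop.gcd_mul, hmn]; exact Nat.gcd_eq_left (Dvd.intro _ rfl)
  obtain ⟨m', hm'⟩ := Nat.gcd_dvd_right N m
  obtain ⟨n', hn'⟩ := Nat.gcd_dvd_right N (m + 1)
  set a := Nat.gcd N m
  set b := Nat.gcd N (m + 1)
  have hprod : m' * n' = Z ^ 2 := by
    apply Nat.eq_of_mul_eq_mul_left hN0
    rw [← hmn, ← hab]
    conv_rhs => rw [hn', hm']
    ring
  have hcop' : Nat.Coprime m' n' :=
    Nat.Coprime.coprime_dvd_left ⟨a, by rw [mul_comm]; exact hm'⟩ (Nat.Coprime.coprime_dvd_right ⟨b, by rw [mul_comm]; exact hn'⟩ hcop)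
  obtain ⟨x, hx⟩ := nat_sq_of hcop' hprod
  obtain ⟨y, hy⟩ := nat_sq_of hcop'.symm (by rw [mul_comm]; exact hprod)
  refine ⟨a, b, x, y, hab, ?_, ?_⟩
  · rw [← hx, ← hy, ← hm', ← hn']
  · intro hb
    have hxpos : 0 < x := by
      rcases Nat.eq_zero_or_pos x with rfl | h
      · rw [hx] at hm'; simp at hm'; omega
      · exact h
    have hypos : 0 < y := by
      rcases Nat.eq_zero_or_pos y with rfl | h
      · rw [hy] at hn'; simp at hn'
      · exact h
    have hxy : (x * y) ^ 2 = Z ^ 2 := by rw [← hprod, hx, hy]; ring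
    have hxy' := Nat.pow_left_injective (n := 2) (by norm_num) hxy
    apply hmin x
    · rw [hZ, ← hxy']; nlinarith
    · refine ⟨hxpos, y, ?_⟩
      rw [hb, mul_one] at hab
      rw [hab, hx] at hm'
      rw [hb, one_mul, hy] at hn'
      rw [← hn', ← hm']

theorem pell_neg_one {p : ℕ} (hp : p.Prime) (h8 : p % 8 = 1) : ∃ x y : ℤ, x ^ 2 - p * y ^ 2 = -1 := by
  obtain ⟨a, b, x, y, hab, h, hb⟩ := pell_split p hp.prime.not_isSquare (by omega)
  have : b = p := ((Nat.dvd_prime hp).mp ⟨a, by rw [mul_comm b]; exact hab.symm⟩).resolve_left hb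
  subst this
  have ha : a = 1 := by
    have := hp.pos
    nlinarith
  subst ha
  refine ⟨x, y, ?_⟩
  zify at h
  linarith

theorem leg_two {p : ℕ} [Fact p.Prime] (h8 : p % 8 = 3) : legendreSym p 2 = -1 := by
  rw [legendreSym.at_two (by rintro rfl; norm_num at h8), ZMod.χ₈_nat_eq_if_mod_eight]
  have : p % 2 = 1 := by omega
  simp [h8, this]

theorem leg_neg_one {p : ℕ} [Fact p.Prime] (h8 : p % 8 = 3) : legendreSym p (-1) = -1 := by
  rw [legendreSym.at_neg_one (by rintro rfl; norm_num at h8), ZMod.χ₄_nat_three_mod_four (by omega)]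

theorem leg_cases {p : ℕ} [Fact p.Prime] {q : ℕ} (hq : q.Prime) (hpq : p ≠ q) : legendreSym p q = 1 ∨ legendreSym p q = -1 := by
  apply legendreSym.eq_one_or_neg_one
  have : ((q : ℤ) : ZMod p) = (q : ZMod p) := by push_cast; rfl
  rw [this, Ne, ZMod.natCast_eq_zero_iff, Nat.prime_dvd_prime_iff_eq Fact.out hq]
  exact hpq

theorem leg_contra {p : ℕ} [Fact p.Prime] {u y z : ℤ} (hu : legendreSym p u = -1) (h : u * y ^ 2 = 1 + p * z) : False := by
  have := (legendreSym.prime_dvd_of_eq_neg_one hu (x := 1) (y := y) ⟨-z, by rw [h]; ring⟩).1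
  have h1 := Int.le_of_dvd one_pos this
  have := (Fact.out : p.Prime).two_le
  omega

theorem leg_rec {p q : ℕ} [Fact p.Prime] [Fact q.Prime] (h8 : p % 8 = 3) (h8' : q % 8 = 3) : legendreSym q p = - legendreSym p q :=
  legendreSym.quadratic_reciprocity_three_mod_four (by omega) (by omega)

theorem divs_pq {p q b : ℕ} (hp : p.Prime) (hq : q.Prime) (h : b ∣ p * q) : b = 1 ∨ b = p ∨ b = q ∨ b = p * q := by
  obtain ⟨c, d, hc, hd, rfl⟩ := exists_dvd_and_dvd_of_dvd_mul h
  rcases (Nat.dvd_prime hp).mp hc with rfl | rfl <;> rcases (Nat.dvd_prime hq).mp hd with rfl | rfl <;> simp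

theorem not_square_pq {p q : ℕ} (hp : p.Prime) (hq : q.Prime) (hpq : p ≠ q) (e : ℕ) (he : ¬ p ∣ e) : ¬ IsSquare (e * (p * q)) := by
  rintro ⟨r, hr⟩
  have h1 : p ∣ r := by
    have : p ∣ r * r := ⟨e * q, by rw [← hr]; ring⟩
    rcases hp.dvd_mul.mp this with h | h <;> exact h
  obtain ⟨s, rfl⟩ := h1
  have : e * q = p * (s * s) := by
    apply Nat.eq_of_mul_eq_mul_left hp.pos
    linarith
  rcases hp.dvd_mul.mp ⟨_, this⟩ with h | h
  · exact he h
  · exact hpq ((Nat.prime_dvd_prime_iff_eq hp hq).mp h)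

theorem pell_pq {p q : ℕ} (hp : p.Prime) (hq : q.Prime) (h8 : p % 8 = 3) (h8' : q % 8 = 3) (hpq : p ≠ q) :
    ∃ x y : ℤ, p * x ^ 2 - q * y ^ 2 = 1 ∨ p * x ^ 2 - q * y ^ 2 = -1 := by
  haveI := Fact.mk hp
  haveI := Fact.mk hq
  have hmod : (p * q) % 4 = 1 := by
    rw [Nat.mul_mod, show p % 4 = 3 by omega, show q % 4 = 3 by omega]
  obtain ⟨a, b, x, y, hab, h, hb⟩ := pell_split (p * q) (by simpa using not_square_pq hp hq hpq 1 hp.not_dvd_one) (Or.inl hmod)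
  skip
  rcases divs_pq hp hq ⟨a, by rw [mul_comm b]; exact hab.symm⟩ with hbe | hbe | hbe | hbe
  · exact absurd (by simp [*]) hb
  · rw [hbe] at h hab
    have : a = q := Nat.eq_of_mul_eq_mul_left hp.pos (by rw [mul_comm, hab])
    rw [this] at h
    zify at h
    exact ⟨y, x, Or.inl (by linarith)⟩
  · rw [hbe] at h hab
    have : a = p := Nat.eq_of_mul_eq_mul_right hq.pos hab
    rw [this] at h
    zify at h
    exact ⟨x, y, Or.inr (by linarith)⟩
  · rw [hbe] at h hab
    have : a = 1 := by
      have : a * (p * q) = 1 * (p * q) := by rw [hab, one_mul]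
      exact Nat.eq_of_mul_eq_mul_right (Nat.mul_pos hp.pos hq.pos) this
    rw [this] at h
    exfalso
    zify at h
    exact leg_contra (leg_neg_one h8) (y := x) (z := -q * y ^ 2) (by linarith)

theorem pell_2pq {p q : ℕ} (hp : p.Prime) (hq : q.Prime) (h8 : p % 8 = 3) (h8' : q % 8 = 3) (hpq : p ≠ q) :
    ∃ x y : ℤ, 2 * x ^ 2 - p * q * y ^ 2 = -1 := by
  haveI := Fact.mk hp
  haveI := Fact.mk hq
  have hmod : (2 * (p * q)) % 4 = 2 := by
    rw [Nat.mul_mod, Nat.mul_mod p, show p % 4 = 3 by omega, show q % 4 = 3 by omega]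
  have hp2 : ¬ p ∣ 2 := by
    intro h; have := Nat.le_of_dvd two_pos h; omega
  obtain ⟨a, b, x, y, hab, h, hb⟩ := pell_split (2 * (p * q)) (not_square_pq hp hq hpq 2 hp2) (Or.inr hmod)
  have h2p := leg_two h8
  have h2q := leg_two h8'
  have hnp := leg_neg_one h8
  have hnq := leg_neg_one h8'
  have hrec := leg_rec h8 h8'
  have hcs := leg_cases hq hpq
  skip
  have hpos : 0 < p * q := Nat.mul_pos hp.pos hq.pos
  have hpp := hp.pos
  have hqp := hq.pos
  obtain ⟨b1, b2, hb1, hb2, rfl⟩ := exists_dvd_and_dvd_of_dvd_mul (⟨a, by rw [mul_comm b]; exact hab.symm⟩ : b ∣ 2 * (p * q))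
  rcases (Nat.dvd_prime Nat.prime_two).mp hb1 with hb1e | hb1e <;> rcases divs_pq hp hq hb2 with hbe | hbe | hbe | hbe
  · exact absurd (by simp [*]) hb
  · rw [hb1e, hbe] at h hab
    have : a = 2 * q := Nat.eq_of_mul_eq_mul_right hpp (by linarith)
    rw [this] at h
    zify at h
    exfalso
    rcases hcs with hc | hc
    · exact leg_contra (u := p) (y := y) (z := 2 * x ^ 2) (by rw [hrec, hc]) (by linarith)
    · exact leg_contra (p := p) (u := -1 * (2 * q)) (y := x) (z := - y ^ 2) (by rw [legendreSym.mul, legendreSym.mul, hnp, h2p, hc]; rfl) (by linarith)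
  · rw [hb1e, hbe] at h hab
    have : a = 2 * p := Nat.eq_of_mul_eq_mul_right hqp (by linarith)
    rw [this] at h
    zify at h
    exfalso
    rcases hcs with hc | hc
    · exact leg_contra (p := q) (u := -1 * (2 * p)) (y := x) (z := - y ^ 2) (by rw [legendreSym.mul, legendreSym.mul, hnq, h2q, hrec, hc]; rfl) (by linarith)
    · exact leg_contra (u := q) (y := y) (z := 2 * x ^ 2) hc (by linarith)
  · rw [hb1e, hbe] at h hab
    have : a = 2 := Nat.eq_of_mul_eq_mul_right hpos (by linarith)
    rw [this] at h
    zify at h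
    exact ⟨x, y, by linarith⟩
  · rw [hb1e, hbe] at h hab
    have : a = p * q := Nat.eq_of_mul_eq_mul_left two_pos (by linarith)
    rw [this] at h
    zify at h
    exact (leg_contra (y := y) (z := q * x ^ 2) h2p (by linarith)).elim
  · rw [hb1e, hbe] at h hab
    have : a = q := Nat.eq_of_mul_eq_mul_right (Nat.mul_pos two_pos hpp) (by linarith)
    rw [this] at h
    zify at h
    exfalso
    rcases hcs with hc | hc
    · exact leg_contra (p := p) (u := -1 * q) (y := x) (z := - 2 * y ^ 2) (by rw [legendreSym.mul, hnp, hc]; rfl) (by linarith)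
    · exact leg_contra (p := q) (u := 2 * p) (y := y) (z := x ^ 2) (by rw [legendreSym.mul, h2q, hrec, hc]; rfl) (by linarith)
  · rw [hb1e, hbe] at h hab
    have : a = p := Nat.eq_of_mul_eq_mul_right (Nat.mul_pos two_pos hqp) (by linarith)
    rw [this] at h
    zify at h
    exfalso
    rcases hcs with hc | hc
    · exact leg_contra (p := p) (u := 2 * q) (y := y) (z := x ^ 2) (by rw [legendreSym.mul, h2p, hc]; rfl) (by linarith)
    · exact leg_contra (p := q) (u := -1 * p) (y := x) (z := - 2 * y ^ 2) (by rw [legendreSym.mul, hnq, hrec, hc]; rfl) (by linarith)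
  · rw [hb1e, hbe] at h hab
    have : a = 1 := Nat.eq_of_mul_eq_mul_right (Nat.mul_pos two_pos hpos) (by linarith)
    rw [this] at h
    zify at h
    exact (leg_contra (y := x) (z := -2 * q * y ^ 2) hnp (by linarith)).elim

end ArithJ

section ArithJ2

theorem descent (l : ℕ) (hl : 2 ≤ l) (P : ℤ → ℤ → ℤ → Prop)
    (h : ∀ c x y, P c x y → ∃ c' x' y', c = l * c' ∧ P c' x' y') : ∀ c x y, P c x y → c = 0 := by
  have key : ∀ n : ℕ, ∀ c x y, c.natAbs = n → P c x y → c = 0 := by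
    intro n
    induction n using Nat.strong_induction_on with
    | _ n ih =>
      intro c x y hc hP
      obtain ⟨c', x', y', h1, h2⟩ := h c x y hP
      by_contra h0
      have hc' : c' ≠ 0 := by rintro rfl; apply h0; rw [h1, mul_zero]
      apply hc'
      refine ih c'.natAbs ?_ c' x' y' rfl h2
      rw [← hc, h1, Int.natAbs_mul, Int.natAbs_natCast]
      have := Int.natAbs_pos.mpr hc'
      nlinarith
  exact fun c x y => key _ c x y rfl

theorem prime_int_cases {p q : ℕ} (hp : p.Prime) (hq : q.Prime) (hpq : p ≠ q) {y : ℤ} (h : (p : ℤ) ∣ q * y ^ 2) : (p : ℤ) ∣ y := by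
  rcases (Nat.prime_iff_prime_int.mp hp).dvd_or_dvd h with h | h
  · exact absurd ((Nat.prime_dvd_prime_iff_eq hp hq).mp (by exact_mod_cast h)) hpq
  · exact (Nat.prime_iff_prime_int.mp hp).dvd_of_dvd_pow h

theorem form_two {p q : ℕ} (hp : p.Prime) (hq : q.Prime) (h8 : p % 8 = 3) (hpq : p ≠ q) (c x y : ℤ) (h : 2 * c ^ 2 = x ^ 2 + p * q * y ^ 2) : c = 0 := by
  haveI := Fact.mk hp
  refine descent p hp.two_le (fun c x y => 2 * c ^ 2 = x ^ 2 + p * q * y ^ 2) ?_ c x y h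
  clear h c x y
  intro c x y h
  obtain ⟨⟨x', rfl⟩, ⟨c', rfl⟩⟩ := legendreSym.prime_dvd_of_eq_neg_one (leg_two h8) (x := x) (y := c) ⟨-q * y ^ 2, by linarith⟩
  have hp0 : (p : ℤ) ≠ 0 := by exact_mod_cast hp.ne_zero
  have h1 : (q : ℤ) * y ^ 2 = p * (2 * c' ^ 2 - x' ^ 2) := by
    apply mul_left_cancel₀ hp0; linarith
  obtain ⟨y', rfl⟩ := prime_int_cases hp hq hpq ⟨_, h1⟩
  refine ⟨c', x', y', rfl, ?_⟩
  apply mul_left_cancel₀ (pow_ne_zero 2 hp0)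
  linarith

theorem form_aux {p q e : ℕ} (hp : p.Prime) (hq : q.Prime) (h8 : p % 8 = 3) (hpq : p ≠ q) (he : e = 1 ∨ e = 2)
    [Fact p.Prime] (hl : legendreSym p (e * q) = -1)
    (c x y : ℤ) (h : e * c ^ 2 = p * x ^ 2 + q * y ^ 2) : c = 0 := by
  refine descent p hp.two_le (fun c x y => e * c ^ 2 = p * x ^ 2 + q * y ^ 2) ?_ c x y h
  clear h c x y
  intro c x y h
  obtain ⟨h1, ⟨y', rfl⟩⟩ := legendreSym.prime_dvd_of_eq_neg_one hl (x := e * c) (y := y) ⟨e * x ^ 2, by linear_combination (e : ℤ) * h⟩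
  have hp0 : (p : ℤ) ≠ 0 := by exact_mod_cast hp.ne_zero
  have hpe : ¬ (p : ℤ) ∣ e := by
    intro h2
    have h3 : p ∣ e := by exact_mod_cast h2
    have := Nat.le_of_dvd (by omega) h3
    omega
  obtain ⟨c', rfl⟩ := ((Nat.prime_iff_prime_int.mp hp).dvd_or_dvd h1).resolve_left hpe
  have h2 : x ^ 2 = p * (e * c' ^ 2 - q * y' ^ 2) := by
    apply mul_left_cancel₀ hp0; linarith
  obtain ⟨x', rfl⟩ := (Nat.prime_iff_prime_int.mp hp).dvd_of_dvd_pow ⟨_, h2⟩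
  refine ⟨c', x', y', rfl, ?_⟩
  apply mul_left_cancel₀ (pow_ne_zero 2 hp0)
  linarith

/-- `p c² = x² + pq y²` and `2 p c² = x² + pq y²` only have the trivial solutions -/
theorem form_p {p q e : ℕ} (hp : p.Prime) (hq : q.Prime) (h8 : p % 8 = 3) (h8' : q % 8 = 3) (hpq : p ≠ q) (he : e = 1 ∨ e = 2)
    (c x y : ℤ) (h : e * p * c ^ 2 = x ^ 2 + p * q * y ^ 2) : c = 0 := by
  haveI := Fact.mk hp
  haveI := Fact.mk hq
  have hp0 : (p : ℤ) ≠ 0 := by exact_mod_cast hp.ne_zero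
  obtain ⟨x', rfl⟩ := (Nat.prime_iff_prime_int.mp hp).dvd_of_dvd_pow (⟨e * c ^ 2 - q * y ^ 2, by linarith⟩ : (p : ℤ) ∣ x ^ 2)
  have h1 : e * c ^ 2 = p * x' ^ 2 + q * y ^ 2 := by
    apply mul_left_cancel₀ hp0; linarith
  have hrec := leg_rec h8 h8'
  have h2p := leg_two h8
  have h2q := leg_two h8'
  have e1 : legendreSym p e = legendreSym q e := by
    rcases he with rfl | rfl
    · simp
    · rw [Nat.cast_ofNat, h2p, h2q]
  have e2 : legendreSym q e = 1 ∨ legendreSym q e = -1 := by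
    rcases he with rfl | rfl
    · simp
    · right; exact h2q
  rcases leg_cases hq hpq with hc | hc <;> rcases e2 with he2 | he2
  · exact form_aux hq hp h8' hpq.symm he (by rw [legendreSym.mul, he2, hrec, hc]; rfl) c y x' (by linarith)
  · exact form_aux hp hq h8 hpq he (by rw [legendreSym.mul, e1, he2, hc]; rfl) c x' y h1
  · exact form_aux hp hq h8 hpq he (by rw [legendreSym.mul, e1, he2, hc]; rfl) c x' y h1
  · exact form_aux hq hp h8' hpq.symm he (by rw [legendreSym.mul, he2, hrec, hc]; rfl) c y x' (by linarith)

theorem form_par : ∀ p a c x y : Fin 8, p.1 = 1 → a.1 % 4 = 3 → ∀ e : Fin 3, 1 ≤ e.1 →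
    (e.1 * a.1 * c.1 ^ 2) % 8 = (x.1 ^ 2 + p.1 * y.1 ^ 2) % 8 → c.1 % 2 = 0 ∧ x.1 % 2 = 0 ∧ y.1 % 2 = 0 := by decide

theorem form_a {p a e : ℕ} (h8 : p % 8 = 1) (ha : a % 4 = 3) (he : e = 1 ∨ e = 2)
    (c x y : ℤ) (h : e * a * c ^ 2 = x ^ 2 + p * y ^ 2) : c = 0 := by
  refine descent 2 le_rfl (fun c x y => e * a * c ^ 2 = x ^ 2 + p * y ^ 2) ?_ c x y h
  clear h c x y
  intro c x y h
  have h' : e * a * c.natAbs ^ 2 = x.natAbs ^ 2 + p * y.natAbs ^ 2 := by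
    zify; simpa using h
  have hp := form_par ⟨p % 8, Nat.mod_lt _ (by norm_num)⟩ ⟨a % 8, Nat.mod_lt _ (by norm_num)⟩ ⟨c.natAbs % 8, Nat.mod_lt _ (by norm_num)⟩
    ⟨x.natAbs % 8, Nat.mod_lt _ (by norm_num)⟩ ⟨y.natAbs % 8, Nat.mod_lt _ (by norm_num)⟩ (by simpa using h8) (by dsimp only; omega)
    ⟨e, by omega⟩ (by dsimp only; omega) ?_
  · dsimp only at hp
    obtain ⟨⟨c', rfl⟩, ⟨x', rfl⟩, ⟨y', rfl⟩⟩ : (2 ∣ c) ∧ (2 ∣ x) ∧ (2 ∣ y) := by omega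
    refine ⟨c', x', y', rfl, ?_⟩
    push_cast at h; linarith
  · dsimp only
    have := congrArg (· % 8) h'
    have h1 : e * (a % 8) * (c.natAbs % 8) ^ 2 ≡ e * a * c.natAbs ^ 2 [MOD 8] :=
      Nat.ModEq.mul (Nat.ModEq.mul_left _ (Nat.mod_modEq _ _)) ((Nat.mod_modEq _ _).pow 2)
    have h2 : (x.natAbs % 8) ^ 2 + (p % 8) * (y.natAbs % 8) ^ 2 ≡ x.natAbs ^ 2 + p * y.natAbs ^ 2 [MOD 8] :=
      Nat.ModEq.add ((Nat.mod_modEq _ _).pow 2) (Nat.ModEq.mul (Nat.mod_modEq _ _) ((Nat.mod_modEq _ _).pow 2))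
    exact h1.trans ((Nat.ModEq.trans this h2.symm))

end ArithJ2

section ArithJ3

theorem thue {p : ℕ} (hp : p.Prime) (s : ZMod p) : ∃ x a : ℤ, (x ≠ 0 ∨ a ≠ 0) ∧ x ^ 2 < p ∧ a ^ 2 < p ∧ (x : ZMod p) = s * a := by
  haveI := Fact.mk hp
  set k := Nat.sqrt p with hk
  have hk1 : p < (k + 1) * (k + 1) := Nat.lt_succ_sqrt p
  have hk2 : k * k < p := by
    refine lt_of_le_of_ne (Nat.sqrt_le p) ?_
    intro h
    exact hp.prime.not_isSquare ⟨k, h.symm⟩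
  obtain ⟨⟨u1, v1⟩, ⟨u2, v2⟩, hne, heq⟩ := Fintype.exists_ne_map_eq_of_card_lt
    (fun z : Fin (k + 1) × Fin (k + 1) => ((z.1 : ℕ) : ZMod p) - s * ((z.2 : ℕ) : ZMod p)) (by simpa [ZMod.card] using hk1)
  have hb : ∀ u v : Fin (k + 1), (((u : ℕ) : ℤ) - (v : ℕ)) ^ 2 < p := by
    intro u v
    have h1 : (u : ℕ) ≤ k := by omega
    have h2 : (v : ℕ) ≤ k := by omega
    have h3 : (((u : ℕ) : ℤ) - (v : ℕ)) ^ 2 ≤ (k : ℤ) ^ 2 := by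
      have h5 : ((u : ℕ) : ℤ) - (v : ℕ) ≤ k := by omega
      have h6 : -(k : ℤ) ≤ ((u : ℕ) : ℤ) - (v : ℕ) := by omega
      nlinarith
    have h4 : (k : ℤ) ^ 2 < p := by rw [pow_two]; exact_mod_cast hk2
    linarith
  refine ⟨((u1 : ℕ) : ℤ) - (u2 : ℕ), ((v1 : ℕ) : ℤ) - (v2 : ℕ), ?_, hb _ _, hb _ _, ?_⟩
  · by_contra hcon
    push Not at hcon
    apply hne
    ext
    · dsimp only; omega
    · dsimp only; omega
  · push_cast
    dsimp only at heq
    linear_combination heq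

theorem rep_par : ∀ x a : Fin 16, (9 + x.1 ^ 2) % 16 = (2 * a.1 ^ 2) % 16 → a.1 % 2 = 1 ∧ (x.1 % 8 = 3 ∨ x.1 % 8 = 5) := by decide

theorem exists_rep {p : ℕ} (hp : p.Prime) (h16 : p % 16 = 9) (hx : ∃ z : ZMod p, z ^ 4 = 2) :
    ∃ a x : ℕ, p + x ^ 2 = 2 * a ^ 2 ∧ a % 4 = 3 ∧ x % 2 = 1 ∧ Nat.Coprime a (2 * x) := by
  haveI := Fact.mk hp
  obtain ⟨z, hz⟩ := hx
  obtain ⟨x, a, hne, hx, ha, hxa⟩ := thue hp (z ^ 2)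
  have h0 : ((x ^ 2 - 2 * a ^ 2 : ℤ) : ZMod p) = 0 := by
    push_cast; rw [hxa]; linear_combination (a : ZMod p) ^ 2 * hz
  obtain ⟨m, hm⟩ := (ZMod.intCast_zmod_eq_zero_iff_dvd _ _).mp h0
  have hp0 : (0 : ℤ) < p := by exact_mod_cast hp.pos
  have hm1 : m < 1 := by
    by_contra hcon; push Not at hcon; nlinarith [sq_nonneg a]
  have hm2 : -2 < m := by
    by_contra hcon; push Not at hcon; nlinarith [sq_nonneg x]
  have hm3 : m ≠ 0 := by
    rintro rfl
    by_cases ha0 : a = 0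
    · subst ha0
      have : x = 0 := by simpa using hm
      simp [this] at hne
    · have ha0' : (a : ℚ) ≠ 0 := by exact_mod_cast ha0
      apply rat_not_sq_two ((x : ℚ) / (a : ℚ))
      field_simp
      have : x ^ 2 = a ^ 2 * 2 := by linarith
      exact_mod_cast this
  have hm4 : m = -1 := by omega
  subst hm4
  have hrep : p + x.natAbs ^ 2 = 2 * a.natAbs ^ 2 := by
    zify; rw [sq_abs, sq_abs]; linarith
  have hleg : legendreSym p x.natAbs = legendreSym p a.natAbs := by
    have key : ∀ y : ℤ, legendreSym p y.natAbs = legendreSym p y := by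
      intro y
      have h1 : legendreSym p (-1) = 1 := by
        rw [legendreSym.at_neg_one (by rintro rfl; norm_num at h16), ZMod.χ₄_nat_one_mod_four (by omega)]
      rcases Int.natAbs_eq y with h | h
      · conv_rhs => rw [h]
      · conv_rhs => rw [h, ← neg_one_mul, legendreSym.mul, h1, one_mul]
    have hz0 : z ≠ 0 := by
      rintro rfl
      have h2 : ((2 : ℕ) : ZMod p) = 0 := by rw [Nat.cast_ofNat, ← hz]; ring
      rw [ZMod.natCast_eq_zero_iff] at h2
      have := Nat.le_of_dvd two_pos h2
      have := hp.two_le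
      have : p = 2 := by omega
      subst this; norm_num at h16
    rw [key, key, legendreSym, legendreSym, hxa, map_mul, quadraticChar_sq_one' hz0, one_mul]
  generalize x.natAbs = X at *
  generalize a.natAbs = A at *
  have hcop : Nat.Coprime A X := by
    by_contra hcon
    obtain ⟨l, hl, ⟨A', rfl⟩, ⟨X', rfl⟩⟩ := Nat.Prime.not_coprime_iff_dvd.mp hcon
    have h1 : l * (l * (2 * A' ^ 2)) = p + l * (l * X' ^ 2) := by linarith
    have h2 : l * l ∣ p := by
      refine (Nat.dvd_add_left (⟨X' ^ 2, by ring⟩ : l * l ∣ l * (l * X' ^ 2))).mp ?_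
      rw [← h1]
      exact ⟨2 * A' ^ 2, by ring⟩
    have h3 := hp.prime.squarefree l h2
    exact hl.prime.not_isUnit h3
  have hpar := rep_par ⟨X % 16, Nat.mod_lt _ (by norm_num)⟩ ⟨A % 16, Nat.mod_lt _ (by norm_num)⟩ (by
    dsimp only
    have h1 : 9 + (X % 16) ^ 2 ≡ p + X ^ 2 [MOD 16] := Nat.ModEq.add (by rw [← h16]; exact Nat.mod_modEq _ _) ((Nat.mod_modEq _ _).pow 2)
    have h2 : 2 * (A % 16) ^ 2 ≡ 2 * A ^ 2 [MOD 16] := Nat.ModEq.mul_left _ ((Nat.mod_modEq _ _).pow 2)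
    rw [← hrep] at h2
    exact h1.trans h2.symm)
  dsimp only at hpar
  have hAo : Odd A := Nat.odd_iff.mpr (by omega)
  have hXo : Odd X := Nat.odd_iff.mpr (by omega)
  have e1 : legendreSym p X = -1 := by
    rw [jacobiSym.legendreSym.to_jacobiSym, ← jacobiSym.quadratic_reciprocity_one_mod_four (by omega) hXo,
      jacobiSym.mod_left' (a₂ := 2 * (A : ℤ) ^ 2), jacobiSym.mul_left, jacobiSym.pow_left, jacobiSym.sq_one (by exact_mod_cast hcop), mul_one,
      jacobiSym.at_two hXo, ZMod.χ₈_nat_eq_if_mod_eight]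
    · rcases hpar.2 with h | h
      · simp [show X % 8 = 3 by omega, show X % 2 = 1 by omega]
      · simp [show X % 8 = 5 by omega, show X % 2 = 1 by omega]
    · have : 2 * (A : ℤ) ^ 2 = p + X * X := by rw [← pow_two]; exact_mod_cast hrep.symm
      rw [this]; simp
  have e2 : legendreSym p A = ZMod.χ₄ A := by
    rw [jacobiSym.legendreSym.to_jacobiSym, ← jacobiSym.quadratic_reciprocity_one_mod_four (by omega) hAo,
      jacobiSym.mod_left' (a₂ := -1 * (X : ℤ) ^ 2), jacobiSym.mul_left, jacobiSym.pow_left, jacobiSym.sq_one (by exact_mod_cast hcop.symm), mul_one,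
      jacobiSym.at_neg_one hAo]
    · have : (p : ℤ) = -1 * X ^ 2 + A * (2 * A) := by
        have : 2 * (A : ℤ) ^ 2 = p + X ^ 2 := by exact_mod_cast hrep.symm
        linarith
      rw [this]; simp
  refine ⟨A, X, hrep, ?_, by omega, Nat.Coprime.mul_right (Nat.coprime_two_right.mpr hAo) hcop⟩
  by_contra h3
  rw [e1, e2, ZMod.χ₄_nat_one_mod_four (by omega)] at hleg
  norm_num at hleg

end ArithJ3

section GroupK
variable {G : Type*} [CommGroup G]

theorem mem_primary_iff {g : G} : g ∈ CommGroup.primaryComponent G 2 ↔ ∃ n : ℕ, g ^ 2 ^ n = 1 := Iff.rfl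

theorem card_primary [Finite G] : Nat.card (CommGroup.primaryComponent G 2) = 2 ^ (Nat.card G).factorization 2 := by
  obtain ⟨k, hk⟩ := IsPGroup.iff_card.mp (CommGroup.primaryComponent.isPGroup (G := G) (p := 2))
  apply Nat.dvd_antisymm
  · rw [hk]
    apply pow_dvd_pow
    rw [← Nat.prime_two.pow_dvd_iff_le_factorization Nat.card_pos.ne', ← hk]
    exact Subgroup.card_subgroup_dvd_card _
  · obtain ⟨P⟩ : Nonempty (Sylow 2 G) := inferInstance
    rw [← Sylow.card_eq_multiplicity P]
    apply Subgroup.card_dvd_of_le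
    intro g hg
    obtain ⟨n, hn⟩ := P.2 ⟨g, hg⟩
    exact mem_primary_iff.mpr ⟨n, by simpa using congrArg Subtype.val hn⟩

theorem card_primary_eq [Finite G] {a m : ℕ} (hm : Odd m) (h : Nat.card G = 2 ^ a * m) : Nat.card (CommGroup.primaryComponent G 2) = 2 ^ a := by
  rw [card_primary, h, Nat.factorization_mul (by positivity) (by rintro rfl; simp at hm), Nat.factorization_pow]
  simp [Nat.Prime.factorization_self Nat.prime_two, Nat.factorization_eq_zero_of_not_dvd hm.not_two_dvd_nat]

theorem exists_odd_of_primary [Finite G] : ∃ m, Odd m ∧ Nat.card G = Nat.card (CommGroup.primaryComponent G 2) * m := by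
  refine ⟨Nat.card G / 2 ^ (Nat.card G).factorization 2, ?_, ?_⟩
  · rw [← Nat.not_even_iff_odd, even_iff_two_dvd]
    exact Nat.not_dvd_ordCompl Nat.prime_two Nat.card_pos.ne'
  · rw [card_primary, Nat.ordProj_mul_ordCompl_eq_self]

theorem four_odd [Finite G] (T : Finset G) (hT : T.card = 4) (h1 : ∀ g, g ∈ T ↔ g ^ 4 = 1) (h2 : ∀ g : G, g ^ 8 = 1 → g ^ 4 = 1) :
    ∃ m, Odd m ∧ Nat.card G = 4 * m := by
  have : ∀ n : ℕ, ∀ g : G, g ^ 2 ^ n = 1 → g ^ 4 = 1 := by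
    intro n
    induction n with
    | zero => intro g hg; rw [pow_zero, pow_one] at hg; simp [hg]
    | succ n ih =>
      intro g hg
      apply h2
      have := ih (g ^ 2) (by rw [← pow_mul, ← pow_succ', hg])
      rw [← pow_mul] at this
      exact this
  have hc : Nat.card (CommGroup.primaryComponent G 2) = 4 := by
    rw [← hT, ← Set.ncard_coe_finset]
    change Set.ncard _ = _
    congr 1
    ext g
    simp only [SetLike.mem_coe]
    rw [h1, mem_primary_iff]
    exact ⟨fun ⟨n, hn⟩ => this n g hn, fun h => ⟨2, h⟩⟩
  obtain ⟨m, hm, h⟩ := exists_odd_of_primary (G := G)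
  exact ⟨m, hm, by rw [h, hc]⟩

end GroupK

section K2

theorem InvSetup.class_mem {A B : Type*} [CommRing A] [IsDomain A] [IsPrincipalIdealRing A] [CommRing B] [IsDedekindDomain B]
    [Algebra A B] {τ : B ≃+* B} {θ : B} (S : InvSetup A B τ θ) (H : Subgroup (ClassGroup B))
    (hH : ∀ P : Ideal B, P.IsPrime → ∀ h0 : P ≠ ⊥, θ - τ θ ∈ P → ClassGroup.mk0 ⟨P, mem_nonZeroDivisors_of_ne_zero h0⟩ ∈ H)
    (δ : B) (hδ : τ δ = -δ) (hδ0 : δ ≠ 0) {I : Ideal B} (hI : I ∈ nonZeroDivisors (Ideal B)) {γ : B} {n : A} (hn : n ≠ 0) (h1 : I * I = Ideal.span {γ})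
    (h2 : I * I.map τ = Ideal.span {algebraMap A B n}) (h3 : γ * τ γ = algebraMap A B n ^ 2) :
    ClassGroup.mk0 ⟨I, hI⟩ ∈ H := by
  obtain ⟨β, hβ0, hβ⟩ := S.hilbert δ hδ hδ0 hn h1 h2 h3
  have hI0 := nonZeroDivisors.ne_zero hI
  have hβ0' : Ideal.span {β} ≠ (0 : Ideal B) := by simpa using hβ0
  obtain ⟨a, s, ha, hs, hJ⟩ := S.invariant _ (mul_ne_zero hI0 hβ0') hβ
  have ha0 : algebraMap A B a ≠ 0 := by
    intro h; exact ha (S.inj (by rw [h, map_zero]))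
  have ha0' : Ideal.span {algebraMap A B a} ≠ (0 : Ideal B) := by simpa using ha0
  have hs0 : s.prod ≠ 0 := by
    intro h
    obtain h := Multiset.prod_eq_zero_iff.mp h
    exact (hs _ h).2.1 rfl
  have key : ∀ s : Multiset (Ideal B), (∀ P ∈ s, P.IsPrime ∧ P ≠ ⊥ ∧ θ - τ θ ∈ P) → ∀ h : s.prod ≠ 0,
      ClassGroup.mk0 ⟨s.prod, mem_nonZeroDivisors_of_ne_zero h⟩ ∈ H := by
    intro s
    induction s using Multiset.induction with
    | empty =>
      intro _ h
      have : ClassGroup.mk0 ⟨(0 : Multiset (Ideal B)).prod, mem_nonZeroDivisors_of_ne_zero h⟩ = 1 := by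
        rw [ClassGroup.mk0_eq_one_iff, Multiset.prod_zero]
        exact ⟨1, by simp⟩
      rw [this]; exact one_mem _
    | cons P s ih =>
      intro hs h
      have hP := hs P (Multiset.mem_cons_self P s)
      have hs' : s.prod ≠ 0 := by
        intro h'; apply h; rw [Multiset.prod_cons, h', mul_zero]
      have e : (⟨(P ::ₘ s).prod, mem_nonZeroDivisors_of_ne_zero h⟩ : nonZeroDivisors (Ideal B)) =
          ⟨P, mem_nonZeroDivisors_of_ne_zero hP.2.1⟩ * ⟨s.prod, mem_nonZeroDivisors_of_ne_zero hs'⟩ := by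
        ext1; simp
      rw [e, map_mul]
      exact mul_mem (hH P hP.1 hP.2.1 hP.2.2) (ih (fun Q hQ => hs Q (Multiset.mem_cons_of_mem hQ)) hs')
  have hprin : ∀ x : B, ∀ h : Ideal.span {x} ≠ 0, ClassGroup.mk0 ⟨Ideal.span {x}, mem_nonZeroDivisors_of_ne_zero h⟩ = 1 := by
    intro x h
    rw [ClassGroup.mk0_eq_one_iff]
    exact ⟨x, rfl⟩
  have e : (⟨I, hI⟩ * ⟨_, mem_nonZeroDivisors_of_ne_zero hβ0'⟩ : nonZeroDivisors (Ideal B)) =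
     ⟨_, mem_nonZeroDivisors_of_ne_zero ha0'⟩ * ⟨s.prod, mem_nonZeroDivisors_of_ne_zero hs0⟩ := by
    ext1; exact hJ
  have e' := congrArg ClassGroup.mk0 e
  rw [map_mul, map_mul, hprin _ hβ0', hprin _ ha0', mul_one, one_mul] at e'
  rw [e']
  exact key s hs hs0

variable {K : Type*} [Field K] [NumberField K]

theorem absNorm_conj (τ : 𝓞 K ≃+* 𝓞 K) (x : 𝓞 K) : Ideal.absNorm (Ideal.span {x}) ^ 2 = Ideal.absNorm (Ideal.span {x * τ x}) := by
  rw [← Ideal.span_singleton_mul_span_singleton, map_mul, Ideal.absNorm_span_singleton, Ideal.absNorm_span_singleton]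
  let e : 𝓞 K ≃ₐ[ℤ] 𝓞 K := AlgEquiv.ofRingEquiv (f := τ) (fun r => by simp)
  have : Algebra.norm ℤ (τ x) = Algebra.norm ℤ x := Algebra.norm_eq_of_algEquiv e x
  rw [this, pow_two]

theorem absNorm_int (n : ℤ) : Ideal.absNorm (Ideal.span {(n : 𝓞 K)}) = n.natAbs ^ Module.finrank ℚ K := by
  rw [Ideal.absNorm_span_singleton, ← eq_intCast (algebraMap ℤ (𝓞 K)), Algebra.norm_algebraMap, RingOfIntegers.rank, Int.natAbs_pow]

/-- basic data on an imaginary quadratic field -/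
structure Imag (K : Type*) [Field K] [NumberField K] (d : ℕ) (τ : 𝓞 K ≃+* 𝓞 K) (R : 𝓞 K) : Prop where
  inv : InvSetup ℤ (𝓞 K) τ R
  tau : τ R = - R
  sq : R ^ 2 = - (d : 𝓞 K)
  norm : ∀ x y : ℤ, (Ideal.absNorm (Ideal.span {(x : 𝓞 K) + y * R}) : ℤ) = x ^ 2 + d * y ^ 2
  deg : Module.finrank ℚ K = 2

theorem IsQuad.imag {d : ℕ} {r : K} (h : IsQuad ℚ K ((-(d : ℤ) : ℤ) : ℚ) r) (hd : Squarefree d) (hd8 : d % 8 = 1) :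
    ∃ τ R, Imag K d τ R := by
  obtain ⟨σ, hσ⟩ := h.exists_conj
  have hsq : r ^ 2 = ((-(d : ℤ) : ℤ) : K) := by simpa using h.sq
  obtain ⟨R, hR⟩ := exists_ringOfIntegers (isIntegral_of_sq_int hsq)
  have hσr : σ r = -r := by simpa using hσ 0 1
  set τ := RingOfIntegers.mapRingEquiv σ.toRingEquiv with hτ
  have hτa : ∀ x, algebraMap (𝓞 K) K (τ x) = σ (algebraMap (𝓞 K) K x) := fun x => rfl
  have hτR : τ R = -R := by
    apply RingOfIntegers.ext
    change algebraMap (𝓞 K) K _ = algebraMap (𝓞 K) K _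
    rw [hτa, hR, map_neg, hσr, hR]
  have hR2 : R ^ 2 = - (d : 𝓞 K) := by
    apply RingOfIntegers.ext
    change algebraMap (𝓞 K) K _ = algebraMap (𝓞 K) K _
    rw [map_pow, hR, hsq, map_neg, map_natCast]; simp
  have hgen : ∀ x : 𝓞 K, ∃ a b : ℤ, x = a + b * R := by
    intro x
    obtain ⟨a, b, hx⟩ := h.int_repr_23 (by rw [← Int.squarefree_natAbs]; simpa using hd) (by omega) (RingOfIntegers.isIntegral_coe x)
    refine ⟨a, b, ?_⟩
    apply RingOfIntegers.ext
    change algebraMap (𝓞 K) K _ = algebraMap (𝓞 K) K _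
    simp only [map_add, map_mul, map_intCast, hR]
    exact hx
  have hR0 : R ≠ 0 := by
    rintro rfl
    have : (d : 𝓞 K) = 0 := by simpa using hR2
    have : d = 0 := by exact_mod_cast this
    subst this; norm_num at hd8
  refine ⟨τ, R, ⟨⟨?_, ?_, ?_, ?_, ?_⟩, hτR, hR2, ?_, h.finrank_eq⟩⟩
  · intro x
    obtain ⟨a, b, rfl⟩ := hgen x
    simp [hτR]
  · intro a; simp
  · exact FaithfulSMul.algebraMap_injective ℤ (𝓞 K)
  · intro x
    obtain ⟨a, b, rfl⟩ := hgen x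
    exact ⟨a, b, by simp⟩
  · rw [hτR]
    intro h2
    have h3 : 2 * R = 0 := by linear_combination -h2
    rcases mul_eq_zero.mp h3 with h | h
    · norm_num at h
    · exact hR0 h
  · intro x y
    have h1 := absNorm_conj τ ((x : 𝓞 K) + y * R)
    have h2 : ((x : 𝓞 K) + y * R) * τ ((x : 𝓞 K) + y * R) = ((x ^ 2 + d * y ^ 2 : ℤ) : 𝓞 K) := by
      rw [map_add, map_mul, hτR, map_intCast, map_intCast]; push_cast; linear_combination (-(y : 𝓞 K) ^ 2) * hR2
    rw [h2, absNorm_int, h.finrank_eq] at h1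
    rw [Nat.pow_left_injective (n := 2) (by norm_num) h1]
    apply Int.natAbs_of_nonneg
    positivity

variable {d : ℕ} {τ : 𝓞 K ≃+* 𝓞 K} {R : 𝓞 K}

theorem Imag.two_torsion (S : Imag K d τ R) (hd : d ≠ 0) (H : Subgroup (ClassGroup (𝓞 K)))
    (hH : ∀ P : Ideal (𝓞 K), P.IsPrime → ∀ h0 : P ≠ ⊥, 2 * R ∈ P → ClassGroup.mk0 ⟨P, mem_nonZeroDivisors_of_ne_zero h0⟩ ∈ H)
    (c : ClassGroup (𝓞 K)) (hc : c ^ 2 = 1) : c ∈ H := by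
  obtain ⟨⟨I, hI⟩, rfl⟩ := ClassGroup.mk0_surjective c
  have hI0 := nonZeroDivisors.ne_zero hI
  rw [pow_two, ← map_mul] at hc
  have hp : (I * I).IsPrincipal := by
    rwa [← ClassGroup.mk0_eq_one_iff (mul_mem hI hI)]
  obtain ⟨γ, hγ⟩ := hp
  have hγ : I * I = Ideal.span {γ} := hγ
  obtain ⟨n, hn⟩ := S.inv.norm_ideal I
  have hR0 : R ≠ 0 := by
    rintro rfl
    have : (d : 𝓞 K) = 0 := by simpa using S.sq
    exact hd (by exact_mod_cast this)
  have hn0 : n ≠ 0 := by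
    rintro rfl
    have : I * I.map τ ≠ 0 := mul_ne_zero hI0 (S.inv.map_ne_bot hI0)
    apply this; rw [hn]; simp
  refine S.inv.class_mem H (by rw [S.tau, sub_neg_eq_add, ← two_mul]; exact hH) R S.tau hR0 hI hn0 hγ hn ?_
  obtain ⟨x, y, hxy⟩ := S.inv.gen γ
  simp only [eq_intCast] at hxy hn ⊢
  have h2 : γ * τ γ = ((x ^ 2 + d * y ^ 2 : ℤ) : 𝓞 K) := by
    rw [hxy, map_add, map_mul, S.tau, map_intCast, map_intCast]; push_cast; linear_combination (-(y : 𝓞 K) ^ 2) * S.sq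
  have h3 : Ideal.span {γ * τ γ} = Ideal.span {((n ^ 2 : ℤ) : 𝓞 K)} := by
    rw [← Ideal.span_singleton_mul_span_singleton, ← S.inv.map_span, ← hγ, Ideal.map_mul, mul_mul_mul_comm, hn,
      Ideal.span_singleton_mul_span_singleton]
    push_cast; rw [pow_two]
  rw [h2] at h3 ⊢
  have h4 := congrArg Ideal.absNorm h3
  rw [absNorm_int, absNorm_int, S.deg] at h4
  have h5 := Nat.pow_left_injective (n := 2) (by norm_num) h4
  have h6 : x ^ 2 + d * y ^ 2 = n ^ 2 := by
    zify at h5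
    rwa [abs_of_nonneg (by positivity), abs_of_nonneg (by positivity)] at h5
  rw [h6]; push_cast; rfl

theorem Imag.norm_form (S : Imag K d τ R) {I E : Ideal (𝓞 K)} (hI : I ∈ nonZeroDivisors (Ideal (𝓞 K))) (hE : E ∈ nonZeroDivisors (Ideal (𝓞 K)))
    (h : ClassGroup.mk0 ⟨I, hI⟩ ^ 2 * ClassGroup.mk0 ⟨E, hE⟩ = 1) : ∃ c x y : ℤ, c ≠ 0 ∧ Ideal.absNorm E * c ^ 2 = x ^ 2 + d * y ^ 2 := by
  rw [pow_two, ← map_mul, ← map_mul] at h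
  have hp : (I * I * E).IsPrincipal := by
    rwa [← ClassGroup.mk0_eq_one_iff (mul_mem (mul_mem hI hI) hE)]
  obtain ⟨γ, hγ⟩ := hp
  have hγ : I * I * E = Ideal.span {γ} := hγ
  obtain ⟨x, y, hxy⟩ := S.inv.gen γ
  simp only [eq_intCast] at hxy
  refine ⟨Ideal.absNorm I, x, y, ?_, ?_⟩
  · have := nonZeroDivisors.ne_zero hI
    rw [Ne, Nat.cast_eq_zero, Ideal.absNorm_eq_zero_iff]; exact this
  · rw [← S.norm, ← hxy, ← hγ, map_mul, map_mul]; push_cast; ring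

end K2

section K3

theorem pair_mul_eq {B : Type*} [CommRing B] {a b c e g : B} (h1 : g ∣ a * c) (h2 : g ∣ a * e) (h3 : g ∣ b * c) (h4 : g ∣ b * e)
    (u1 u2 u3 u4 : B) (h : g = u1 * (a * c) + u2 * (a * e) + u3 * (b * c) + u4 * (b * e)) :
    Ideal.span {a, b} * Ideal.span {c, e} = Ideal.span {g} := by
  rw [Ideal.span_pair_mul_span_pair]
  apply le_antisymm
  · rw [Ideal.span_le]
    rintro x (rfl | rfl | rfl | rfl) <;> rw [SetLike.mem_coe, Ideal.mem_span_singleton] <;> assumption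
  · rw [Ideal.span_singleton_le_iff_mem, h]
    refine add_mem (add_mem (add_mem ?_ ?_) ?_) ?_ <;> apply Ideal.mul_mem_left <;> apply Ideal.subset_span <;> simp

variable {K : Type*} [Field K] [NumberField K] {d : ℕ} {τ : 𝓞 K ≃+* 𝓞 K} {R : 𝓞 K}

theorem eq_of_prime_norm {I P : Ideal (𝓞 K)} (hI : (Ideal.absNorm I).Prime) (hP : P.IsPrime) (h : I ≤ P) : P = I := by
  have h1 : I.IsPrime := Ideal.isPrime_of_irreducible_absNorm hI
  have h0 : I ≠ ⊥ := by
    rintro rfl; simp at hI; exact absurd hI (by norm_num)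
  exact ((h1.isMaximal h0).eq_of_le hP.ne_top h).symm

theorem norm_of_sq (hdeg : Module.finrank ℚ K = 2) {I : Ideal (𝓞 K)} {n : ℕ} (h : I * I = Ideal.span {(n : 𝓞 K)}) : Ideal.absNorm I = n := by
  have h1 := congrArg Ideal.absNorm h
  have h2 := absNorm_int (K := K) n
  rw [Int.cast_natCast] at h2
  rw [map_mul, h2, hdeg, Int.natAbs_natCast] at h1
  exact Nat.pow_left_injective (n := 2) (by norm_num) (by simpa [pow_two] using h1)

theorem mk0_sq {I : Ideal (𝓞 K)} (hI : I ∈ nonZeroDivisors (Ideal (𝓞 K))) {x : 𝓞 K} (h : I * I = Ideal.span {x}) :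
    ClassGroup.mk0 ⟨I, hI⟩ ^ 2 = 1 := by
  rw [pow_two, ← map_mul]
  exact (ClassGroup.mk0_eq_one_iff (mul_mem hI hI)).mpr ⟨x, h⟩

theorem Imag.p2_sq (S : Imag K d τ R) (hd8 : d % 8 = 1) : Ideal.span {2, 1 + R} * Ideal.span {2, 1 + R} = Ideal.span {((2 : ℕ) : 𝓞 K)} := by
  obtain ⟨m, hm⟩ : ∃ m, d = 8 * m + 1 := ⟨d / 8, by omega⟩
  have hsq := S.sq
  rw [hm] at hsq
  push_cast at hsq ⊢
  refine pair_mul_eq (g := (2 : 𝓞 K)) ⟨2, by ring⟩ ⟨1 + R, by ring⟩ ⟨1 + R, by ring⟩ ⟨R - 4 * m, by linear_combination hsq⟩ (-2 * m) 1 0 (-1) ?_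
  linear_combination hsq

theorem Imag.p2_unique (S : Imag K d τ R) (hd8 : d % 8 = 1) {P : Ideal (𝓞 K)} (hP : P.IsPrime) (h : 2 ∈ P) : P = Ideal.span {2, 1 + R} := by
  apply eq_of_prime_norm _ hP
  · rw [Ideal.span_le]
    have h1 : 1 + R ∈ P := by
      apply hP.mem_of_pow_mem 2
      obtain ⟨m, hm⟩ : ∃ m, d = 8 * m + 1 := ⟨d / 8, by omega⟩
      have hsq := S.sq
      rw [hm] at hsq
      push_cast at hsq
      rw [show (1 + R) ^ 2 = 2 * (R - 4 * m) by linear_combination hsq]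
      exact Ideal.mul_mem_right _ _ h
    rintro x (rfl | rfl)
    · exact h
    · exact h1
  · rw [norm_of_sq S.deg (S.p2_sq hd8)]; exact Nat.prime_two

theorem ne_zero_of_sq {I : Ideal (𝓞 K)} {n : ℕ} (hn : n ≠ 0) (h : I * I = Ideal.span {(n : 𝓞 K)}) : I ∈ nonZeroDivisors (Ideal (𝓞 K)) := by
  apply mem_nonZeroDivisors_of_ne_zero
  rintro rfl
  rw [mul_zero] at h
  have := h.symm
  simp at this
  exact hn this

theorem Imag.pq {p q : ℕ} (hp : p.Prime) (hq : q.Prime) (h8 : p % 8 = 3) (h8' : q % 8 = 3) (hpq : p ≠ q) (S : Imag K (p * q) τ R) :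
    ∃ m, Odd m ∧ classNumber K = 4 * m := by
  have hd8 : (p * q) % 8 = 1 := by rw [Nat.mul_mod, h8, h8']
  have hsq := S.sq
  push_cast at hsq
  obtain ⟨u, v, huv⟩ : ∃ u v : 𝓞 K, u * p + v * q = 1 := by
    have : IsCoprime (p : ℤ) q := Nat.isCoprime_iff_coprime.mpr ((Nat.coprime_primes hp hq).mpr hpq)
    obtain ⟨u, v, h⟩ := this
    exact ⟨u, v, by exact_mod_cast congrArg (Int.cast : ℤ → 𝓞 K) h⟩
  have s2 := S.p2_sq hd8
  have sp : Ideal.span {(p : 𝓞 K), R} * Ideal.span {(p : 𝓞 K), R} = Ideal.span {(p : 𝓞 K)} := by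
    refine pair_mul_eq ⟨p, by ring⟩ ⟨R, by ring⟩ ⟨R, by ring⟩ ⟨-q, by linear_combination hsq⟩ u 0 0 (-v) ?_
    linear_combination -(p : 𝓞 K) * huv + v * hsq
  have sq' : Ideal.span {(q : 𝓞 K), R} * Ideal.span {(q : 𝓞 K), R} = Ideal.span {(q : 𝓞 K)} := by
    refine pair_mul_eq ⟨q, by ring⟩ ⟨R, by ring⟩ ⟨R, by ring⟩ ⟨-p, by linear_combination hsq⟩ v 0 0 (-u) ?_
    linear_combination -(q : 𝓞 K) * huv + u * hsq
  have spq : Ideal.span {(p : 𝓞 K), R} * Ideal.span {(q : 𝓞 K), R} = Ideal.span {R} := by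
    refine pair_mul_eq ⟨-R, by linear_combination hsq⟩ ⟨p, by ring⟩ ⟨q, by ring⟩ ⟨R, by ring⟩ 0 u v 0 ?_
    linear_combination -R * huv
  have n2 := ne_zero_of_sq two_ne_zero s2
  have np := ne_zero_of_sq hp.ne_zero sp
  have nq := ne_zero_of_sq hq.ne_zero sq'
  set 𝔭2 := Ideal.span {2, 1 + R} with h𝔭2
  set 𝔭 := Ideal.span {(p : 𝓞 K), R} with h𝔭
  set 𝔮 := Ideal.span {(q : 𝓞 K), R} with h𝔮
  set e := ClassGroup.mk0 ⟨𝔭2, n2⟩ with he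
  set f := ClassGroup.mk0 ⟨𝔭, np⟩ with hf
  have e2 : e ^ 2 = 1 := mk0_sq n2 s2
  have f2 : f ^ 2 = 1 := mk0_sq np sp
  have fq : ClassGroup.mk0 ⟨𝔮, nq⟩ = f := by
    have : f * ClassGroup.mk0 ⟨𝔮, nq⟩ = 1 := by
      rw [hf, ← map_mul]
      exact (ClassGroup.mk0_eq_one_iff (mul_mem np nq)).mpr ⟨R, spq⟩
    rw [pow_two] at f2
    exact mul_left_cancel (this.trans f2.symm)
  have N2 : Ideal.absNorm 𝔭2 = 2 := norm_of_sq S.deg s2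
  have Np : Ideal.absNorm 𝔭 = p := norm_of_sq S.deg sp
  have Nq : Ideal.absNorm 𝔮 = q := norm_of_sq S.deg sq'
  have tors : ∀ c : ClassGroup (𝓞 K), c ^ 2 = 1 → c = 1 ∨ c = e ∨ c = f ∨ c = e * f := by
    intro c hc
    have := S.two_torsion (Nat.mul_ne_zero hp.ne_zero hq.ne_zero) (Subgroup.closure {e, f}) ?_ c hc
    · rw [Subgroup.mem_closure_pair] at this
      obtain ⟨m, n, rfl⟩ := this
      have key : ∀ g : ClassGroup (𝓞 K), g ^ 2 = 1 → ∀ m : ℤ, g ^ m = 1 ∨ g ^ m = g := by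
        intro g hg m
        rcases Int.even_or_odd' m with ⟨k, rfl | rfl⟩
        · left; rw [zpow_mul]; norm_cast; rw [hg, one_zpow]
        · right; rw [zpow_add, zpow_mul]; norm_cast; rw [hg, one_zpow, one_mul, pow_one]
      rcases key e e2 m with h | h <;> rcases key f f2 n with h' | h' <;> rw [h, h'] <;> simp
    · intro P hP h0 hmem
      have heH : e ∈ Subgroup.closure {e, f} := Subgroup.subset_closure (by simp)
      have hfH : f ∈ Subgroup.closure {e, f} := Subgroup.subset_closure (by simp)
      rcases hP.mem_or_mem hmem with h | h
      · have := S.p2_unique hd8 hP h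
        subst this; exact heH
      · have h1 : (p : 𝓞 K) * q ∈ P := by
          rw [show (p : 𝓞 K) * q = - (R * R) by linear_combination hsq]
          exact neg_mem (Ideal.mul_mem_left _ _ h)
        rcases hP.mem_or_mem h1 with h2 | h2
        · have := eq_of_prime_norm (I := 𝔭) (by rw [Np]; exact hp) hP (by
            rw [h𝔭, Ideal.span_le]; rintro x (rfl | rfl) <;> assumption)
          subst this; exact hfH
        · have := eq_of_prime_norm (I := 𝔮) (by rw [Nq]; exact hq) hP (by
            rw [h𝔮, Ideal.span_le]; rintro x (rfl | rfl) <;> assumption)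
          subst this; rw [fq]; exact hfH
  have hge : ∀ g : ClassGroup (𝓞 K), g ^ 2 * e ≠ 1 := by
    intro g hg
    obtain ⟨⟨I, hI⟩, rfl⟩ := ClassGroup.mk0_surjective g
    obtain ⟨c, x, y, hc, h⟩ := S.norm_form hI n2 hg
    rw [N2] at h
    exact hc (form_two hp hq h8 hpq c x y (by push_cast at h; exact h))
  have hgf : ∀ g : ClassGroup (𝓞 K), g ^ 2 * f ≠ 1 := by
    intro g hg
    obtain ⟨⟨I, hI⟩, rfl⟩ := ClassGroup.mk0_surjective g
    obtain ⟨c, x, y, hc, h⟩ := S.norm_form hI np hg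
    rw [Np] at h
    exact hc (form_p hp hq h8 h8' hpq (Or.inl rfl) c x y (by push_cast at h ⊢; linarith))
  have hgef : ∀ g : ClassGroup (𝓞 K), g ^ 2 * (e * f) ≠ 1 := by
    intro g hg
    obtain ⟨⟨I, hI⟩, rfl⟩ := ClassGroup.mk0_surjective g
    obtain ⟨c, x, y, hc, h⟩ := S.norm_form hI (mul_mem n2 np) (by rw [← hg, he, hf, ← map_mul ClassGroup.mk0]; rfl)
    rw [map_mul, N2, Np] at h
    exact hc (form_p hp hq h8 h8' hpq (Or.inr rfl) c x y (by push_cast at h ⊢; linarith))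
  have e1 : e ≠ 1 := by simpa using hge 1
  have f1 : f ≠ 1 := by simpa using hgf 1
  have ef1 : e * f ≠ 1 := by simpa using hgef 1
  have ef : e ≠ f := by rintro h; rw [h, ← pow_two] at ef1; exact ef1 f2
  have h4 : ∀ g : ClassGroup (𝓞 K), g ^ 4 = 1 → g ^ 2 = 1 := by
    intro g hg
    have h1 : (g ^ 2) ^ 2 = 1 := by rw [← pow_mul]; exact hg
    rcases tors _ h1 with h | h | h | h
    · exact h
    · exact absurd (by rw [h, ← pow_two, e2]) (hge g)
    · exact absurd (by rw [h, ← pow_two, f2]) (hgf g)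
    · exact absurd (by rw [h, ← pow_two, mul_pow, e2, f2, one_mul]) (hgef g)
  classical
  have := four_odd ({1, e, f, e * f} : Finset (ClassGroup (𝓞 K))) ?_ ?_ ?_
  · rw [Nat.card_eq_fintype_card] at this
    exact this
  · have a1 : e * f ≠ e := by simpa using f1
    have a2 : e * f ≠ f := by simpa using e1
    rw [Finset.card_insert_of_notMem, Finset.card_insert_of_notMem, Finset.card_insert_of_notMem, Finset.card_singleton]
    · simpa using a2.symm
    · simp [ef, a1.symm]
    · simp [e1.symm, f1.symm, ef1.symm]
  · intro g
    simp only [Finset.mem_insert, Finset.mem_singleton]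
    constructor
    · have x4 : ∀ x : ClassGroup (𝓞 K), x ^ 2 = 1 → x ^ 4 = 1 := by
        intro x hx; rw [show 4 = 2 * 2 by rfl, pow_mul, hx, one_pow]
      rintro (rfl | rfl | rfl | rfl)
      · exact one_pow 4
      · exact x4 _ e2
      · exact x4 _ f2
      · exact x4 _ (by rw [mul_pow, e2, f2, one_mul])
    · intro hg; exact tors g (h4 g hg)
  · intro g hg
    have := h4 (g ^ 2) (by rw [← pow_mul]; exact hg)
    rw [← pow_mul] at this; exact this

end K3

section K4

variable {K : Type*} [Field K] [NumberField K] {τ : 𝓞 K ≃+* 𝓞 K} {R : 𝓞 K}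

theorem Imag.p {p : ℕ} (hp : p.Prime) (h16 : p % 16 = 9) (hx : ∃ z : ZMod p, z ^ 4 = 2) (S : Imag K p τ R) :
    ∃ m, Odd m ∧ classNumber K = 4 * m := by
  have hd8 : p % 8 = 1 := by omega
  have hsq := S.sq
  obtain ⟨a, x, hax, ha, hx2, hcop⟩ := exists_rep hp h16 hx
  have haxK : (p : 𝓞 K) + x ^ 2 = 2 * a ^ 2 := by exact_mod_cast congrArg (Nat.cast : ℕ → 𝓞 K) hax
  obtain ⟨u, v, huv⟩ : ∃ u v : 𝓞 K, u * a + v * (2 * x) = 1 := by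
    have : IsCoprime (a : ℤ) ((2 * x : ℕ) : ℤ) := Nat.isCoprime_iff_coprime.mpr hcop
    obtain ⟨u, v, h⟩ := this
    exact ⟨u, v, by exact_mod_cast congrArg (Int.cast : ℤ → 𝓞 K) h⟩
  obtain ⟨k, hk⟩ : ∃ k, x = 2 * k + 1 := ⟨x / 2, by omega⟩
  obtain ⟨n, hn⟩ : ∃ n, a ^ 2 = 2 * n + 1 := by
    have : a ^ 2 % 2 = 1 := by
      have h2 : a % 2 = 1 := by omega
      rw [Nat.pow_mod, h2]
    exact ⟨a ^ 2 / 2, by omega⟩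
  have hkK : (x : 𝓞 K) = 2 * k + 1 := by rw [hk]; push_cast; ring
  have hnK : (a : 𝓞 K) ^ 2 = 2 * n + 1 := by exact_mod_cast congrArg (Nat.cast : ℕ → 𝓞 K) hn
  have s2 := S.p2_sq hd8
  have n2 := ne_zero_of_sq two_ne_zero s2
  have sa : Ideal.span {(a : 𝓞 K), x + R} * Ideal.span {(a : 𝓞 K), x + R} = Ideal.span {(a : 𝓞 K) ^ 2, x + R} := by
    rw [Ideal.span_pair_mul_span_pair]
    apply le_antisymm
    · rw [Ideal.span_le]
      rintro y (rfl | rfl | rfl | rfl) <;> rw [SetLike.mem_coe, Ideal.mem_span_pair]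
      · exact ⟨1, 0, by ring⟩
      · exact ⟨0, a, by ring⟩
      · exact ⟨0, a, by ring⟩
      · exact ⟨0, x + R, by ring⟩
    · rw [Ideal.span_le]
      rintro y (rfl | rfl) <;> rw [SetLike.mem_coe]
      · apply Ideal.subset_span; left; ring
      · have e : (x : 𝓞 K) + R = u * (a * (x + R)) + v * ((x + R) * (x + R)) + (v * 2) * (a * a) := by
          linear_combination -(x + R) * huv - v * hsq + v * haxK
        refine (congrArg (· ∈ Ideal.span {(a : 𝓞 K) * a, a * (x + R), (x + R) * a, (x + R) * (x + R)}) e).mpr ?_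
        refine add_mem (add_mem ?_ ?_) ?_ <;> apply Ideal.mul_mem_left <;> apply Ideal.subset_span <;> simp
  have sa2 : Ideal.span {(a : 𝓞 K), x + R} * Ideal.span {(a : 𝓞 K), x + R} * Ideal.span {2, 1 + R} = Ideal.span {x + R} := by
    rw [sa]
    refine pair_mul_eq ⟨x - R, ?_⟩ ⟨a ^ 2 - k * (x - R), ?_⟩ ⟨2, by ring⟩ ⟨1 + R, by ring⟩ k 1 (-n) 0 ?_
    · linear_combination -haxK + hsq
    · linear_combination (-(a : 𝓞 K) ^ 2) * hkK + k * haxK - k * hsq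
    · linear_combination (-(x + R)) * hnK + (a : 𝓞 K) ^ 2 * hkK
  have hx0 : (x : 𝓞 K) + R ≠ 0 := by
    intro h
    have := S.norm x 1
    push_cast at this
    rw [one_mul, h] at this
    simp at this
    have h0 := hp.pos
    nlinarith [sq_nonneg (x : ℤ)]
  have na : Ideal.span {(a : 𝓞 K), x + R} ∈ nonZeroDivisors (Ideal (𝓞 K)) := by
    apply mem_nonZeroDivisors_of_ne_zero
    intro h
    rw [h, zero_mul, zero_mul] at sa2
    have := sa2.symm
    simp at this
    exact hx0 this
  have N2 : Ideal.absNorm (Ideal.span {2, 1 + R}) = 2 := norm_of_sq S.deg s2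
  have Na : Ideal.absNorm (Ideal.span {(a : 𝓞 K), x + R}) = a := by
    have h := congrArg Ideal.absNorm sa2
    rw [map_mul, map_mul, N2] at h
    have h' := S.norm x 1
    push_cast at h'
    rw [one_mul] at h'
    have h2 : Ideal.absNorm (Ideal.span {(x : 𝓞 K) + R}) = x ^ 2 + p := by zify; rw [h']; ring
    rw [h2] at h
    exact Nat.pow_left_injective (n := 2) (by norm_num) (by simp only; nlinarith)
  set 𝔭2 := Ideal.span {2, 1 + R} with h𝔭2
  set 𝔞 := Ideal.span {(a : 𝓞 K), x + R} with h𝔞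
  set e := ClassGroup.mk0 ⟨𝔭2, n2⟩ with he
  set f := ClassGroup.mk0 ⟨𝔞, na⟩ with hf
  have e2 : e ^ 2 = 1 := mk0_sq n2 s2
  have f2 : f ^ 2 = e := by
    have : f ^ 2 * e = 1 := by
      rw [pow_two, he, hf, ← map_mul, ← map_mul]
      exact (ClassGroup.mk0_eq_one_iff (mul_mem (mul_mem na na) n2)).mpr ⟨_, sa2⟩
    rw [pow_two] at e2
    exact mul_right_cancel (this.trans e2.symm)
  have tors : ∀ c : ClassGroup (𝓞 K), c ^ 2 = 1 → c = 1 ∨ c = e := by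
    intro c hc
    have := S.two_torsion hp.ne_zero (Subgroup.zpowers e) ?_ c hc
    · obtain ⟨m, rfl⟩ := this
      simp only
      rcases Int.even_or_odd' m with ⟨k, rfl | rfl⟩
      · left; rw [zpow_mul]; norm_cast; rw [e2, one_zpow]
      · right; rw [zpow_add, zpow_mul]; norm_cast; rw [e2, one_zpow, one_mul, pow_one]
    · intro P hP h0 hmem
      rcases hP.mem_or_mem hmem with h | h
      · have := S.p2_unique hd8 hP h
        subst this; exact Subgroup.mem_zpowers _
      · have hN := S.norm 0 1
        push_cast at hN
        rw [one_mul, zero_add] at hN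
        have hN' : Ideal.absNorm (Ideal.span {R}) = p := by zify; rw [hN]; ring
        have := eq_of_prime_norm (I := Ideal.span {R}) (by rw [hN']; exact hp) hP (by rwa [Ideal.span_singleton_le_iff_mem])
        rw [(ClassGroup.mk0_eq_one_iff _).mpr ⟨R, this⟩]
        exact one_mem _
  have hgf : ∀ g : ClassGroup (𝓞 K), g ^ 2 * f ≠ 1 := by
    intro g hg
    obtain ⟨⟨I, hI⟩, rfl⟩ := ClassGroup.mk0_surjective g
    obtain ⟨c, x, y, hc, h⟩ := S.norm_form hI na hg
    rw [Na] at h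
    exact hc (form_a hd8 ha (Or.inl rfl) c x y (by push_cast at h ⊢; linarith))
  have hgef : ∀ g : ClassGroup (𝓞 K), g ^ 2 * (e * f) ≠ 1 := by
    intro g hg
    obtain ⟨⟨I, hI⟩, rfl⟩ := ClassGroup.mk0_surjective g
    obtain ⟨c, x, y, hc, h⟩ := S.norm_form hI (mul_mem n2 na) (by rw [← hg, he, hf, ← map_mul ClassGroup.mk0]; rfl)
    rw [map_mul, N2, Na] at h
    exact hc (form_a hd8 ha (Or.inr rfl) c x y (by push_cast at h ⊢; linarith))
  have f1 : f ≠ 1 := by simpa using hgf 1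
  have ef1 : e * f ≠ 1 := by simpa using hgef 1
  have e1 : e ≠ 1 := by
    intro h
    rw [h] at f2
    rcases tors f f2 with h' | h'
    · exact f1 h'
    · exact f1 (h'.trans h)
  have ef : e ≠ f := by rintro h; rw [h, ← pow_two] at ef1; exact ef1 (h ▸ e2)
  have h4 : ∀ g : ClassGroup (𝓞 K), g ^ 4 = 1 → g = 1 ∨ g = e ∨ g = f ∨ g = e * f := by
    intro g hg
    have h1 : (g ^ 2) ^ 2 = 1 := by rw [← pow_mul]; exact hg
    rcases tors _ h1 with h | h
    · rcases tors _ h with h | h <;> simp [h]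
    · have : (g * f⁻¹) ^ 2 = 1 := by rw [mul_pow, inv_pow, f2, h, mul_inv_cancel]
      rcases tors _ this with h | h
      · right; right; left; exact mul_inv_eq_one.mp h
      · right; right; right; exact mul_inv_eq_iff_eq_mul.mp h
  have f4 : f ^ 4 = 1 := by rw [show 4 = 2 * 2 by rfl, pow_mul, f2, e2]
  classical
  have := four_odd ({1, e, f, e * f} : Finset (ClassGroup (𝓞 K))) ?_ ?_ ?_
  · rw [Nat.card_eq_fintype_card] at this
    exact this
  · have a1 : e * f ≠ e := by simpa using f1
    have a2 : e * f ≠ f := by simpa using e1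
    rw [Finset.card_insert_of_notMem, Finset.card_insert_of_notMem, Finset.card_insert_of_notMem, Finset.card_singleton]
    · simpa using a2.symm
    · simp [ef, a1.symm]
    · simp [e1.symm, f1.symm, ef1.symm]
  · intro g
    simp only [Finset.mem_insert, Finset.mem_singleton]
    constructor
    · have e4 : e ^ 4 = 1 := by rw [show 4 = 2 * 2 by rfl, pow_mul, e2, one_pow]
      rintro (h | h | h | h)
      · rw [h]; exact one_pow 4
      · rw [h]; exact e4
      · rw [h]; exact f4
      · rw [h, mul_pow, e4, f4, one_mul]
    · exact h4 g
  · intro g hg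
    have h1 : (g ^ 2) ^ 4 = 1 := by rw [← pow_mul]; exact hg
    have e4 : g ^ 4 = (g ^ 2) ^ 2 := by rw [← pow_mul]
    rcases h4 _ h1 with h | h | h | h
    · rw [e4, h, one_pow]
    · rw [e4, h, e2]
    · exfalso
      apply hgef g
      rw [h, mul_left_comm, ← pow_two, f2, ← pow_two, e2]
    · exfalso
      apply hgf g
      rw [h, mul_assoc, ← pow_two, f2, ← pow_two, e2]

end K4

section L1

variable {M : Type*} [Field M] [NumberField M] {d : ℤ} {w t : M}

/-- explicit description of the ring of integers of `ℚ(√2, √d)` over the (principal) ring `A = ℤ[√2]`. -/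
structure Bq (A : Type*) [CommRing A] (M : Type*) [Field M] [NumberField M] [Algebra A (𝓞 M)] (d : ℤ) (W T θ : 𝓞 M)
    (τ ρ : 𝓞 M ≃+* 𝓞 M) : Prop where
  hW : W ^ 2 = 2
  hT : T ^ 2 = d
  hθ : 2 * θ = 1 + T
  inv : InvSetup A (𝓞 M) τ θ
  τW : τ W = W
  τT : τ T = -T
  ρW : ρ W = -W
  ρT : ρ T = T
  rep : ∀ a : A, ∃ x y : ℤ, algebraMap A (𝓞 M) a = x + y * W
  mem : ∀ x y : ℤ, ∃ a : A, algebraMap A (𝓞 M) a = x + y * W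
  indep : ∀ a b c e : ℤ, (a : 𝓞 M) + b * W + (c + e * W) * T = 0 → a = 0 ∧ b = 0 ∧ c = 0 ∧ e = 0
  deg : Module.finrank ℚ M = 4

theorem IsBiq.indep (h : IsBiq M d w t) (a b c e : ℚ) (H : (a : M) + b * w + (c + e * w) * t = 0) : a = 0 ∧ b = 0 ∧ c = 0 ∧ e = 0 := by
  have hq := isQuad_w h.hw
  have h1 := h.isQuad.eq_zero (a := (a : ℚ⟮w⟯) + b * AdjoinSimple.gen ℚ w) (b := (c : ℚ⟮w⟯) + e * AdjoinSimple.gen ℚ w)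
    (by simp only [map_add, map_mul, map_ratCast]
        exact H)
  have h2 := hq.eq_zero (a := a) (b := b) (by simpa using h1.1)
  have h3 := hq.eq_zero (a := c) (b := e) (by simpa using h1.2)
  exact ⟨h2.1, h2.2, h3.1, h3.2⟩

theorem IsBiq.span4 (h : IsBiq M d w t) (x : M) : ∃ a b c e : ℚ, x = (a : M) + b * w + (c + e * w) * t := by
  obtain ⟨α, β, rfl⟩ := h.span x
  obtain ⟨a, b, rfl⟩ := (isQuad_w h.hw).span α
  obtain ⟨c, e, rfl⟩ := (isQuad_w h.hw).span β
  refine ⟨a, b, c, e, ?_⟩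
  simp

theorem IsBiq.exists_rho (h : IsBiq M d w t) : ∃ ρ : M ≃+* M, ρ w = -w ∧ ρ t = t := by
  have hq : IsQuad ℚ⟮t⟯ M (2 : ℚ⟮t⟯) w := by
    refine ⟨by rw [map_ofNat]; exact h.hw, ?_, ?_⟩
    · intro q hq
      obtain ⟨y, hy | hy⟩ := (isQuad_t h.ht h.hd1 h.hd).sq_eq (n := (2 : ℚ)) (x := q) (by simpa using hq)
      · exact rat_not_sq_two y hy
      · have h0 : (d : ℚ) ≠ 0 := by have := h.hd1; exact_mod_cast (by omega : d ≠ 0)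
        apply rat_not_sq_two_d h.hd h.hd8 (1 / y)
        have hy0 : y ≠ 0 := by rintro rfl; norm_num at hy
        field_simp
        linarith
    · intro x
      obtain ⟨a, b, c, e, rfl⟩ := h.span4 x
      refine ⟨(a : ℚ⟮t⟯) + c * AdjoinSimple.gen ℚ t, (b : ℚ⟮t⟯) + e * AdjoinSimple.gen ℚ t, ?_⟩
      simp only [map_add, map_mul, map_ratCast]
      change _ = (a : M) + c * t + (b + e * t) * w
      ring
  obtain ⟨σ, hσ⟩ := hq.exists_conj
  refine ⟨σ.toRingEquiv, ?_, ?_⟩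
  · simpa using hσ 0 1
  · exact σ.commutes (AdjoinSimple.gen ℚ t)

theorem IsBiq.int_span (h : IsBiq M d w t) {k : ℤ} (hk : d = 4 * k + 1) {W θ : 𝓞 M} (hW : algebraMap (𝓞 M) M W = w)
    (hθ : algebraMap (𝓞 M) M θ = (1 + t) / 2) (hW2 : W ^ 2 = 2) (hθ2 : θ ^ 2 = θ + k) (x : 𝓞 M) :
    ∃ a b c e : ℤ, x = a + b * W + (c + e * W) * θ := by
  let S : Subalgebra ℤ (𝓞 M) :=
    { carrier := {x | ∃ a b c e : ℤ, x = a + b * W + (c + e * W) * θ}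
      mul_mem' := by
        rintro _ _ ⟨a, b, c, e, rfl⟩ ⟨a', b', c', e', rfl⟩
        refine ⟨(a * a' + 2 * b * b') + k * (c * c' + 2 * e * e'), (a * b' + b * a') + k * (c * e' + e * c'),
          a * c' + 2 * b * e' + a' * c + 2 * b' * e + c * c' + 2 * e * e', a * e' + b * c' + a' * e + b' * c + c * e' + e * c', ?_⟩
        push_cast
        linear_combination (b * b' + b * e' * θ + b' * e * θ + e * e' * θ ^ 2) * hW2 + ((c * c' + 2 * e * e') + (c * e' + e * c') * W) * hθ2
      add_mem' := by
        rintro _ _ ⟨a, b, c, e, rfl⟩ ⟨a', b', c', e', rfl⟩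
        refine ⟨a + a', b + b', c + c', e + e', ?_⟩
        push_cast; ring
      algebraMap_mem' := fun r => ⟨r, 0, 0, 0, by simp⟩ }
  have hc : IsCoprime (discr ℚ⟮w⟯) (discr ℚ⟮t⟯) := by
    rw [discr_t h.ht h.hd1 h.hd8 h.hd, discr_w h.hw]
    exact coprime_two_pow_d h.hd8 3
  have hg : IsGalois ℚ ℚ⟮t⟯ := (isQuad_t h.ht h.hd1 h.hd).isGalois
  have hl : (ℚ⟮w⟯).LinearDisjoint ℚ⟮t⟯ := (linearDisjoint_of_isGalois_isCoprime_discr M ℚ⟮t⟯ ℚ⟮w⟯ hc.symm).symm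
  have htop : ℚ⟮w⟯ ⊔ ℚ⟮t⟯ = ⊤ := by
    rw [eq_top_iff]
    intro x _
    obtain ⟨a, b, rfl⟩ := h.span x
    refine add_mem ?_ (mul_mem ?_ ?_)
    · exact (le_sup_left : ℚ⟮w⟯ ≤ ℚ⟮w⟯ ⊔ ℚ⟮t⟯) a.2
    · exact (le_sup_left : ℚ⟮w⟯ ≤ ℚ⟮w⟯ ⊔ ℚ⟮t⟯) b.2
    · exact (le_sup_right : ℚ⟮t⟯ ≤ ℚ⟮w⟯ ⊔ ℚ⟮t⟯) (mem_adjoin_simple_self ℚ t)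
  have htop' : (ℚ⟮w⟯).toSubalgebra ⊔ (ℚ⟮t⟯).toSubalgebra = ⊤ := by
    simpa [sup_toSubalgebra_of_isAlgebraic_right] using congr_arg IntermediateField.toSubalgebra htop
  have key := IsDedekindDomain.range_sup_range_eq_top_of_isCoprime_differentIdeal ℤ (𝓞 M) (𝓞 ℚ⟮w⟯) (𝓞 ℚ⟮t⟯) hl htop'
    (isCoprime_differentIdeal_of_isCoprime_discr M hc)
  have hle : (⊤ : Subalgebra ℤ (𝓞 M)) ≤ S := by
    rw [← key]
    apply sup_le
    · rintro _ ⟨y, rfl⟩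
      obtain ⟨a, b, hy⟩ := (isQuad_w' h.hw).int_repr_23 Int.prime_two.squarefree (by norm_num) (RingOfIntegers.isIntegral_coe y)
      refine ⟨a, b, 0, 0, ?_⟩
      apply RingOfIntegers.ext
      change algebraMap (𝓞 M) M _ = algebraMap (𝓞 M) M _
      simp only [map_add, map_mul, map_intCast, hW]
      have := congrArg (algebraMap ℚ⟮w⟯ M) hy
      simp only [map_add, map_mul, map_intCast] at this
      simp
      exact this
    · rintro _ ⟨y, rfl⟩
      obtain ⟨a, b, hy⟩ := (isQuad_t h.ht h.hd1 h.hd).int_repr_1 h.hd (by have := h.hd8; omega) (RingOfIntegers.isIntegral_coe y)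
      refine ⟨a, 0, b, 0, ?_⟩
      apply RingOfIntegers.ext
      change algebraMap (𝓞 M) M _ = algebraMap (𝓞 M) M _
      simp only [map_add, map_mul, map_intCast, hθ]
      have := congrArg (algebraMap ℚ⟮t⟯ M) hy
      simp only [map_add, map_mul, map_intCast, map_div₀, map_one, map_ofNat] at this
      simp
      exact this
  exact hle (Algebra.mem_top (x := x))

end L1

section L2

variable {M : Type*} [Field M] [NumberField M] {d : ℤ} {w t : M}

theorem pid_w (hw : w ^ 2 = 2) : IsPrincipalIdealRing (𝓞 ℚ⟮w⟯) := by
  apply RingOfIntegers.isPrincipalIdealRing_of_abs_discr_lt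
  have hf := (isQuad_w hw).finrank_eq
  have hc : InfinitePlace.nrComplexPlaces ℚ⟮w⟯ = 0 ∨ InfinitePlace.nrComplexPlaces ℚ⟮w⟯ = 1 := by
    have := InfinitePlace.card_add_two_mul_card_eq_rank ℚ⟮w⟯
    rw [hf] at this
    omega
  rw [discr_w hw, hf]
  have h3 := Real.pi_gt_three
  rcases hc with h | h <;> rw [h] <;> norm_num [Nat.factorial]
  nlinarith

theorem IsBiq.exists_bq (h : IsBiq M d w t) : ∃ W T θ τ ρ, Bq (𝓞 ℚ⟮w⟯) M d W T θ τ ρ := by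
  obtain ⟨k, hk⟩ : ∃ k, d = 4 * k + 1 := ⟨d / 4, by have := h.hd8; omega⟩
  have hkM : (d : M) = 4 * k + 1 := by rw [hk]; push_cast; ring
  have e : ((1 + t) / 2) ^ 2 = ((1 + t) / 2) + (k : M) := by
    have := h.ht
    rw [hkM] at this
    field_simp; linear_combination this
  obtain ⟨W, hW⟩ := exists_ringOfIntegers (isIntegral_of_sq_int (r := w) (m := 2) (by simpa using h.hw))
  obtain ⟨T, hT⟩ := exists_ringOfIntegers (isIntegral_of_sq_int (r := t) (m := d) h.ht)
  obtain ⟨θ, hθ⟩ := exists_ringOfIntegers (isIntegral_half e)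
  obtain ⟨σ, hσ1, hσ2, hσ3⟩ := h.exists_sigma
  obtain ⟨r, hr1, hr2⟩ := h.exists_rho
  have hσw : σ w = w := hσ1 (AdjoinSimple.gen ℚ w)
  set τ := RingOfIntegers.mapRingEquiv σ with hτ
  set ρ := RingOfIntegers.mapRingEquiv r with hρ
  have hτa : ∀ x, algebraMap (𝓞 M) M (τ x) = σ (algebraMap (𝓞 M) M x) := fun x => rfl
  have hρa : ∀ x, algebraMap (𝓞 M) M (ρ x) = r (algebraMap (𝓞 M) M x) := fun x => rfl
  have ext : ∀ x y : 𝓞 M, algebraMap (𝓞 M) M x = algebraMap (𝓞 M) M y → x = y := fun x y h => RingOfIntegers.ext h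
  have hW2 : W ^ 2 = 2 := by
    apply ext; rw [map_pow, hW, h.hw, map_ofNat]
  have hT2 : T ^ 2 = d := by
    apply ext; rw [map_pow, hT, h.ht, map_intCast]
  have hθT : 2 * θ = 1 + T := by
    apply ext; rw [map_mul, map_ofNat, hθ, map_add, hT, map_one]; field_simp
  have hθ2 : θ ^ 2 = θ + k := by
    apply ext; rw [map_pow, hθ, map_add, hθ, e, map_intCast]
  have hτW : τ W = W := by apply ext; rw [hτa, hW, hσw]
  have hτT : τ T = -T := by apply ext; rw [hτa, map_neg, hT, hσ2]
  have hρW : ρ W = -W := by apply ext; rw [hρa, map_neg, hW, hr1]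
  have hρT : ρ T = T := by apply ext; rw [hρa, hT, hr2]
  have hrep : ∀ a : 𝓞 ℚ⟮w⟯, ∃ x y : ℤ, algebraMap (𝓞 ℚ⟮w⟯) (𝓞 M) a = x + y * W := by
    intro y
    obtain ⟨a, b, hy⟩ := (isQuad_w' h.hw).int_repr_23 Int.prime_two.squarefree (by norm_num) (RingOfIntegers.isIntegral_coe y)
    refine ⟨a, b, ?_⟩
    apply ext
    simp only [map_add, map_mul, map_intCast, hW]
    have := congrArg (algebraMap ℚ⟮w⟯ M) hy
    simp only [map_add, map_mul, map_intCast] at this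
    exact this
  have hmem : ∀ x y : ℤ, ∃ a : 𝓞 ℚ⟮w⟯, algebraMap (𝓞 ℚ⟮w⟯) (𝓞 M) a = x + y * W := by
    intro x y
    obtain ⟨W', hW'⟩ := exists_ringOfIntegers (isIntegral_of_sq_int (r := AdjoinSimple.gen ℚ w) (m := 2) (by simpa using (isQuad_w h.hw).sq))
    refine ⟨x + y * W', ?_⟩
    rw [map_add, map_mul, map_intCast, map_intCast]
    congr 2
    apply ext
    rw [hW]
    exact congrArg (algebraMap ℚ⟮w⟯ M) hW'
  have hindep : ∀ a b c e : ℤ, (a : 𝓞 M) + b * W + (c + e * W) * T = 0 → a = 0 ∧ b = 0 ∧ c = 0 ∧ e = 0 := by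
    intro a b c e H
    have := congrArg (algebraMap (𝓞 M) M) H
    simp only [map_add, map_mul, map_intCast, hW, hT, map_zero] at this
    have := h.indep a b c e (by push_cast; exact this)
    exact_mod_cast this
  refine ⟨W, T, θ, τ, ρ, hW2, hT2, hθT, ⟨?_, ?_, ?_, ?_, ?_⟩, hτW, hτT, hρW, hρT, hrep, hmem, hindep, ?_⟩
  · intro x; apply ext; rw [hτa, hτa, hσ3]
  · intro a
    obtain ⟨x, y, hxy⟩ := hrep a
    rw [hxy, map_add, map_mul, map_intCast, map_intCast, hτW]
  · exact FaithfulSMul.algebraMap_injective _ _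
  · intro x
    obtain ⟨a, b, c, e, hx⟩ := h.int_span hk hW hθ hW2 hθ2 x
    obtain ⟨α, hα⟩ := hmem a b
    obtain ⟨β, hβ⟩ := hmem c e
    exact ⟨α, β, by rw [hα, hβ, hx]⟩
  · intro hc
    have h2 : 2 * τ θ = 1 - T := by
      have := congrArg τ hθT
      rw [map_mul, map_ofNat, map_add, map_one, hτT] at this
      linear_combination this
    rw [hc] at h2
    have := hindep 0 0 1 0 (by
      have : 2 * T = 0 := by linear_combination h2 - hθT
      rcases mul_eq_zero.mp this with h | h
      · norm_num at h
      · simpa using h)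
    simp at this
  · rw [← Module.finrank_mul_finrank ℚ ℚ⟮w⟯ M, (isQuad_w h.hw).finrank_eq, h.isQuad.finrank_eq]

end L2

section L3

theorem norm_one_sq_pos {x y : ℤ} (hx : 0 < x) (h : x ^ 2 - 2 * y ^ 2 = 1) : ∃ a b : ℤ, x = a ^ 2 + 2 * b ^ 2 ∧ y = 2 * a * b := by
  have hx2 : x % 2 = 1 := by
    by_contra hc
    obtain ⟨k, hk⟩ : ∃ k, x = 2 * k := ⟨x / 2, by omega⟩
    rw [hk] at h
    have : 2 * (2 * k ^ 2 - y ^ 2) = 1 := by linear_combination h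
    omega
  obtain ⟨m, hm⟩ : ∃ m, x = 2 * m + 1 := ⟨x / 2, by omega⟩
  have hy : 2 * (m * (m + 1)) = y ^ 2 := by rw [hm] at h; linarith
  have hy2 : Even y := by
    have : Even (y ^ 2) := ⟨m * (m + 1), by rw [← hy]; ring⟩
    exact (Int.even_pow.mp this).1
  obtain ⟨z, hz⟩ := hy2
  have hz2 : m * (m + 1) = 2 * z ^ 2 := by rw [hz] at hy; linarith
  have hm0 : 0 ≤ m := by omega
  have fin : ∀ a b : ℤ, x = a ^ 2 + 2 * b ^ 2 → z ^ 2 = (a * b) ^ 2 → ∃ a b : ℤ, x = a ^ 2 + 2 * b ^ 2 ∧ y = 2 * a * b := by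
    intro a b h1 h2
    rcases sq_eq_sq_iff_eq_or_eq_neg.mp h2 with h | h
    · exact ⟨a, b, h1, by rw [hz, h]; ring⟩
    · exact ⟨a, -b, by rw [h1]; ring, by rw [hz, h]; ring⟩
  have key : ∀ k l : ℤ, 0 ≤ k → 0 ≤ l → IsCoprime k l → k * l = z ^ 2 → ∃ b a : ℤ, k = b ^ 2 ∧ l = a ^ 2 := by
    intro k l hk hl hc hkl
    obtain ⟨b, hb⟩ := Int.sq_of_isCoprime hc hkl
    obtain ⟨a, ha⟩ := Int.sq_of_isCoprime hc.symm (by rw [mul_comm]; exact hkl)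
    refine ⟨b, a, ?_, ?_⟩
    · rcases hb with h | h
      · exact h
      · nlinarith [sq_nonneg b]
    · rcases ha with h | h
      · exact h
      · nlinarith [sq_nonneg a]
  rcases Int.even_or_odd' m with ⟨k, hk | hk⟩
  · obtain ⟨b, a, hb, ha⟩ := key k (m + 1) (by omega) (by omega) ⟨-2, 1, by rw [hk]; ring⟩ (by rw [hk] at hz2 ⊢; linarith)
    refine fin a b (by rw [← ha, ← hb]; omega) (by rw [mul_pow, ← ha, ← hb]; rw [hk] at hz2 ⊢; linarith)
  · obtain ⟨b, a, hb, ha⟩ := key (k + 1) m (by omega) (by omega) ⟨2, -1, by rw [hk]; ring⟩ (by rw [hk] at hz2 ⊢; linarith)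
    refine fin a b (by rw [← ha, ← hb]; omega) (by rw [mul_pow, ← ha, ← hb]; rw [hk] at hz2 ⊢; linarith)

theorem norm_one_sq {x y : ℤ} (h : x ^ 2 - 2 * y ^ 2 = 1) : ∃ a b s : ℤ, (s = 1 ∨ s = -1) ∧ x = s * (a ^ 2 + 2 * b ^ 2) ∧ y = s * (2 * a * b) := by
  rcases lt_trichotomy x 0 with hx | hx | hx
  · obtain ⟨a, b, h1, h2⟩ := norm_one_sq_pos (x := -x) (y := -y) (by omega) (by linear_combination h)
    exact ⟨a, b, -1, Or.inr rfl, by omega, by linarith⟩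
  · subst hx; nlinarith [sq_nonneg y]
  · obtain ⟨a, b, h1, h2⟩ := norm_one_sq_pos hx h
    exact ⟨a, b, 1, Or.inl rfl, by omega, by linarith⟩

variable {A : Type*} [CommRing A] [IsDomain A] [IsPrincipalIdealRing A] {M : Type*} [Field M] [NumberField M] [Algebra A (𝓞 M)]
  {d : ℤ} {W T θ : 𝓞 M} {τ ρ : 𝓞 M ≃+* 𝓞 M}

namespace Bq

theorem fix_rep (S : Bq A M d W T θ τ ρ) {x : 𝓞 M} (h : τ x = x) : ∃ a b : ℤ, x = a + b * W := by
  obtain ⟨α, rfl⟩ := S.inv.fix h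
  exact S.rep α

theorem τform (S : Bq A M d W T θ τ ρ) (a b : ℤ) : τ (a + b * W) = a + b * W := by
  rw [map_add, map_mul, map_intCast, map_intCast, S.τW]

theorem ρform (S : Bq A M d W T θ τ ρ) (a b : ℤ) : ρ (a + b * W) = a - b * W := by
  rw [map_add, map_mul, map_intCast, map_intCast, S.ρW]; ring

theorem τθ (S : Bq A M d W T θ τ ρ) : τ θ = 1 - θ := by
  have h := congrArg τ S.hθ
  rw [map_mul, map_ofNat, map_add, map_one, S.τT] at h
  apply mul_left_cancel₀ (two_ne_zero (α := 𝓞 M))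
  linear_combination h + S.hθ

theorem ρθ (S : Bq A M d W T θ τ ρ) : ρ θ = θ := by
  have h := congrArg ρ S.hθ
  rw [map_mul, map_ofNat, map_add, map_one, S.ρT] at h
  apply mul_left_cancel₀ (two_ne_zero (α := 𝓞 M))
  linear_combination h - S.hθ

theorem gen4 (S : Bq A M d W T θ τ ρ) (x : 𝓞 M) : ∃ a b c e : ℤ, x = a + b * W + (c + e * W) * θ := by
  obtain ⟨α, β, rfl⟩ := S.inv.gen x
  obtain ⟨a, b, h1⟩ := S.rep α
  obtain ⟨c, e, h2⟩ := S.rep β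
  exact ⟨a, b, c, e, by rw [h1, h2]⟩

theorem ρρ (S : Bq A M d W T θ τ ρ) (x : 𝓞 M) : ρ (ρ x) = x := by
  obtain ⟨a, b, c, e, rfl⟩ := S.gen4 x
  simp only [map_add, map_mul, map_intCast, S.ρW, S.ρθ, map_neg, neg_neg]

theorem comm (S : Bq A M d W T θ τ ρ) (x : 𝓞 M) : ρ (τ x) = τ (ρ x) := by
  obtain ⟨a, b, c, e, rfl⟩ := S.gen4 x
  simp only [map_add, map_mul, map_intCast, S.ρW, S.ρθ, S.τW, S.τθ, map_neg, map_sub, map_one]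

theorem indep2 (S : Bq A M d W T θ τ ρ) {a b a' b' : ℤ} (h : (a : 𝓞 M) + b * W = a' + b' * W) : a = a' ∧ b = b' := by
  have := S.indep (a - a') (b - b') 0 0 (by push_cast; linear_combination h)
  omega

/-- elements fixed by ρ -/
theorem ρfix (S : Bq A M d W T θ τ ρ) {x : 𝓞 M} (h : ρ x = x) : ∃ a c : ℤ, 2 * x = a + c * T := by
  obtain ⟨a, b, c, e, rfl⟩ := S.gen4 x
  simp only [map_add, map_mul, map_intCast, S.ρW, S.ρθ] at h
  have h2 : ((0 : ℤ) : 𝓞 M) + ((2 * b + e : ℤ) : 𝓞 M) * W + (((0 : ℤ) : 𝓞 M) + (e : 𝓞 M) * W) * T = 0 := by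
    push_cast; linear_combination - h - e * W * S.hθ
  obtain ⟨-, h3, -, h4⟩ := S.indep _ _ _ _ h2
  have hb : b = 0 := by omega
  subst h4 hb
  exact ⟨2 * a + c, c, by push_cast; linear_combination c * S.hθ⟩

theorem T_ne (S : Bq A M d W T θ τ ρ) : T ≠ 0 := by
  intro h
  have := S.indep 0 0 1 0 (by rw [h]; simp)
  simp at this

theorem norm_fixed (S : Bq A M d W T θ τ ρ) (x : 𝓞 M) : ∃ a b : ℤ, x * τ x = a + b * W :=
  S.fix_rep (by rw [map_mul, S.inv.inv, mul_comm])

/-- relative norm of units -/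
theorem unit_norm (S : Bq A M d W T θ τ ρ) {a b : ℤ} (h : IsUnit ((a : 𝓞 M) + b * W)) : a ^ 2 - 2 * b ^ 2 = 1 ∨ a ^ 2 - 2 * b ^ 2 = -1 := by
  obtain ⟨u, hu⟩ := h.exists_right_inv
  have hfix : τ u = u := by
    have h1 := congrArg τ hu
    rw [map_mul, S.τform, map_one] at h1
    exact mul_left_cancel₀ h.ne_zero (h1.trans hu.symm)
  obtain ⟨a', b', rfl⟩ := S.fix_rep hfix
  have h1 := congrArg ρ hu
  rw [map_mul, S.ρform, S.ρform, map_one] at h1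
  have h2 : (((a ^ 2 - 2 * b ^ 2) * (a' ^ 2 - 2 * b' ^ 2) : ℤ) : 𝓞 M) = ((1 : ℤ) : 𝓞 M) := by
    push_cast
    have e : ∀ x y : 𝓞 M, x ^ 2 - 2 * y ^ 2 = (x + y * W) * (x - y * W) := by
      intro x y; linear_combination y ^ 2 * S.hW
    rw [e, e]
    linear_combination hu * ((a : 𝓞 M) - b * W) * (a' - b' * W) + h1
  have h3 := Int.cast_injective h2
  exact Int.isUnit_iff.mp (IsUnit.of_mul_eq_one _ h3)

/-- no relative norm `η n²` with `N η = -1` -/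
def Neg (_S : Bq A M d W T θ τ ρ) : Prop := ∀ (γ : 𝓞 M) (x y a b : ℤ), a ^ 2 - 2 * b ^ 2 = -1 → γ ≠ 0 →
  γ * τ γ = (a + b * W) * (x + y * W) ^ 2 → False

theorem unit_sq (S : Bq A M d W T θ τ ρ) (hN : S.Neg) {γ : 𝓞 M} (x y a b : ℤ) (hγ : γ ≠ 0) (hu : IsUnit ((a : 𝓞 M) + b * W))
    (h : γ * τ γ = (a + b * W) * (x + y * W) ^ 2) : ∃ a' b' : ℤ, IsUnit ((a' : 𝓞 M) + b' * W) ∧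
      ((a : 𝓞 M) + b * W = (a' + b' * W) ^ 2 ∨ (a : 𝓞 M) + b * W = - (a' + b' * W) ^ 2) := by
  rcases S.unit_norm hu with h1 | h1
  · obtain ⟨a', b', s, hs, h2, h3⟩ := norm_one_sq h1
    have e : ((a' : 𝓞 M) + b' * W) ^ 2 = ((a' ^ 2 + 2 * b' ^ 2 : ℤ) : 𝓞 M) + ((2 * a' * b' : ℤ) : 𝓞 M) * W := by
      push_cast; linear_combination b' ^ 2 * S.hW
    refine ⟨a', b', ?_, ?_⟩
    · have : IsUnit (((a' : 𝓞 M) + b' * W) ^ 2) := by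
        rw [e]
        rcases hs with rfl | rfl
        · rw [h2, h3, one_mul, one_mul] at hu; exact hu
        · rw [h2, h3] at hu
          rw [← IsUnit.neg_iff]
          convert hu using 1
          push_cast; ring
      exact (isUnit_pow_iff two_ne_zero).mp this
    · rw [e, h2, h3]
      rcases hs with rfl | rfl
      · left; push_cast; ring
      · right; push_cast; ring
  · exact (hN γ x y a b h1 hγ h).elim

end Bq

end L3

section L4

variable {A : Type*} [CommRing A] [IsDomain A] [IsPrincipalIdealRing A] {M : Type*} [Field M] [NumberField M] [Algebra A (𝓞 M)]
  {d : ℤ} {W T θ : 𝓞 M} {τ ρ : 𝓞 M ≃+* 𝓞 M}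

namespace Bq

theorem diff (S : Bq A M d W T θ τ ρ) : θ - τ θ = T := by
  rw [S.τθ]; linear_combination S.hθ

theorem odd (S : Bq A M d W T θ τ ρ) (hN : S.Neg) {u : 𝓞 M} (hu : u * τ u = -1)
    (hP : ∀ P : Ideal (𝓞 M), P.IsPrime → P ≠ ⊥ → T ∈ P → P.IsPrincipal) : Odd (classNumber M) := by
  have huu : IsUnit u := IsUnit.of_mul_eq_one (-τ u) (by linear_combination - hu)
  have main : ∀ c : ClassGroup (𝓞 M), c ^ 2 = 1 → c = 1 := by
    intro c hc
    obtain ⟨⟨I, hI⟩, rfl⟩ := ClassGroup.mk0_surjective c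
    have hI0 := nonZeroDivisors.ne_zero hI
    rw [pow_two, ← map_mul] at hc
    have hp : (I * I).IsPrincipal := by
      rwa [← ClassGroup.mk0_eq_one_iff (mul_mem hI hI)]
    obtain ⟨γ, hγ⟩ := hp
    have hγ : I * I = Ideal.span {γ} := hγ
    have hγ0 : γ ≠ 0 := by
      rintro rfl
      exact (mul_ne_zero hI0 hI0) (by rw [hγ]; simp)
    obtain ⟨n, hn⟩ := S.inv.norm_ideal I
    obtain ⟨x, y, hxy⟩ := S.rep n
    have hn0 : algebraMap A (𝓞 M) n ≠ 0 := by
      intro h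
      have : I * I.map τ ≠ 0 := mul_ne_zero hI0 (S.inv.map_ne_bot hI0)
      apply this; rw [hn, h]; simp
    have h3 : Ideal.span {algebraMap A (𝓞 M) n ^ 2} = Ideal.span {γ * τ γ} := by
      rw [← Ideal.span_singleton_mul_span_singleton, ← S.inv.map_span, ← hγ, Ideal.map_mul, mul_mul_mul_comm, hn,
        Ideal.span_singleton_mul_span_singleton, pow_two]
    obtain ⟨η, hη⟩ := Ideal.span_singleton_eq_span_singleton.mp h3
    have hηfix : τ (η : 𝓞 M) = η := by
      have h := congrArg τ hη
      rw [map_mul, map_mul, map_pow, S.inv.com, S.inv.inv, mul_comm (τ γ), ← hη] at h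
      exact mul_left_cancel₀ (pow_ne_zero 2 hn0) h
    obtain ⟨a, b, hab⟩ := S.fix_rep hηfix
    obtain ⟨a', b', hunit, hsq⟩ := S.unit_sq hN (γ := γ) x y a b hγ0 (hab ▸ η.isUnit) (by rw [← hab, ← hxy, ← hη, mul_comm])
    rw [← hab] at hsq
    obtain ⟨μ, hμ⟩ := S.mem a' b'
    rw [← hμ] at hunit hsq
    have hn' : I * I.map τ = Ideal.span {algebraMap A (𝓞 M) (n * μ)} := by
      rw [hn, map_mul, Ideal.span_singleton_mul_right_unit hunit]
    have hn0' : n * μ ≠ 0 := by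
      intro h
      have := mul_ne_zero hn0 hunit.ne_zero
      rw [← map_mul, h, map_zero] at this
      exact this rfl
    have hH : ∀ P : Ideal (𝓞 M), P.IsPrime → ∀ h0 : P ≠ ⊥, θ - τ θ ∈ P →
        ClassGroup.mk0 ⟨P, mem_nonZeroDivisors_of_ne_zero h0⟩ ∈ (⊥ : Subgroup (ClassGroup (𝓞 M))) := by
      intro P h1 h2 h3
      rw [Subgroup.mem_bot, ClassGroup.mk0_eq_one_iff]
      rw [S.diff] at h3
      exact hP P h1 h2 h3
    rcases hsq with hsq | hsq
    · have := S.inv.class_mem ⊥ hH T S.τT S.T_ne hI hn0' hγ hn' (by rw [← hη, hsq, map_mul]; ring)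
      simpa using this
    · have := S.inv.class_mem ⊥ hH T S.τT S.T_ne hI (γ := γ * u) hn0' (by rw [hγ, Ideal.span_singleton_mul_right_unit huu]) hn' (by
        rw [hsq] at hη
        rw [map_mul, map_mul]
        linear_combination γ * τ γ * hu + hη)
      simpa using this
  rw [← Nat.not_even_iff_odd, even_iff_two_dvd]
  intro h
  obtain ⟨c, hc⟩ := exists_prime_orderOf_dvd_card (G := ClassGroup (𝓞 M)) 2 h
  have h1 := main c (by rw [← hc, pow_orderOf_eq_one])
  rw [h1, orderOf_one] at hc
  omega

/-- the case `d = p q` -/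
theorem neg_pq (S : Bq A M d W T θ τ ρ) {p q : ℕ} (hp : p.Prime) (hq : q.Prime) (h8 : p % 8 = 3) (hpq : p ≠ q) (hd : d = p * q) : S.Neg := by
  intro γ x y a b hab hγ h
  have hΓ : ρ (γ * ρ γ) = γ * ρ γ := by rw [map_mul, S.ρρ, mul_comm]
  obtain ⟨X, Y, hXY⟩ := S.ρfix hΓ
  have h2 := congrArg ρ h
  rw [map_mul, map_mul, map_pow, S.ρform, S.ρform, S.comm] at h2
  have h4 := congrArg τ hXY
  simp only [map_mul, map_add, map_intCast, map_ofNat, S.τT] at h4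
  have e : ∀ x y : 𝓞 M, (x + y * W) * (x - y * W) = x ^ 2 - 2 * y ^ 2 := by
    intro x y; linear_combination -y ^ 2 * S.hW
  have hab' : ((a : 𝓞 M) ^ 2 - 2 * b ^ 2) = -1 := by exact_mod_cast congrArg (Int.cast : ℤ → 𝓞 M) hab
  have h5 : ((X ^ 2 + (2 * (x ^ 2 - 2 * y ^ 2)) ^ 2 : ℤ) : 𝓞 M) = ((p * q * Y ^ 2 : ℤ) : 𝓞 M) := by
    have hT := S.hT
    rw [hd] at hT
    push_cast at hT ⊢
    have e1 : ((X : 𝓞 M) + Y * T) * (X - Y * T) = 4 * ((γ * τ γ) * (ρ γ * τ (ρ γ))) := by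
      rw [← hXY, sub_eq_add_neg, ← mul_neg, ← h4]; ring
    rw [h, h2] at e1
    have e2 := e a b
    have e3 := e x y
    rw [hab'] at e2
    rw [← e3]
    linear_combination e1 + Y ^ 2 * hT + 4 * ((x + y * W) * (x - y * W)) ^ 2 * e2
  have h6 : X ^ 2 + (2 * (x ^ 2 - 2 * y ^ 2)) ^ 2 = p * q * Y ^ 2 := Int.cast_injective h5
  have hm : x ^ 2 - 2 * y ^ 2 ≠ 0 := by
    intro h0
    have e3 := e x y
    have h0' : ((x : 𝓞 M) ^ 2 - 2 * y ^ 2) = 0 := by exact_mod_cast congrArg (Int.cast : ℤ → 𝓞 M) h0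
    rw [h0'] at e3
    have h7 : (γ * τ γ) * (ρ γ * τ (ρ γ)) = 0 := by
      rw [h, h2]; linear_combination (a + b * W) * (a - b * W) * ((x + y * W) * (x - y * W)) * e3
    simp only [mul_eq_zero, EmbeddingLike.map_eq_zero_iff, hγ, or_self] at h7
  have hY : Y ≠ 0 := by
    rintro rfl
    have : (2 * (x ^ 2 - 2 * y ^ 2)) ^ 2 > 0 := by positivity
    nlinarith [sq_nonneg X]
  have h7 := (Nat.eq_sq_add_sq_iff (n := p * q * Y.natAbs ^ 2)).mp ⟨X.natAbs, (2 * (x ^ 2 - 2 * y ^ 2)).natAbs, by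
    zify; rw [sq_abs, sq_abs, sq_abs, h6]⟩
  have hY' : Y.natAbs ≠ 0 := by omega
  have h8 := h7 (q := p) (by
    rw [Nat.mem_primeFactors]
    exact ⟨hp, ⟨q * Y.natAbs ^ 2, by ring⟩, by have := hp.ne_zero; have := hq.ne_zero; positivity⟩) (by omega)
  haveI := Fact.mk hp
  rw [padicValNat.mul (mul_ne_zero hp.ne_zero hq.ne_zero) (pow_ne_zero 2 hY'), padicValNat.mul hp.ne_zero hq.ne_zero, padicValNat.pow,
    padicValNat_self, padicValNat.eq_zero_of_not_dvd (fun h => hpq ((Nat.prime_dvd_prime_iff_eq hp hq).mp h))] at h8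
  rw [Nat.even_iff] at h8
  omega

end Bq

end L4

section L5

variable {A : Type*} [CommRing A] [IsDomain A] [IsPrincipalIdealRing A] {M : Type*} [Field M] [NumberField M] [Algebra A (𝓞 M)]
  {d : ℤ} {W T θ : 𝓞 M} {τ ρ : 𝓞 M ≃+* 𝓞 M}

theorem quot_equiv {p : ℕ} (hp : p.Prime) {P : Ideal (𝓞 M)} (h : Ideal.absNorm P = p) : Nonempty (ZMod p ≃+* (𝓞 M ⧸ P)) := by
  have hc : Nat.card (𝓞 M ⧸ P) = p := by rw [← h]; rfl
  haveI : Finite (𝓞 M ⧸ P) := Nat.finite_of_card_ne_zero (by rw [hc]; exact hp.ne_zero)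
  haveI := Fintype.ofFinite (𝓞 M ⧸ P)
  rw [Nat.card_eq_fintype_card] at hc
  exact ⟨ZMod.ringEquivOfPrime _ hp hc⟩

namespace Bq

theorem prin (S : Bq A M d W T θ τ ρ) {p q : ℕ} (hp : p.Prime) (h8 : p % 8 = 3) (hd : d = p * q) {x y s : ℤ} (hs : s = 1 ∨ s = -1)
    (h : p * x ^ 2 - q * y ^ 2 = s) {P : Ideal (𝓞 M)} (hP : P.IsPrime) (hT : T ∈ P) (hpP : (p : 𝓞 M) ∈ P) : P.IsPrincipal := by
  have hT2 := S.hT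
  rw [hd] at hT2
  push_cast at hT2
  have hmem : (p * x + y * T : 𝓞 M) ∈ P := P.add_mem (P.mul_mem_right _ hpP) (P.mul_mem_left _ hT)
  have hn : Ideal.absNorm (Ideal.span {(p * x + y * T : 𝓞 M)}) = p ^ 2 := by
    have h1 := absNorm_conj τ (p * x + y * T : 𝓞 M)
    have h2 : (p * x + y * T : 𝓞 M) * τ (p * x + y * T : 𝓞 M) = ((p * s : ℤ) : 𝓞 M) := by
      simp only [map_add, map_mul, map_natCast, map_intCast, S.τT]
      rw [← h]; push_cast; linear_combination -y ^ 2 * hT2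
    rw [h2, absNorm_int, S.deg, Int.natAbs_mul, Int.natAbs_natCast, show s.natAbs = 1 by omega, mul_one] at h1
    exact Nat.pow_left_injective (n := 2) (by norm_num) (by simp only [h1]; ring)
  obtain ⟨J, hJ⟩ := Ideal.dvd_iff_le.mpr ((Ideal.span_singleton_le_iff_mem P).mpr hmem)
  have hJ2 := congrArg Ideal.absNorm hJ
  rw [map_mul, hn] at hJ2
  obtain ⟨k, hk, hk2⟩ := (Nat.dvd_prime_pow hp).mp ⟨_, hJ2⟩
  interval_cases k
  · rw [pow_zero, Ideal.absNorm_eq_one_iff] at hk2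
    exact (hP.ne_top hk2).elim
  · rw [pow_one] at hk2
    obtain ⟨f⟩ := quot_equiv hp hk2
    haveI := Fact.mk hp
    have : IsSquare (2 : ZMod p) := by
      refine ⟨f.symm (Ideal.Quotient.mk P W), ?_⟩
      rw [← map_mul, ← map_mul, ← pow_two, S.hW, map_ofNat, map_ofNat]
    rw [ZMod.exists_sq_eq_two_iff (by rintro rfl; omega)] at this
    omega
  · rw [hk2] at hJ2
    have h1 : Ideal.absNorm J = 1 := by
      have : p ^ 2 ≠ 0 := pow_ne_zero 2 hp.ne_zero
      exact mul_left_cancel₀ this (by rw [← hJ2, mul_one])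
    rw [Ideal.absNorm_eq_one_iff] at h1
    rw [h1, Ideal.mul_top] at hJ
    exact ⟨_, hJ.symm⟩

theorem odd_pq (S : Bq A M d W T θ τ ρ) {p q : ℕ} (hp : p.Prime) (hq : q.Prime) (h8 : p % 8 = 3) (h8' : q % 8 = 3) (hpq : p ≠ q)
    (hd : d = p * q) : Odd (classNumber M) := by
  have hT2 := S.hT
  rw [hd] at hT2
  push_cast at hT2
  obtain ⟨x, y, hxy⟩ := pell_2pq hp hq h8 h8' hpq
  refine S.odd (S.neg_pq hp hq h8 hpq hd) (u := x * W + y * T) ?_ ?_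
  · have : ((2 * x ^ 2 - p * q * y ^ 2 : ℤ) : 𝓞 M) = ((-1 : ℤ) : 𝓞 M) := by rw [hxy]
    push_cast at this
    simp only [map_add, map_mul, map_intCast, S.τT, S.τW]
    linear_combination this + x ^ 2 * S.hW - y ^ 2 * hT2
  · intro P hP h0 hT
    have h1 : (p : 𝓞 M) * q ∈ P := by rw [← hT2]; exact P.pow_mem_of_mem hT 2 (by norm_num)
    obtain ⟨x, y, h⟩ := pell_pq hp hq h8 h8' hpq
    rcases hP.mem_or_mem h1 with h2 | h2
    · rcases h with h | h
      · exact S.prin hp h8 hd (Or.inl rfl) h hP hT h2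
      · exact S.prin hp h8 hd (Or.inr rfl) h hP hT h2
    · rcases h with h | h
      · exact S.prin hq h8' (by rw [hd, mul_comm]) (x := y) (y := x) (Or.inr rfl) (by linear_combination -h) hP hT h2
      · exact S.prin hq h8' (by rw [hd, mul_comm]) (x := y) (y := x) (Or.inl rfl) (by linear_combination -h) hP hT h2

end Bq

end L5

section L6

theorem nonsq {p : ℕ} [hp : Fact p.Prime] (h16 : p % 16 = 9) (hx : ∃ z : ZMod p, z ^ 4 = 2) {r : ZMod p} (hr : r ^ 2 = 2) (m : ZMod p)
    (h : 1 + r = m ^ 2) : False := by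
  obtain ⟨z, hz⟩ := hx
  have h2 : (2 : ZMod p) ≠ 0 := by
    intro h
    have : ((2 : ℕ) : ZMod p) = 0 := by exact_mod_cast h
    rw [ZMod.natCast_eq_zero_iff] at this
    have := (Nat.prime_dvd_prime_iff_eq hp.out Nat.prime_two).mp this
    omega
  obtain ⟨i, hi⟩ := ZMod.exists_sq_eq_neg_one_iff (p := p) |>.mpr (by omega)
  have hrk : ∃ k, r = k ^ 2 := by
    have : r ^ 2 = (z ^ 2) ^ 2 := by rw [hr, ← hz]; ring
    rcases sq_eq_sq_iff_eq_or_eq_neg.mp this with h | h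
    · exact ⟨z, h⟩
    · exact ⟨i * z, by rw [h]; linear_combination z ^ 2 * hi⟩
  obtain ⟨k, hk⟩ := hrk
  have hr0 : r ≠ 0 := by rintro rfl; apply h2; rw [← hr]; ring
  have hk0 : k ≠ 0 := by rintro rfl; apply hr0; rw [hk]; ring
  have hm0 : m ≠ 0 := by
    rintro rfl
    have h3 : r = -1 := by linear_combination h
    rw [h3] at hr
    have : (1 : ZMod p) = 0 := by linear_combination -hr
    exact one_ne_zero this
  set ζ : ZMod p := r * (1 + i) / 2 with hζ
  have hζ2 : 2 * ζ = r * (1 + i) := by rw [hζ]; field_simp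
  have hζi : ζ ^ 2 = i := by
    apply mul_left_cancel₀ (pow_ne_zero 2 h2)
    linear_combination (2 * ζ + r * (1 + i)) * hζ2 + (1 + i) ^ 2 * hr - 2 * hi
  clear_value ζ
  have h1 : (1 + ζ) ^ 2 = ζ * k ^ 2 * m ^ 2 := by
    rw [← hk, ← h]
    apply mul_left_cancel₀ h2
    linear_combination 2 * hζi + (2 - r - r ^ 2) * hζ2 - (r + r * i + 1 + i) * hr
  set s := (1 + ζ) / (k * m) with hs
  have hs2 : s ^ 2 = ζ := by rw [hs]; field_simp; linear_combination h1
  have hs8 : s ^ 8 = -1 := by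
    rw [show s ^ 8 = (s ^ 2) ^ 4 by ring, hs2, show ζ ^ 4 = (ζ ^ 2) ^ 2 by ring, hζi]; linear_combination -hi
  have hs0 : s ≠ 0 := by
    intro h0; rw [h0] at hs8
    have : (1 : ZMod p) = 0 := by linear_combination hs8
    exact one_ne_zero this
  have h3 := ZMod.pow_card_sub_one_eq_one hs0
  obtain ⟨j, hj⟩ : ∃ j, p - 1 = 8 * (2 * j + 1) := ⟨p / 16, by omega⟩
  rw [hj, pow_mul, hs8, pow_succ, pow_mul] at h3
  norm_num at h3
  apply h2
  linear_combination -h3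

/-- evaluation of `ℤ[√2]` modulo a prime above `p` -/
theorem zs_desc {p : ℕ} (hp : p.Prime) (h16 : p % 16 = 9) (hz : ∃ z : ZMod p, z ^ 4 = 2) {a x : ℤ} (hax : p + x ^ 2 = 2 * a ^ 2)
    (hpa : ¬ (p : ℤ) ∣ a) (hpx : ¬ (p : ℤ) ∣ x) {η : ℤ√2} (hη : η.re ^ 2 - 2 * η.im ^ 2 = -1) (N : ℕ) :
    ∀ g β n : ℤ√2, g ^ 2 - (p : ℤ√2) * β ^ 2 = η * n ^ 2 → n.norm.natAbs ≤ N → n.norm = 0 := by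
  haveI := Fact.mk hp
  have ha0 : (a : ZMod p) ≠ 0 := by rwa [Ne, ZMod.intCast_zmod_eq_zero_iff_dvd]
  obtain ⟨r, hr⟩ : ∃ r : ZMod p, (x : ZMod p) + a * r = 0 := ⟨-x / a, by field_simp; ring⟩
  have hax' : (x : ZMod p) ^ 2 = 2 * a ^ 2 := by
    have := congrArg (Int.cast : ℤ → ZMod p) hax
    push_cast at this
    rw [ZMod.natCast_self, zero_add] at this
    exact this
  have hr2 : r ^ 2 = 2 := by
    apply mul_left_cancel₀ (pow_ne_zero 2 ha0)
    linear_combination (a * r - x) * hr + hax'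
  set φ : ℤ√2 →+* ZMod p := Zsqrtd.lift ⟨r, by rw [← pow_two, hr2]; norm_num⟩ with hφ
  have φdef : ∀ z : ℤ√2, φ z = z.re + z.im * r := fun z => by rw [hφ]; rfl
  have hφη : ∀ m, φ η ≠ m ^ 2 := by
    intro m hm
    obtain ⟨a', b', s, hs, h1, h2⟩ := norm_one_sq (x := 2 * η.im - η.re) (y := η.re - η.im) (by linear_combination -hη)
    obtain ⟨i, hi⟩ := ZMod.exists_sq_eq_neg_one_iff (p := p) |>.mpr (by omega)
    have h1' : (2 * η.im - η.re : ZMod p) = s * (a' ^ 2 + 2 * b' ^ 2) := by exact_mod_cast congrArg (Int.cast : ℤ → ZMod p) h1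
    have h2' : (η.re - η.im : ZMod p) = s * (2 * a' * b') := by exact_mod_cast congrArg (Int.cast : ℤ → ZMod p) h2
    rw [φdef] at hm
    have h3 : m ^ 2 = (1 + r) * (s * (a' + b' * r) ^ 2) := by
      rw [← hm]
      linear_combination (1 + r) * h1' + (1 + r) * r * h2' - (η.re - η.im + s * b' ^ 2 * (1 + r)) * hr2
    have h0 : (s : ZMod p) * (a' + b' * r) ^ 2 ≠ 0 := by
      intro h0
      have e : ((2 * η.im - η.re : ZMod p) + (η.re - η.im) * r) * ((2 * η.im - η.re : ZMod p) - (η.re - η.im) * r) = 1 := by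
        have hη' : (η.re ^ 2 - 2 * η.im ^ 2 : ZMod p) = -1 := by exact_mod_cast congrArg (Int.cast : ℤ → ZMod p) hη
        linear_combination -hη' - (η.re - η.im : ZMod p) ^ 2 * hr2
      have e2 : ((2 * η.im - η.re : ZMod p) + (η.re - η.im) * r) = s * (a' + b' * r) ^ 2 := by
        linear_combination h1' + r * h2' - s * b' ^ 2 * hr2
      rw [e2, h0, zero_mul] at e
      exact zero_ne_one e
    rcases hs with rfl | rfl
    · push_cast at h0 h3
      rw [one_mul] at h0 h3
      have h4 : (a' + b' * r : ZMod p) ≠ 0 := by intro h; apply h0; rw [h]; ring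
      generalize (a' + b' * r : ZMod p) = c at h3 h4
      exact nonsq h16 hz hr2 (m / c) (by field_simp; linear_combination -h3)
    · push_cast at h0 h3
      have h4 : (a' + b' * r : ZMod p) ≠ 0 := by intro h; apply h0; rw [h]; ring
      generalize (a' + b' * r : ZMod p) = c at h3 h4
      exact nonsq h16 hz hr2 (i * m / c) (by field_simp; linear_combination -(1 + r) * c ^ 2 * hi  - i ^ 2 * h3)
  have hp0 : (p : ℤ) ≠ 0 := by exact_mod_cast hp.ne_zero
  have hpp : Prime (p : ℤ) := Nat.prime_iff_prime_int.mp hp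
  have hdvd : ∀ z : ℤ√2, φ z = 0 → ∃ z', z = (⟨x, a⟩ : ℤ√2) * z' := by
    intro z hz
    rw [φdef] at hz
    have h1 : (p : ℤ) ∣ a * z.re - x * z.im := by
      rw [← ZMod.intCast_zmod_eq_zero_iff_dvd]; push_cast
      linear_combination a * hz - z.im * hr
    have h2 : (p : ℤ) ∣ x * z.re - 2 * a * z.im := by
      have : (p : ℤ) ∣ x * (x * z.re - 2 * a * z.im) := by
        have e : x * (x * z.re - 2 * a * z.im) = 2 * a * (a * z.re - x * z.im) - p * z.re := by linear_combination z.re * hax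
        rw [e]
        exact dvd_sub (h1.mul_left _) (dvd_mul_right _ _)
      exact (hpp.dvd_or_dvd this).resolve_left hpx
    obtain ⟨k, hk⟩ := h1
    obtain ⟨l, hl⟩ := h2
    refine ⟨⟨-l, k⟩, ?_⟩
    have e1 : p * z.re = p * (a * 2 * k - x * l) := by linear_combination 2 * a * hk - x * hl + z.re * hax
    have e2 : p * z.im = p * (x * k - a * l) := by linear_combination x * hk - a * hl + z.im * hax
    ext
    · simp only [Zsqrtd.re_mul]; rw [mul_left_cancel₀ hp0 e1]; ring
    · simp only [Zsqrtd.im_mul]; rw [mul_left_cancel₀ hp0 e2]; ring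
  have hπ : (⟨x, a⟩ : ℤ√2) * ⟨x, -a⟩ = -(p : ℤ√2) := by
    ext
    · simp; linear_combination hax
    · simp; ring
  have hcan : ∀ z : ℤ√2, (⟨x, a⟩ : ℤ√2) * z = 0 → z = 0 := by
    intro z h
    have h1 : (p : ℤ√2) * z = 0 := by linear_combination z * hπ - ⟨x, -a⟩ * h
    have h2 := congrArg Zsqrtd.re h1
    have h3 := congrArg Zsqrtd.im h1
    simp [hp.ne_zero] at h2 h3
    ext
    · simpa using h2
    · simpa using h3
  have hφπ : φ ⟨x, a⟩ = 0 := by rw [φdef]; exact hr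
  have hφp : φ (p : ℤ√2) = 0 := by rw [map_natCast, ZMod.natCast_self]
  have hφπ' : φ ⟨x, -a⟩ ≠ 0 := by
    rw [φdef]; push_cast
    intro h
    have h2 : (2 * x : ZMod p) = 0 := by linear_combination h + hr
    have h3 : (p : ℤ) ∣ 2 * x := by rw [← ZMod.intCast_zmod_eq_zero_iff_dvd]; push_cast; exact h2
    rcases hpp.dvd_or_dvd h3 with h | h
    · have := Int.le_of_dvd (by norm_num) h
      omega
    · exact hpx h
  induction N with
  | zero =>
    intro g β n _ h
    omega
  | succ N ih =>
    intro g β n h hn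
    have h1 := congrArg φ h
    rw [map_sub, map_mul, map_mul, map_pow, map_pow, map_pow, hφp, zero_mul, sub_zero] at h1
    have hn0 : φ n = 0 := by
      by_contra h0
      exact hφη (φ g / φ n) (by field_simp; exact h1.symm)
    have hg0 : φ g = 0 := by
      rw [hn0] at h1; simpa using h1
    obtain ⟨n', rfl⟩ := hdvd n hn0
    obtain ⟨g', rfl⟩ := hdvd g hg0
    have h2 : φ β = 0 := by
      have e : (⟨x, a⟩ : ℤ√2) * (⟨x, a⟩ * g' ^ 2 + ⟨x, -a⟩ * β ^ 2 - η * (⟨x, a⟩ * n' ^ 2)) = 0 := by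
        linear_combination h + β ^ 2 * hπ
      have e2 := congrArg φ (hcan _ e)
      simp only [map_sub, map_add, map_mul, map_pow, hφπ, zero_mul, mul_zero, zero_add, sub_zero, map_zero, mul_eq_zero, hφπ', false_or] at e2
      simpa using e2
    obtain ⟨β', rfl⟩ := hdvd β h2
    have h3 : g' ^ 2 - (p : ℤ√2) * β' ^ 2 = η * n' ^ 2 := by
      have e : (⟨x, a⟩ : ℤ√2) * (⟨x, a⟩ * (g' ^ 2 - (p : ℤ√2) * β' ^ 2 - η * n' ^ 2)) = 0 := by linear_combination h
      have := hcan _ (hcan _ e)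
      linear_combination this
    rw [Zsqrtd.norm_mul]
    by_cases h0 : n'.norm = 0
    · rw [h0, mul_zero]
    · rw [ih g' β' n' h3 ?_, mul_zero]
      rw [Zsqrtd.norm_mul, Int.natAbs_mul] at hn
      have hnπ : (Zsqrtd.norm (⟨x, a⟩ : ℤ√2)).natAbs = p := by
        have : Zsqrtd.norm (⟨x, a⟩ : ℤ√2) = -p := by rw [Zsqrtd.norm_def]; linear_combination hax
        omega
      rw [hnπ] at hn
      have h9 : 9 ≤ p := by omega
      have : n'.norm.natAbs ≠ 0 := by omega
      nlinarith

end L6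

section L7

variable {A : Type*} [CommRing A] [IsDomain A] [IsPrincipalIdealRing A] {M : Type*} [Field M] [NumberField M] [Algebra A (𝓞 M)]
  {d : ℤ} {W T θ : 𝓞 M} {τ ρ : 𝓞 M ≃+* 𝓞 M}

theorem rep_dvd {p : ℕ} (hp : p.Prime) {a x : ℕ} (h : p + x ^ 2 = 2 * a ^ 2) (hc : Nat.Coprime a (2 * x)) (hp2 : p ≠ 2) :
    ¬ (p : ℤ) ∣ a ∧ ¬ (p : ℤ) ∣ x := by
  rw [Int.natCast_dvd_natCast, Int.natCast_dvd_natCast]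
  have key : p ∣ a → p ∣ 2 * x → False := fun h1 h2 => by
    have := Nat.dvd_gcd h1 h2
    rw [hc] at this
    exact hp.one_lt.ne' (Nat.dvd_one.mp this)
  have h1 : p ∣ a → p ∣ x := fun h1 => by
    have : p ∣ p + x ^ 2 := by rw [h]; exact (dvd_pow h1 two_ne_zero).mul_left _
    exact hp.dvd_of_dvd_pow ((Nat.dvd_add_right dvd_rfl).mp this)
  have h2 : p ∣ x → p ∣ a := fun h1 => by
    have : p ∣ 2 * a ^ 2 := by rw [← h]; exact dvd_add dvd_rfl (dvd_pow h1 two_ne_zero)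
    rcases hp.dvd_mul.mp this with h | h
    · exact (hp2 ((Nat.prime_dvd_prime_iff_eq hp Nat.prime_two).mp h)).elim
    · exact hp.dvd_of_dvd_pow h
  exact ⟨fun h => key h ((h1 h).mul_left _), fun h => key (h2 h) (h.mul_left _)⟩

namespace Bq

theorem neg_p (S : Bq A M d W T θ τ ρ) {p : ℕ} (hp : p.Prime) (h16 : p % 16 = 9) (hz : ∃ z : ZMod p, z ^ 4 = 2) (hd : d = p) : S.Neg := by
  intro γ x y a b hab hγ h
  obtain ⟨a', x', hax, -, -, hcop⟩ := exists_rep hp h16 hz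
  obtain ⟨hpa, hpx⟩ := rep_dvd hp hax hcop (by rintro rfl; omega)
  have hT2 := S.hT
  rw [hd] at hT2
  push_cast at hT2
  set ι : ℤ√2 →+* 𝓞 M := Zsqrtd.lift ⟨W, by rw [← pow_two, S.hW]; norm_num⟩ with hι
  have ιdef : ∀ z : ℤ√2, ι z = z.re + z.im * W := fun z => by rw [hι]; rfl
  have ιinj : Function.Injective ι := by
    intro z z' h
    rw [ιdef, ιdef] at h
    obtain ⟨h1, h2⟩ := S.indep2 h
    exact Zsqrtd.ext h1 h2
  obtain ⟨g0, g1, c, e, rfl⟩ := S.gen4 γ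
  have key : (⟨2 * g0 + c, 2 * g1 + e⟩ : ℤ√2) ^ 2 - (p : ℤ√2) * (⟨c, e⟩ : ℤ√2) ^ 2 = ⟨a, b⟩ * (2 * ⟨x, y⟩) ^ 2 := by
    apply ιinj
    simp only [map_sub, map_mul, map_pow, map_natCast, map_ofNat]
    simp only [ιdef]
    push_cast
    simp only [map_add, map_mul, map_intCast, S.τW, S.τθ] at h
    have hθ2 : 4 * (θ * (1 - θ)) = 1 - p := by
      linear_combination (1 - 2 * θ - T) * S.hθ - hT2
    linear_combination 4 * h - (c + e * W) ^ 2 * hθ2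
  have h0 := zs_desc hp h16 hz (a := a') (x := x') (by exact_mod_cast hax) hpa hpx (η := ⟨a, b⟩) hab _ _ _ _ key le_rfl
  have h1 : x ^ 2 - 2 * y ^ 2 = 0 := by
    have e2 : (2 : ℤ√2) = ⟨2, 0⟩ := rfl
    rw [Zsqrtd.norm_mul, e2, Zsqrtd.norm_def, Zsqrtd.norm_def] at h0
    simp only at h0
    linarith
  have hy : y = 0 := by
    by_contra hy
    apply rat_not_sq_two (x / y)
    have : (x : ℚ) ^ 2 - 2 * y ^ 2 = 0 := by exact_mod_cast congrArg (Int.cast : ℤ → ℚ) h1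
    have hy' : (y : ℚ) ≠ 0 := by exact_mod_cast hy
    field_simp
    linarith
  subst hy
  have hx : x = 0 := by
    apply pow_eq_zero_iff two_ne_zero |>.mp; linarith
  subst hx
  simp only [Int.cast_zero, zero_mul, add_zero, ne_eq, OfNat.ofNat_ne_zero, not_false_eq_true, zero_pow, mul_zero] at h
  rcases mul_eq_zero.mp h with h | h
  · exact hγ h
  · rw [EmbeddingLike.map_eq_zero_iff] at h
    exact hγ h

/-- the primes above `T` -/
theorem P_sq (S : Bq A M d W T θ τ ρ) {p : ℕ} {a x : ℤ} (hd : d = p) (hax : p + x ^ 2 = 2 * a ^ 2) {u v : ℤ} (huv : u * (2 * x) + v * p = 1) :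
    Ideal.span {(x + a * W : 𝓞 M), T} * Ideal.span {(x + a * W : 𝓞 M), T} = Ideal.span {(x + a * W : 𝓞 M)} ∧
    Ideal.span {(x + a * W : 𝓞 M), T} * Ideal.span {(x - a * W : 𝓞 M), T} = Ideal.span {T} := by
  have hT2 := S.hT
  rw [hd] at hT2
  push_cast at hT2
  have huv' : (u * (2 * x) + v * p : 𝓞 M) = 1 := by exact_mod_cast congrArg (Int.cast : ℤ → 𝓞 M) huv
  have hax' : (p + x ^ 2 : 𝓞 M) = 2 * a ^ 2 := by exact_mod_cast congrArg (Int.cast : ℤ → 𝓞 M) hax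
  have hπ : (x + a * W : 𝓞 M) * (x - a * W) = -T ^ 2 := by linear_combination hax' + hT2 - a ^ 2 * S.hW
  constructor
  · refine pair_mul_eq ⟨x + a * W, by ring⟩ ⟨T, by ring⟩ ⟨T, by ring⟩ ⟨-(x - a * W), by linear_combination hπ⟩
      (u - v * (x - a * W)) 0 0 (-u) ?_
    linear_combination -(x + a * W : 𝓞 M) * huv' - v * (x + a * W) * hT2 + (v * (x + a * W) + u) * hπ
  · refine pair_mul_eq ⟨-T, by linear_combination hπ⟩ ⟨x + a * W, by ring⟩ ⟨x - a * W, by ring⟩ ⟨T, by ring⟩ 0 u u (v * T) ?_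
    linear_combination -T * huv' - v * T * hT2

theorem P_norm (S : Bq A M d W T θ τ ρ) {p : ℕ} {a x : ℤ} (hax : p + x ^ 2 = 2 * a ^ 2) {P : Ideal (𝓞 M)}
    (h : P * P = Ideal.span {(x + a * W : 𝓞 M)}) : Ideal.absNorm P = p := by
  have h1 := absNorm_conj ρ (x + a * W : 𝓞 M)
  have hax' : (p + x ^ 2 : 𝓞 M) = 2 * a ^ 2 := by exact_mod_cast congrArg (Int.cast : ℤ → 𝓞 M) hax
  have hπ : (x + a * W : 𝓞 M) * ρ (x + a * W) = ((-p : ℤ) : 𝓞 M) := by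
    rw [S.ρform]; push_cast; linear_combination hax' - a ^ 2 * S.hW
  rw [hπ, absNorm_int, S.deg, ← h, map_mul, Int.natAbs_neg, Int.natAbs_natCast] at h1
  exact Nat.pow_left_injective (n := 4) (by norm_num) (by simp only [← h1]; ring)

end Bq

end L7

section L8

variable {A : Type*} [CommRing A] [IsDomain A] [IsPrincipalIdealRing A] {M : Type*} [Field M] [NumberField M] [Algebra A (𝓞 M)]
  {d : ℤ} {W T θ : 𝓞 M} {τ ρ : 𝓞 M ≃+* 𝓞 M}

theorem prod_two {P1 P2 : Ideal (𝓞 M)} {π1 π2 : 𝓞 M} (h1 : τ π1 = π1) (h2 : τ π2 = π2) (h10 : π1 ≠ 0) (h20 : π2 ≠ 0)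
    (h11 : P1 * P1 = Ideal.span {π1}) (h22 : P2 * P2 = Ideal.span {π2}) (h12 : P1 * P2 = Ideal.span {T}) (s : Multiset (Ideal (𝓞 M)))
    (hs : ∀ P ∈ s, P = P1 ∨ P = P2) : ∃ c : 𝓞 M, τ c = c ∧ c ≠ 0 ∧
      (s.prod = Ideal.span {c} ∨ s.prod = Ideal.span {c * T} ∨ s.prod = Ideal.span {c} * P1 ∨ s.prod = Ideal.span {c} * P2) := by
  induction s using Multiset.induction with
  | empty => exact ⟨1, by simp, one_ne_zero, Or.inl (by simp)⟩
  | cons P s ih =>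
    obtain ⟨c, hc, hc0, h⟩ := ih (fun P hP => hs P (Multiset.mem_cons_of_mem hP))
    rw [Multiset.prod_cons]
    have m : ∀ x y : 𝓞 M, Ideal.span {x * y} = Ideal.span {x} * Ideal.span {y} := fun x y => by rw [Ideal.span_singleton_mul_span_singleton]
    have hc1 : τ (c * π1) = c * π1 := by rw [map_mul, hc, h1]
    have hc2 : τ (c * π2) = c * π2 := by rw [map_mul, hc, h2]
    have hc10 := mul_ne_zero hc0 h10
    have hc20 := mul_ne_zero hc0 h20
    rcases hs P (Multiset.mem_cons_self P s) with rfl | rfl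
    · rcases h with h | h | h | h
      · exact ⟨c, hc, hc0, Or.inr (Or.inr (Or.inl (by rw [h, mul_comm])))⟩
      · exact ⟨c * π1, hc1, hc10, Or.inr (Or.inr (Or.inr (by rw [h, m, m, ← h12, ← h11]; ring)))⟩
      · exact ⟨c * π1, hc1, hc10, Or.inl (by rw [h, m, ← h11]; ring)⟩
      · exact ⟨c, hc, hc0, Or.inr (Or.inl (by rw [h, m, ← h12]; ring))⟩
    · rcases h with h | h | h | h
      · exact ⟨c, hc, hc0, Or.inr (Or.inr (Or.inr (by rw [h, mul_comm])))⟩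
      · exact ⟨c * π2, hc2, hc20, Or.inr (Or.inr (Or.inl (by rw [h, m, m, ← h12, ← h22]; ring)))⟩
      · exact ⟨c, hc, hc0, Or.inr (Or.inl (by rw [h, m, ← h12]; ring))⟩
      · exact ⟨c * π2, hc2, hc20, Or.inl (by rw [h, m, ← h22]; ring)⟩

theorem prin_of_mul {P : Ideal (𝓞 M)} {c β : 𝓞 M} (hc : c ≠ 0) (h : Ideal.span {β} = Ideal.span {c} * P) : P.IsPrincipal := by
  have h1 : β ∈ Ideal.span {c} := by
    have : β ∈ Ideal.span {c} * P := by rw [← h]; exact Ideal.mem_span_singleton_self β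
    exact Ideal.mul_le_right.trans le_rfl this |> fun _ => Ideal.mul_le_left this
  obtain ⟨κ, rfl⟩ := Ideal.mem_span_singleton.mp h1
  rw [← Ideal.span_singleton_mul_span_singleton] at h
  have hc' : Ideal.span {c} ≠ (0 : Ideal (𝓞 M)) := by simpa using hc
  exact ⟨κ, (mul_left_cancel₀ hc' h).symm⟩

theorem prin_of_prod {P Q : Ideal (𝓞 M)} {c : 𝓞 M} (hc : c ≠ 0) (h : P * Q = Ideal.span {c}) (hP : P.IsPrincipal) : Q.IsPrincipal := by
  obtain ⟨π, hπ⟩ := hP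
  have hπ : P = Ideal.span {π} := hπ
  subst hπ
  have h0 : π ≠ 0 := by
    rintro rfl
    rw [Ideal.span_singleton_eq_bot.mpr rfl] at h
    rw [Ideal.bot_mul] at h
    exact hc (Ideal.span_singleton_eq_bot.mp h.symm)
  exact prin_of_mul h0 h.symm

namespace Bq

theorem prin_aux (S : Bq A M d W T θ τ ρ) (hN : S.Neg) {P1 P2 : Ideal (𝓞 M)} {π1 π2 : 𝓞 M} (h1 : τ π1 = π1) (h2 : τ π2 = π2) (h10 : π1 ≠ 0) (h20 : π2 ≠ 0)
    (h11 : P1 * P1 = Ideal.span {π1}) (h22 : P2 * P2 = Ideal.span {π2}) (h12 : P1 * P2 = Ideal.span {T})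
    (hP : ∀ P : Ideal (𝓞 M), P.IsPrime → P ≠ ⊥ → T ∈ P → P = P1 ∨ P = P2) {e : 𝓞 M} (he : e * τ e = 1)
    (hns : ∀ v : 𝓞 M, v * τ v = 1 ∨ v * τ v = -1 → e ≠ v ^ 2 ∧ e ≠ -v ^ 2) : P1.IsPrincipal ∧ P2.IsPrincipal := by
  have hβ0 : 1 + e ≠ 0 := by
    intro h
    exact (hns 1 (Or.inl (by simp))).2 (by linear_combination h)
  have heu : IsUnit e := IsUnit.of_mul_eq_one _ he
  have hinv : (Ideal.span {1 + e}).map τ = Ideal.span {1 + e} := by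
    rw [S.inv.map_span]
    have : 1 + e = τ (1 + e) * e := by rw [map_add, map_one]; linear_combination -he
    nth_rw 2 [this]
    rw [Ideal.span_singleton_mul_right_unit heu]
  obtain ⟨α, s, hα, hs, hJ⟩ := S.inv.invariant _ (by simpa using hβ0) hinv
  obtain ⟨c, hc, hc0, hcs⟩ := prod_two (T := T) h1 h2 h10 h20 h11 h22 h12 s (fun P h => by
    obtain ⟨i1, i2, i3⟩ := hs P h
    rw [S.diff] at i3
    exact hP P i1 i2 i3)
  have hα0 : algebraMap A (𝓞 M) α ≠ 0 := by
    intro h; exact hα (S.inv.inj (by rw [h, map_zero]))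
  set α' := algebraMap A (𝓞 M) α with hα'
  have hατ : τ α' = α' := S.inv.com α
  have hb0 : α' * c ≠ 0 := mul_ne_zero hα0 hc0
  have hbτ : τ (α' * c) = α' * c := by rw [map_mul, hατ, hc]
  have bad : ∀ f : 𝓞 M, f ≠ 0 → (τ f = f ∨ τ f = -f) → Ideal.span {1 + e} = Ideal.span {f} → False := by
    intro f hf0 hf h
    obtain ⟨v, hv⟩ := Ideal.span_singleton_eq_span_singleton.mp h.symm
    have hv1 : e * τ (f * v) = f * v := by
      rw [hv, map_add, map_one]; linear_combination he
    rw [map_mul] at hv1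
    have hv2 : e * τ (v : 𝓞 M) = v ∨ e * τ (v : 𝓞 M) = -v := by
      rcases hf with hf | hf
      · left; rw [hf] at hv1; apply mul_left_cancel₀ hf0; linear_combination hv1
      · right; rw [hf] at hv1; apply mul_left_cancel₀ hf0; linear_combination -hv1
    obtain ⟨a, b, hab⟩ := S.norm_fixed (v : 𝓞 M)
    have hμu : IsUnit ((v : 𝓞 M) * τ v) := v.isUnit.mul (v.isUnit.map τ)
    obtain ⟨a', b', hu, hsq⟩ := S.unit_sq hN (γ := v) 1 0 a b v.ne_zero (hab ▸ hμu) (by rw [hab]; simp)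
    rw [← hab] at hsq
    obtain ⟨κ, hκ⟩ := hu.exists_right_inv
    have hκτ : τ κ = κ := by
      have h1 := congrArg τ hκ
      rw [map_mul, S.τform, map_one] at h1
      exact mul_left_cancel₀ hu.ne_zero (h1.trans hκ.symm)
    generalize (a' : 𝓞 M) + b' * W = ν at hsq hκ
    generalize (v : 𝓞 M) = v at hv2 hsq
    have hk2 : ν ^ 2 * κ ^ 2 = 1 := by rw [← mul_pow, hκ, one_pow]
    have hvv : (v * κ) * τ (v * κ) = 1 ∨ (v * κ) * τ (v * κ) = -1 := by
      rw [map_mul, hκτ]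
      rcases hsq with h | h
      · left; linear_combination κ ^ 2 * h + hk2
      · right; linear_combination κ ^ 2 * h - hk2
    obtain ⟨n1, n2⟩ := hns (v * κ) hvv
    rcases hsq with h | h <;> rcases hv2 with h' | h'
    · exact n1 (by linear_combination -e * hk2 + κ ^ 2 * v * h' - e * κ ^ 2 * h)
    · exact n2 (by linear_combination -e * hk2 + κ ^ 2 * v * h' - e * κ ^ 2 * h)
    · exact n2 (by linear_combination -e * hk2 - κ ^ 2 * v * h' + e * κ ^ 2 * h)
    · exact n1 (by linear_combination -e * hk2 - κ ^ 2 * v * h' + e * κ ^ 2 * h)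
  rcases hcs with h | h | h | h
  · rw [h, Ideal.span_singleton_mul_span_singleton] at hJ
    exact (bad _ hb0 (Or.inl hbτ) hJ).elim
  · rw [h, Ideal.span_singleton_mul_span_singleton, ← mul_assoc] at hJ
    refine (bad _ (mul_ne_zero hb0 S.T_ne) (Or.inr ?_) hJ).elim
    rw [map_mul, hbτ, S.τT, mul_neg]
  · rw [h, ← mul_assoc, Ideal.span_singleton_mul_span_singleton] at hJ
    have := prin_of_mul hb0 hJ
    exact ⟨this, prin_of_prod S.T_ne h12 this⟩
  · rw [h, ← mul_assoc, Ideal.span_singleton_mul_span_singleton] at hJ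
    have := prin_of_mul hb0 hJ
    exact ⟨prin_of_prod S.T_ne (by rw [mul_comm]; exact h12) this, this⟩

theorem norm_sq_neg (S : Bq A M d W T θ τ ρ) (hd : 0 < d) {v : 𝓞 M} {X Y : ℤ} (hXY : X ≠ 0)
    (h : (v * ρ v) ^ 2 = -(X + Y * T) ^ 2) : False := by
  obtain ⟨a, c, hac⟩ := S.ρfix (x := v * ρ v) (by rw [map_mul, S.ρρ, mul_comm])
  have h1 : ((a ^ 2 + d * c ^ 2 + 4 * (X ^ 2 + d * Y ^ 2) : ℤ) : 𝓞 M) + ((0 : ℤ) : 𝓞 M) * W + (((2 * a * c + 8 * X * Y : ℤ) : 𝓞 M) + ((0 : ℤ) : 𝓞 M) * W) * T = 0 := by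
    push_cast
    linear_combination 4 * h - (2 * (v * ρ v) + a + c * T) * hac - (c ^ 2 + 4 * Y ^ 2) * S.hT
  obtain ⟨h2, -⟩ := S.indep _ _ _ _ h1
  have : 0 < X ^ 2 := by positivity
  have : 0 ≤ d * c ^ 2 := by positivity
  have : 0 ≤ d * Y ^ 2 := by positivity
  nlinarith [sq_nonneg a]

theorem exists_e (S : Bq A M d W T θ τ ρ) {p : ℕ} (hp : p.Prime) (h16 : p % 16 = 9) (hd : d = p) : ∃ e : 𝓞 M, e * τ e = 1 ∧
    ∀ v : 𝓞 M, v * τ v = 1 ∨ v * τ v = -1 → e ≠ v ^ 2 ∧ e ≠ -v ^ 2 := by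
  have hT2 := S.hT
  rw [hd] at hT2
  push_cast at hT2
  have hd0 : 0 < d := by rw [hd]; exact_mod_cast hp.pos
  obtain ⟨X, Y, hXY⟩ := pell_neg_one hp (by omega)
  have hX : X ≠ 0 := by
    rintro rfl
    have : (p : ℤ) * Y ^ 2 = 1 := by linarith
    have := Int.eq_one_or_neg_one_of_mul_eq_one this
    omega
  have hXY' : (X ^ 2 - p * Y ^ 2 : 𝓞 M) = -1 := by exact_mod_cast congrArg (Int.cast : ℤ → 𝓞 M) hXY
  have hετ : (X + Y * T : 𝓞 M) * τ (X + Y * T) = -1 := by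
    simp only [map_add, map_mul, map_intCast, S.τT]; linear_combination hXY' - Y ^ 2 * hT2
  have hερ : ρ (X + Y * T : 𝓞 M) = X + Y * T := by
    simp only [map_add, map_mul, map_intCast, S.ρT]
  have sq_ρ : ∀ e v : 𝓞 M, (e = v ^ 2 ∨ e = -v ^ 2) → e * ρ e = (v * ρ v) ^ 2 := by
    rintro e v (rfl | rfl)
    · rw [map_pow]; ring
    · rw [map_neg, map_pow]; ring
  have key1 : ∀ e : 𝓞 M, e * τ e = 1 → e * ρ e = -1 → ∃ e : 𝓞 M, e * τ e = 1 ∧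
    ∀ v : 𝓞 M, v * τ v = 1 ∨ v * τ v = -1 → e ≠ v ^ 2 ∧ e ≠ -v ^ 2 := by
    intro e h1 h2
    refine ⟨e, h1, fun v _ => ?_⟩
    rw [← not_or]
    intro h
    have h3 := sq_ρ e v h
    exact S.norm_sq_neg hd0 (X := 1) (Y := 0) one_ne_zero (by rw [← h3, h2]; simp)
  have key2 : ∀ f : 𝓞 M, f * τ f = -1 → (f * ρ f = -1 ∨ f * ρ f = 1) → ∃ e : 𝓞 M, e * τ e = 1 ∧
    ∀ v : 𝓞 M, v * τ v = 1 ∨ v * τ v = -1 → e ≠ v ^ 2 ∧ e ≠ -v ^ 2 := by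
    intro f h1 h2
    refine ⟨f * (X + Y * T), ?_, fun v hv => ?_⟩
    · rw [map_mul]; linear_combination (X + Y * T) * τ (X + Y * T : 𝓞 M) * h1 - hετ
    rw [← not_or]
    intro h
    have h3 := sq_ρ _ v h
    rw [map_mul, hερ] at h3
    rcases h2 with h2 | h2
    · exact S.norm_sq_neg hd0 (v := v) (X := X) (Y := Y) hX (by linear_combination -h3 + (X + Y * T : 𝓞 M) ^ 2 * h2)
    · have h4 : (v * ρ v) ^ 2 = (X + Y * T : 𝓞 M) ^ 2 := by linear_combination -h3 + (X + Y * T : 𝓞 M) ^ 2 * h2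
      have h5 : (v * ρ v) * τ (v * ρ v) = -1 := by
        rcases sq_eq_sq_iff_eq_or_eq_neg.mp h4 with h | h
        · rw [h, hετ]
        · rw [h, map_neg, neg_mul_neg, hετ]
      have h6 : (v * ρ v) * τ (v * ρ v) = (v * τ v) * ρ (v * τ v) := by
        rw [map_mul, map_mul, S.comm]; ring
      rw [h6] at h5
      have h7 : (2 : 𝓞 M) = 0 := by
        rcases hv with hv | hv
        · rw [hv, map_one] at h5; linear_combination h5
        · rw [hv, map_neg, map_one] at h5; linear_combination h5
      exact two_ne_zero h7
  obtain ⟨a, b, x, y, hab, h, hb⟩ := pell_split (2 * p) (by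
    rintro ⟨k, hk⟩
    have h2 : 2 ∣ k := by
      have : 2 ∣ k * k := ⟨p, hk.symm⟩
      rcases Nat.prime_two.dvd_mul.mp this with h | h <;> exact h
    obtain ⟨l, rfl⟩ := h2
    have : p = 2 * (l * l) := by nlinarith
    omega) (by omega)
  have hbd : b = 1 ∨ b = 2 ∨ b = p ∨ b = 2 * p := by
    have hb' : b ∣ 2 * p := ⟨a, by rw [mul_comm b]; exact hab.symm⟩
    obtain ⟨b1, b2, h1, h2, rfl⟩ := (Nat.dvd_mul).mp hb'
    rcases (Nat.dvd_prime Nat.prime_two).mp h1 with rfl | rfl <;> rcases (Nat.dvd_prime hp).mp h2 with rfl | rfl <;> simp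
  have h' : (b * y ^ 2 : 𝓞 M) = a * x ^ 2 + 1 := by exact_mod_cast congrArg (Nat.cast : ℕ → 𝓞 M) h
  have hp0 := hp.pos
  rcases hbd with rfl | rfl | rfl | rfl
  · exact (hb rfl).elim
  · have ha : a = p := by omega
    subst ha
    push_cast at h'
    refine key1 (y * W + x * T) ?_ ?_
    · simp only [map_add, map_mul, map_natCast, S.τT, S.τW]; linear_combination h' + y ^ 2 * S.hW - x ^ 2 * hT2
    · simp only [map_add, map_mul, map_natCast, S.ρT, S.ρW]; linear_combination -h' - y ^ 2 * S.hW + x ^ 2 * hT2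
  · have ha : a = 2 := Nat.eq_of_mul_eq_mul_right hp0 hab
    subst ha
    push_cast at h'
    refine key2 (x * W + y * T) ?_ (Or.inr ?_)
    · simp only [map_add, map_mul, map_natCast, S.τT, S.τW]; linear_combination -h' + x ^ 2 * S.hW - y ^ 2 * hT2
    · simp only [map_add, map_mul, map_natCast, S.ρT, S.ρW]; linear_combination h' - x ^ 2 * S.hW + y ^ 2 * hT2
  · have ha : a = 1 := Nat.eq_of_mul_eq_mul_right (by omega : 0 < 2 * p) (by rw [hab, one_mul])
    subst ha
    push_cast at h'
    refine key2 (x + y * (W * T)) ?_ (Or.inl ?_)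
    · simp only [map_add, map_mul, map_natCast, S.τT, S.τW]; linear_combination -h' - y ^ 2 * (T ^ 2 * S.hW + 2 * hT2)
    · simp only [map_add, map_mul, map_natCast, S.ρT, S.ρW]; linear_combination -h' - y ^ 2 * (T ^ 2 * S.hW + 2 * hT2)

theorem odd_p (S : Bq A M d W T θ τ ρ) {p : ℕ} (hp : p.Prime) (h16 : p % 16 = 9) (hz : ∃ z : ZMod p, z ^ 4 = 2) (hd : d = p) :
    Odd (classNumber M) := by
  have hT2 := S.hT
  rw [hd] at hT2
  push_cast at hT2
  have hN := S.neg_p hp h16 hz hd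
  obtain ⟨X, Y, hXY⟩ := pell_neg_one hp (by omega)
  have hXY' : (X ^ 2 - p * Y ^ 2 : 𝓞 M) = -1 := by exact_mod_cast congrArg (Int.cast : ℤ → 𝓞 M) hXY
  obtain ⟨a, x, hax, -, -, hcop⟩ := exists_rep hp h16 hz
  obtain ⟨hpa, hpx⟩ := rep_dvd hp hax hcop (by rintro rfl; omega)
  have hax1 : (p : ℤ) + (x : ℤ) ^ 2 = 2 * (a : ℤ) ^ 2 := by exact_mod_cast hax
  have hax2 : (p : ℤ) + (x : ℤ) ^ 2 = 2 * (-(a : ℤ)) ^ 2 := by rw [hax1]; ring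
  have hcop2 : IsCoprime (2 * (x : ℤ)) p := by
    have hpp : Prime (p : ℤ) := Nat.prime_iff_prime_int.mp hp
    refine (hpp.coprime_iff_not_dvd.mpr ?_).symm
    intro h
    rcases hpp.dvd_or_dvd h with h | h
    · have := Int.le_of_dvd (by norm_num) h
      omega
    · exact hpx h
  obtain ⟨u, v, huv⟩ := hcop2
  obtain ⟨s1, s12⟩ := S.P_sq hd hax1 huv
  obtain ⟨s2, -⟩ := S.P_sq hd hax2 huv
  have n1 := S.P_norm hax1 s1
  have n2 := S.P_norm hax2 s2
  have e2 : ((x : ℤ) : 𝓞 M) + ((-(a : ℤ) : ℤ) : 𝓞 M) * W = (x : ℤ) - (a : ℤ) * W := by push_cast; ring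
  have hprod : (((x : ℤ) : 𝓞 M) + (a : ℤ) * W) * (((x : ℤ) : 𝓞 M) - (a : ℤ) * W) = -T ^ 2 := by
    have hax' : (p + x ^ 2 : 𝓞 M) = 2 * a ^ 2 := by exact_mod_cast congrArg (Nat.cast : ℕ → 𝓞 M) hax
    push_cast; linear_combination hax' + hT2 - a ^ 2 * S.hW
  have hne : (((x : ℤ) : 𝓞 M) + (a : ℤ) * W) * (((x : ℤ) : 𝓞 M) - (a : ℤ) * W) ≠ 0 := by
    rw [hprod]; exact neg_ne_zero.mpr (pow_ne_zero 2 S.T_ne)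
  have t2 := S.τform (x : ℤ) (-(a : ℤ))
  rw [e2] at s2 n2 t2
  have hP : ∀ P : Ideal (𝓞 M), P.IsPrime → P ≠ ⊥ → T ∈ P → P = Ideal.span {(((x : ℤ) : 𝓞 M) + (a : ℤ) * W), T} ∨
      P = Ideal.span {(((x : ℤ) : 𝓞 M) - (a : ℤ) * W), T} := by
    intro P hP _ hT
    have h1 : (((x : ℤ) : 𝓞 M) + (a : ℤ) * W) * (((x : ℤ) : 𝓞 M) - (a : ℤ) * W) ∈ P := by
      rw [hprod]; exact P.neg_mem (P.pow_mem_of_mem hT 2 (by norm_num))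
    rcases hP.mem_or_mem h1 with h | h
    · left
      refine eq_of_prime_norm (by rw [n1]; exact hp) hP ?_
      rw [Ideal.span_le]
      rintro y (rfl | rfl)
      · exact h
      · exact hT
    · right
      refine eq_of_prime_norm (by rw [n2]; exact hp) hP ?_
      rw [Ideal.span_le]
      rintro y (rfl | rfl)
      · exact h
      · exact hT
  obtain ⟨e, he, hns⟩ := S.exists_e hp h16 hd
  obtain ⟨p1, p2⟩ := S.prin_aux hN (S.τform _ _) t2 (left_ne_zero_of_mul hne) (right_ne_zero_of_mul hne) s1 s2 s12 hP he hns
  refine S.odd hN (u := X + Y * T) ?_ ?_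
  · simp only [map_add, map_mul, map_intCast, S.τT]; linear_combination hXY' - Y ^ 2 * hT2
  · intro P h1 h2 h3
    rcases hP P h1 h2 h3 with rfl | rfl
    · exact p1
    · exact p2

end Bq

end L8

section N

theorem Setup.final {L : Type*} [Field L] [NumberField L] {d : ℕ} {i w t : L} (S : Setup L (d : ℤ) i w t)
    (hd : (∃ p q : ℕ, p.Prime ∧ q.Prime ∧ p % 8 = 3 ∧ q % 8 = 3 ∧ p ≠ q ∧ d = p * q) ∨
          (d.Prime ∧ d % 16 = 9 ∧ ∃ x : ZMod d, x ^ 4 = 2)) :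
    ∃ x y : ℕ, Odd x ∧ Odd y ∧ classNumber L * x = classNumber ℚ⟮i * w * t⟯ * y := by
  haveI := S.isCMField
  obtain ⟨x, y, hx, hy, h⟩ := S.class_formula2
  rw [S.indexRealUnits_eq_one, one_mul] at h
  have hreal : Odd (classNumber (maximalRealSubfield L)) := by
    have hb := S.isBiq
    obtain ⟨W, T, θ, τ, ρ, B⟩ := hb.exists_bq
    haveI := pid_w hb.hw
    rcases hd with ⟨p, q, hp, hq, h8, h8', hpq, rfl⟩ | ⟨hp, h16, hz⟩
    · exact B.odd_pq hp hq h8 h8' hpq (by push_cast; rfl)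
    · exact B.odd_p hp h16 hz rfl
  have h4 : ∃ m, Odd m ∧ classNumber ℚ⟮i * t⟯ = 4 * m := by
    have hsf : Squarefree d := by exact_mod_cast Int.squarefree_natCast.mp S.hd
    have k8 : d % 8 = 1 := by have := S.hd8; omega
    obtain ⟨τ, R, I⟩ := S.q3.imag hsf k8
    rcases hd with ⟨p, q, hp, hq, h8, h8', hpq, rfl⟩ | ⟨hp, h16, hz⟩
    · exact I.pq hp hq h8 h8' hpq
    · exact I.p hp h16 hz
  obtain ⟨m, hm, hm4⟩ := h4
  rw [hm4] at h
  refine ⟨x, classNumber (maximalRealSubfield L) * m * y, hx, (hreal.mul hm).mul hy, ?_⟩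
  apply Nat.eq_of_mul_eq_mul_left (by norm_num : 0 < 4)
  linarith

theorem primary_of_odd {G H : Type*} [CommGroup G] [CommGroup H] [Finite G] [Finite H] {x y : ℕ} (hx : Odd x) (hy : Odd y)
    (h : Nat.card G * x = Nat.card H * y) : Nat.card (CommGroup.primaryComponent G 2) = Nat.card (CommGroup.primaryComponent H 2) := by
  have hx0 : x ≠ 0 := by rintro rfl; simp at hx
  have hy0 : y ≠ 0 := by rintro rfl; simp at hy
  have h1 := congrArg (fun n => n.factorization 2) h
  simp only [Nat.factorization_mul Nat.card_pos.ne' hx0, Nat.factorization_mul Nat.card_pos.ne' hy0, Finsupp.add_apply,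
    Nat.factorization_eq_zero_of_not_dvd hx.not_two_dvd_nat, Nat.factorization_eq_zero_of_not_dvd hy.not_two_dvd_nat, add_zero] at h1
  rw [card_primary, card_primary, h1]

theorem Lfield_eq (d : ℕ) : Lfield 1 (d : ℤ) = IntermediateField.adjoin ℚ {Complex.I, ((√2 : ℝ) : ℂ), ((√(d : ℝ) : ℝ) : ℂ)} := by
  have h2 : ((√2 : ℝ) : ℂ) ^ 2 = 2 := by
    rw [← Complex.ofReal_pow, Real.sq_sqrt (by norm_num)]; norm_num
  have hdd : ((√(d : ℝ) : ℝ) : ℂ) ^ 2 = d := by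
    rw [← Complex.ofReal_pow, Real.sq_sqrt (by positivity)]; norm_num
  have h20 : ((√2 : ℝ) : ℂ) ≠ 0 := by intro h; rw [h] at h2; norm_num at h2
  generalize ((√2 : ℝ) : ℂ) = w at *
  generalize ((√(d : ℝ) : ℝ) : ℂ) = t at *
  have hI := Complex.I_sq
  generalize Complex.I = i at *
  apply le_antisymm
  · rw [Lfield, IntermediateField.adjoin_le_iff]
    have mi : i ∈ IntermediateField.adjoin ℚ {i, w, t} := IntermediateField.subset_adjoin _ _ (by simp)
    have mw : w ∈ IntermediateField.adjoin ℚ {i, w, t} := IntermediateField.subset_adjoin _ _ (by simp)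
    have mt : t ∈ IntermediateField.adjoin ℚ {i, w, t} := IntermediateField.subset_adjoin _ _ (by simp)
    generalize IntermediateField.adjoin ℚ {i, w, t} = F at *
    have m2 : (2 : ℂ) ∈ F := by rw [← h2]; exact pow_mem mw 2
    have mz : (1 + i) * w / 2 ∈ F := div_mem (mul_mem (add_mem (one_mem _) mi) mw) m2
    have hz : ((1 + i) * w / 2) ^ 2 = i := by linear_combination (1 + i) ^ 2 / 4 * h2 + hI / 2
    generalize (1 + i) * w / 2 = ζ at mz hz
    rintro z (hz8 | hzd)
    · have hz8 : z ^ 8 = 1 := hz8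
      have : (z - 1) * (z + 1) * (z - i) * (z + i) * (z - ζ) * (z + ζ) * (z - i * ζ) * (z + i * ζ) = 0 := by
        have e : (z - 1) * (z + 1) * (z - i) * (z + i) * (z - ζ) * (z + ζ) * (z - i * ζ) * (z + i * ζ) =
          (z ^ 2 - 1) * (z ^ 2 - i ^ 2) * (z ^ 2 - ζ ^ 2) * (z ^ 2 - i ^ 2 * ζ ^ 2) := by ring
        rw [e, hz, hI]
        linear_combination hz8 - (z ^ 4 - 1) * hI
      simp only [mul_eq_zero, sub_eq_zero, add_eq_zero_iff_eq_neg, or_assoc] at this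
      rcases this with h | h | h | h | h | h | h | h <;> rw [h]
      · exact one_mem _
      · exact neg_mem (one_mem _)
      · exact mi
      · exact neg_mem mi
      · exact mz
      · exact neg_mem mz
      · exact mul_mem mi mz
      · exact neg_mem (mul_mem mi mz)
    · have hzd : z ^ 2 = ((d : ℤ) : ℂ) := hzd
      have : z ^ 2 = t ^ 2 := by rw [hzd, hdd]; norm_num
      rcases sq_eq_sq_iff_eq_or_eq_neg.mp this with h | h
      · rw [h]; exact mt
      · rw [h]; exact neg_mem mt
  · rw [IntermediateField.adjoin_le_iff]
    have m8 : ∀ z : ℂ, z ^ 8 = 1 → z ∈ Lfield 1 (d : ℤ) := fun z hz => IntermediateField.subset_adjoin _ _ (Or.inl hz)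
    have mi : i ∈ Lfield 1 (d : ℤ) := m8 i (by rw [show i ^ 8 = (i ^ 2) ^ 4 by ring, hI]; norm_num)
    have hz : ((1 + i) * w / 2) ^ 2 = i := by linear_combination (1 + i) ^ 2 / 4 * h2 + hI / 2
    have mz : (1 + i) * w / 2 ∈ Lfield 1 (d : ℤ) := m8 _ (by
      rw [show ((1 + i) * w / 2) ^ 8 = (((1 + i) * w / 2) ^ 2) ^ 4 by ring, hz, show i ^ 4 = (i ^ 2) ^ 2 by ring, hI]; norm_num)
    rintro z (rfl | rfl | rfl)
    · exact mi
    · have : z = (1 + i) * z / 2 * (1 - i) := by linear_combination z / 2 * hI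
      rw [this]
      exact mul_mem mz (sub_mem (one_mem _) mi)
    · exact IntermediateField.subset_adjoin _ _ (Or.inr (by simpa using hdd))

theorem quadField_eq (m : ℤ) {r : ℂ} (hr : r ^ 2 = m) : quadField m = ℚ⟮r⟯ := by
  apply le_antisymm
  · rw [quadField, IntermediateField.adjoin_le_iff]
    intro z hz
    have hz : z ^ 2 = (m : ℂ) := hz
    rcases sq_eq_sq_iff_eq_or_eq_neg.mp (hz.trans hr.symm) with h | h
    · rw [h]; exact mem_adjoin_simple_self ℚ r
    · rw [h]; exact neg_mem (mem_adjoin_simple_self ℚ r)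
  · rw [IntermediateField.adjoin_simple_le_iff]
    exact IntermediateField.subset_adjoin _ _ hr

theorem card_congr_field {K K' : IntermediateField ℚ ℂ} (h : K = K') :
    Nat.card (twoClassGroup K) = Nat.card (twoClassGroup K') := by subst h; rfl

theorem final_thm
    (d : ℕ)
    (hd : (∃ p q : ℕ, p.Prime ∧ q.Prime ∧ p % 8 = 3 ∧ q % 8 = 3 ∧ p ≠ q ∧ d = p * q) ∨
          (d.Prime ∧ d % 16 = 9 ∧ ∃ x : ZMod d, x ^ 4 = 2)) :
    Nat.card (twoClassGroup (Lfield 1 (d : ℤ))) = h2 (-2 * (d : ℤ)) := by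
  have h8 : d % 8 = 1 := by
    rcases hd with ⟨p, q, hp, hq, h8, h8', hpq, rfl⟩ | ⟨hp, h16, hz⟩
    · rw [Nat.mul_mod, h8, h8']
    · omega
  have h1 : 1 < d := by
    rcases hd with ⟨p, q, hp, hq, h8, h8', hpq, rfl⟩ | ⟨hp, h16, hz⟩
    · have := hp.one_lt; have := hq.one_lt; nlinarith
    · exact hp.one_lt
  have hsf : Squarefree d := by
    rcases hd with ⟨p, q, hp, hq, h8, h8', hpq, rfl⟩ | ⟨hp, h16, hz⟩
    · exact (Nat.squarefree_mul ((Nat.coprime_primes hp hq).mpr hpq)).mpr ⟨hp.prime.squarefree, hq.prime.squarefree⟩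
    · exact hp.prime.squarefree
  have e2 : ((√2 : ℝ) : ℂ) ^ 2 = 2 := by
    rw [← Complex.ofReal_pow, Real.sq_sqrt (by norm_num)]; norm_num
  have edd : ((√(d : ℝ) : ℝ) : ℂ) ^ 2 = d := by
    rw [← Complex.ofReal_pow, Real.sq_sqrt (by positivity)]; norm_num
  have eI := Complex.I_sq
  have hL := Lfield_eq d
  generalize ((√2 : ℝ) : ℂ) = w at *
  generalize ((√(d : ℝ) : ℝ) : ℂ) = t at *
  generalize Complex.I = i at *
  have mi : i ∈ Lfield 1 (d : ℤ) := by rw [hL]; exact IntermediateField.subset_adjoin _ _ (by simp)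
  have mw : w ∈ Lfield 1 (d : ℤ) := by rw [hL]; exact IntermediateField.subset_adjoin _ _ (by simp)
  have mt : t ∈ Lfield 1 (d : ℤ) := by rw [hL]; exact IntermediateField.subset_adjoin _ _ (by simp)
  have hintegral : ∀ z : ℂ, ∀ n : ℤ, z ^ 2 = n → IsIntegral ℚ z := by
    intro z n hz
    refine IsIntegral.of_pow (n := 2) (by norm_num) ?_
    rw [hz]
    have h := isIntegral_algebraMap (R := ℚ) (A := ℂ) (x := (n : ℚ))
    rwa [map_intCast] at h
  haveI : FiniteDimensional ℚ (Lfield 1 (d : ℤ)) := by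
    rw [hL]
    apply IntermediateField.finiteDimensional_adjoin
    rintro z (rfl | rfl | rfl)
    · exact hintegral _ (-1) (by rw [eI]; norm_num)
    · exact hintegral _ 2 (by rw [e2]; norm_num)
    · exact hintegral _ d (by rw [edd]; norm_num)
  haveI : NumberField (Lfield 1 (d : ℤ)) := { to_charZero := inferInstance, to_finiteDimensional := by convert this }
  set f := (algebraMap (Lfield 1 (d : ℤ)) ℂ).toRatAlgHom with hf
  have S : Setup (Lfield 1 (d : ℤ)) (d : ℤ) ⟨i, mi⟩ ⟨w, mw⟩ ⟨t, mt⟩ := by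
    refine ⟨Subtype.ext (by simpa using eI), Subtype.ext e2, Subtype.ext (by simpa using edd), ?_, by exact_mod_cast h1,
      by omega, by exact_mod_cast Int.squarefree_natCast.mpr hsf⟩
    rw [eq_top_iff]
    intro x _
    have hx : f x ∈ IntermediateField.adjoin ℚ {i, w, t} := by rw [← hL]; exact x.2
    have hmap := IntermediateField.adjoin_map ℚ {(⟨i, mi⟩ : Lfield 1 (d : ℤ)), ⟨w, mw⟩, ⟨t, mt⟩} f
    rw [Set.image_insert_eq, Set.image_insert_eq, Set.image_singleton] at hmap
    have hx' : f x ∈ (IntermediateField.adjoin ℚ {(⟨i, mi⟩ : Lfield 1 (d : ℤ)), ⟨w, mw⟩, ⟨t, mt⟩}).map f := by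
      rw [hmap]; exact hx
    obtain ⟨y, hy, hyx⟩ := hx'
    rwa [← f.injective hyx]
  obtain ⟨x, y, hx, hy, h⟩ := S.final hd
  have hmap := IntermediateField.adjoin_map ℚ {(⟨i, mi⟩ * ⟨w, mw⟩ * ⟨t, mt⟩ : Lfield 1 (d : ℤ))} f
  rw [Set.image_singleton] at hmap
  have hq : quadField (-2 * (d : ℤ)) = (ℚ⟮(⟨i, mi⟩ * ⟨w, mw⟩ * ⟨t, mt⟩ : Lfield 1 (d : ℤ))⟯).map f := by
    rw [hmap]
    apply quadField_eq
    rw [← map_pow, mul_pow, mul_pow, S.hi, S.hw, S.ht, map_mul, map_mul, map_neg, map_one, map_ofNat, map_intCast]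
    push_cast; ring
  rw [h2, card_congr_field hq]
  have e := ClassGroup.mulEquiv (RingOfIntegers.mapRingEquiv
    (IntermediateField.equivMap (ℚ⟮(⟨i, mi⟩ * ⟨w, mw⟩ * ⟨t, mt⟩ : Lfield 1 (d : ℤ))⟯) f).toRingEquiv)
  haveI := Finite.of_equiv _ e.toEquiv
  refine primary_of_odd hx hy ?_
  rw [← Nat.card_congr e.toEquiv, Nat.card_eq_fintype_card, Nat.card_eq_fintype_card]
  exact h

end N

/-- for `d = pq` with primes `p ≡ q ≡ 3 (mod 8)`, or `d = p` a prime
`≡ 9 (mod 16)` with `2` a fourth power residue mod `p`, the 2-class number of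
`L_{1,d} = ℚ(ζ₈, √d)` equals `h₂(-2d)`. -/
theorem twoClassNumber_Lfield_one_eq
    (d : ℕ)
    (hd : (∃ p q : ℕ, p.Prime ∧ q.Prime ∧ p % 8 = 3 ∧ q % 8 = 3 ∧ p ≠ q ∧ d = p * q) ∨
          (d.Prime ∧ d % 16 = 9 ∧ ∃ x : ZMod d, x ^ 4 = 2)) :
    Nat.card (twoClassGroup (Lfield 1 (d : ℤ))) = h2 (-2 * (d : ℤ)) := by
  exact final_thm d hd
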